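/- arXiv:2506.23264 — 2 statements merged into one kernel-verified Lean document; each statement's English description precedes it below -/
import Mathlib

section
/- For every integer k ≥ 2 and every δ > 0, there exist a constant c > 0 and an integer n₀ such that the following holds for all n ≥ n₀: for any collection G₁, …, G_{g(k)+2} of k-uniform hypergraphs on n vertices, each satisfying δ·n^k ≤ e(G_i) ≤ C(n,k) − δ·n^k, there exist indices i < j with disc(G_i, G_j) ≥ c·n^{(k+1)/2}. -/
open Finset

/-- Image of the edge set of a hypergraph under a vertex permutation. -/
def permEdges {n : ℕ} (σ : Equiv.Perm (Fin n)) (G : Finset (Finset (Fin n))) :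
    Finset (Finset (Fin n)) := G.image (fun e => e.image σ)

/-- Relative discrepancy of two k-uniform hypergraphs on n vertices:
the maximum over all relabelings G' ≅ G, H' ≅ H on the same vertex set of
| |E(G') ∩ E(H')| - p q C(n,k) |, where p q C(n,k) = e(G) e(H) / C(n,k). -/
noncomputable def disc (n k : ℕ) (G H : Finset (Finset (Fin n))) : ℝ :=
  ⨆ p : Equiv.Perm (Fin n) × Equiv.Perm (Fin n),
    |((permEdges p.1 G ∩ permEdges p.2 H).card : ℝ) -
      ((G.card : ℝ) * H.card) / (n.choose k)|

/-- g(k): the smallest g ≥ 0 such that for every m ∈ [2,k], the binary system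
Σ_{0 ≤ i ≤ r} (-1)^i C(r,i) α_i = 0 (r = m-g, ..., m) with α ∈ {0,1}^{m+1}
has only the all-zero and all-one solutions. -/
noncomputable def gDef (k : ℕ) : ℕ :=
  sInf {g : ℕ |
    ∀ m : ℕ, 2 ≤ m → m ≤ k →
      ∀ α : ℕ → Bool,
        (∀ r ∈ Finset.Icc (m - g) m,
          ∑ i ∈ Finset.range (r + 1),
            (-1 : ℤ) ^ i * (r.choose i) * (if α i then 1 else 0) = 0) →
        ∀ i ≤ m, α i = α 0}



lemma gDef_mem (k : ℕ) (hk : 2 ≤ k) : (k - 1) ∈ {g : ℕ |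
    ∀ m : ℕ, 2 ≤ m → m ≤ k →
      ∀ α : ℕ → Bool,
        (∀ r ∈ Finset.Icc (m - g) m,
          ∑ i ∈ Finset.range (r + 1),
            (-1 : ℤ) ^ i * (r.choose i) * (if α i then 1 else 0) = 0) →
        ∀ i ≤ m, α i = α 0} := by
  intro m hm hmk α h i
  induction i using Nat.strong_induction_on with
  | _ i ih =>
    intro him
    rcases Nat.eq_zero_or_pos i with h0 | h0
    · rw [h0]
    have h1 := h i (by rw [Finset.mem_Icc]; omega)
    rw [Finset.sum_range_succ] at h1
    have h2 : ∑ j ∈ Finset.range i, (-1 : ℤ) ^ j * (i.choose j) * (if α j then 1 else 0)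
        = ∑ j ∈ Finset.range i, (-1 : ℤ) ^ j * (i.choose j) * (if α 0 then 1 else 0) := by
      refine Finset.sum_congr rfl fun j hj => ?_
      rw [ih j (Finset.mem_range.1 hj) (by have := Finset.mem_range.1 hj; omega)]
    have h3 := Int.alternating_sum_range_choose_of_ne (n := i) (by omega)
    rw [Finset.sum_range_succ] at h3
    rw [h2, ← Finset.sum_mul] at h1
    simp only [Nat.choose_self, Nat.cast_one, mul_one] at h1 h3
    have h4 : (-1 : ℤ) ^ i * ((if α i then 1 else 0) - (if α 0 then 1 else 0)) = 0 := by
      linear_combination h1 - (if α 0 then 1 else 0) * h3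
    have h5 : ((if α i then 1 else 0 : ℤ) - (if α 0 then 1 else 0)) = 0 := by
      rcases mul_eq_zero.1 h4 with h6 | h6
      · exact absurd h6 (by positivity)
      · exact h6
    cases h7 : α i <;> cases h8 : α 0 <;> simp [h7, h8] at h5 ⊢

lemma gDef_spec (k : ℕ) (hk : 2 ≤ k) :
    ∀ m : ℕ, 2 ≤ m → m ≤ k →
      ∀ α : ℕ → Bool,
        (∀ r ∈ Finset.Icc (m - gDef k) m,
          ∑ i ∈ Finset.range (r + 1),
            (-1 : ℤ) ^ i * (r.choose i) * (if α i then 1 else 0) = 0) →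
        ∀ i ≤ m, α i = α 0 :=
  Nat.sInf_mem ⟨_, gDef_mem k hk⟩

lemma gDef_le (k : ℕ) (hk : 2 ≤ k) : gDef k ≤ k - 1 := Nat.sInf_le (gDef_mem k hk)

/-- Alternating sum over the coordinates in `A`. -/
def DD {k : ℕ} {V : Type*} (F : (Fin k → V) → ℤ) (A : Finset (Fin k)) (x y : Fin k → V) : ℤ :=
  ∑ B ∈ A.powerset, (-1) ^ B.card * F (B.piecewise y x)

lemma map_three {k : ℕ} {Q : Type*} (M B : Finset (Fin k)) (hB : B ⊆ M)
    (p q : Q) (u w : Fin k → Q) (hw1 : ∀ i ∈ B, w i = q) (hw2 : ∀ i ∈ M, i ∉ B → w i = p)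
    (hw3 : ∀ i, i ∉ M → w i = u i) :
    Multiset.map w (univ : Finset (Fin k)).val =
      Multiset.replicate B.card q + Multiset.replicate (M.card - B.card) p +
        Multiset.map u (Mᶜ).val := by
  classical
  have h1 : (univ : Finset (Fin k)).val = B.val + (M \ B).val + (Mᶜ).val := by
    have e1 : M = B.disjUnion (M \ B) disjoint_sdiff := by
      rw [Finset.disjUnion_eq_union, Finset.union_sdiff_of_subset hB]
    have e2 : (univ : Finset (Fin k)) = M.disjUnion Mᶜ disjoint_compl_right := by
      rw [Finset.disjUnion_eq_union, Finset.union_compl]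
    calc (univ : Finset (Fin k)).val = M.val + (Mᶜ).val := by
            conv_lhs => rw [e2]
            rfl
      _ = _ := by
            congr 1
            conv_lhs => rw [e1]
            rfl
  rw [h1, Multiset.map_add, Multiset.map_add]
  congr 1
  · congr 1
    · rw [Multiset.eq_replicate]
      refine ⟨by simp, ?_⟩
      intro b hb
      obtain ⟨i, hi, rfl⟩ := Multiset.mem_map.1 hb
      exact hw1 i hi
    · rw [Multiset.eq_replicate]
      refine ⟨by rw [Multiset.card_map]; exact Finset.card_sdiff_of_subset hB, ?_⟩
      intro b hb
      obtain ⟨i, hi, rfl⟩ := Multiset.mem_map.1 hb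
      have := Finset.mem_sdiff.1 (show i ∈ M \ B from hi)
      exact hw2 i this.1 this.2
  · refine Multiset.map_congr rfl fun i hi => ?_
    exact hw3 i (Finset.mem_compl.1 hi)

theorem partZ0 (k : ℕ) (hk : 2 ≤ k) {Q : Type*} [DecidableEq Q] (c : Multiset Q → ℤ)
    (hc : ∀ s, c s = 0 ∨ c s = 1)
    (hD : ∀ A : Finset (Fin k), k - gDef k ≤ A.card → ∀ x y,
      DD (fun u => c ((univ : Finset (Fin k)).val.map u)) A x y = 0)
    (p : Q) (hp : c ((univ : Finset (Fin k)).val.map (fun _ => p)) = 0) (T : Finset Q) :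
    ∀ u : Fin k → Q, (∀ i, u i ∈ insert p T) → c ((univ : Finset (Fin k)).val.map u) = 0 := by
  classical
  induction T using Finset.induction_on with
  | empty =>
    intro u hu
    have : u = fun _ => p := by
      funext i; simpa using hu i
    rw [this]; exact hp
  | insert q T hq ih =>
    by_cases hqp : q = p
    · intro u hu
      apply ih
      intro i; simpa [hqp] using hu i
    suffices H : ∀ e : ℕ, ∀ u : Fin k → Q, (∀ i, u i ∈ insert p (insert q T)) →
        (univ.filter (fun i => u i ≠ p ∧ u i ≠ q)).card = e →
        c ((univ : Finset (Fin k)).val.map u) = 0 from fun u hu => H _ u hu rfl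
    intro e
    induction e using Nat.strong_induction_on with
    | _ e ihe =>
    intro u hu he
    set M : Finset (Fin k) := univ.filter (fun i => u i = p ∨ u i = q) with hM
    have hMc : Mᶜ = univ.filter (fun i => u i ≠ p ∧ u i ≠ q) := by
      ext i; simp [hM]
    have hcard : M.card + e = k := by
      rw [← he, ← hMc, Finset.card_add_card_compl, Fintype.card_fin]
    set m := M.card with hm
    let a : ℕ → ℤ := fun i => c (Multiset.replicate i q + Multiset.replicate (m - i) p +
        Multiset.map u (Mᶜ).val)
    -- alternating sums vanish
    have key : ∀ r, m - gDef k ≤ r → r ≤ m →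
        ∑ i ∈ Finset.range (r + 1), (-1 : ℤ) ^ i * (r.choose i) * a i = 0 := by
      intro r hr1 hr2
      obtain ⟨A1, hA1, hA1c⟩ := Finset.exists_subset_card_eq hr2
      have hdis : Disjoint A1 Mᶜ := Finset.disjoint_of_subset_left hA1 disjoint_compl_right
      have hMcc : (Mᶜ).card = e := by rw [hMc, he]
      have h0 := hD (A1 ∪ Mᶜ) (by
        rw [Finset.card_union_of_disjoint hdis, hA1c, hMcc]; omega)
        (fun _ => p) (fun i => if i ∈ M then q else u i)
      unfold DD at h0
      have h1 : ∑ B ∈ (A1 ∪ Mᶜ).powerset, (-1 : ℤ) ^ B.card *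
          c ((univ : Finset (Fin k)).val.map
            (B.piecewise (fun i => if i ∈ M then q else u i) (fun _ => p)))
          = ∑ B ∈ A1.powerset, (-1 : ℤ) ^ (B.card + e) * a B.card := by
        rw [← Finset.sum_subset (s₁ := A1.powerset.image (fun B => B ∪ Mᶜ))]
        · rw [Finset.sum_image]
          · refine Finset.sum_congr rfl fun B hB => ?_
            have hB' := Finset.mem_powerset.1 hB
            have hBM : B ⊆ M := hB'.trans hA1
            rw [Finset.card_union_of_disjoint (Finset.disjoint_of_subset_left hB' hdis), hMcc]
            congr 1
            rw [map_three M B hBM p q u]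
            · intro i hi
              simp [Finset.piecewise, hi, hBM hi]
            · intro i hi hi'
              simp [Finset.piecewise, hi, hi']
            · intro i hi
              simp [Finset.piecewise, hi]
          · intro B hB B' hB' hBB
            have e1 := Finset.disjoint_of_subset_left (Finset.mem_powerset.1 hB) hdis
            have e2 := Finset.disjoint_of_subset_left (Finset.mem_powerset.1 hB') hdis
            have := congrArg (fun X => X \ Mᶜ) hBB
            simpa [Finset.union_sdiff_cancel_right e1, Finset.union_sdiff_cancel_right e2]
              using this
        · intro B hB
          obtain ⟨B1, hB1, rfl⟩ := Finset.mem_image.1 hB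
          exact Finset.mem_powerset.2
            (Finset.union_subset_union_left (Finset.mem_powerset.1 hB1))
        · intro B hB hB2
          have hnot : ¬ Mᶜ ⊆ B := by
            intro hsub
            apply hB2
            refine Finset.mem_image.2 ⟨B \ Mᶜ, ?_, ?_⟩
            · rw [Finset.mem_powerset] at hB ⊢
              intro i hi
              rw [Finset.mem_sdiff] at hi
              rcases Finset.mem_union.1 (hB hi.1) with h | h
              · exact h
              · exact absurd h hi.2
            · exact Finset.sdiff_union_of_subset hsub
          rw [ihe _ ?_ _ ?_ rfl, mul_zero]
          · rw [← he, ← hMc]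
            apply Finset.card_lt_card
            constructor
            · intro i hi
              rw [Finset.mem_filter] at hi
              by_contra hiM
              have hiM' : i ∈ M := by simpa using hiM
              by_cases hiB : i ∈ B <;> simp [Finset.piecewise, hiB, hiM'] at hi
            · intro hsub
              apply hnot
              intro i hi
              have := hsub hi
              rw [Finset.mem_filter] at this
              by_contra hiB
              simp [Finset.piecewise, hiB] at this
          · intro i
            by_cases hiB : i ∈ B
            · by_cases hiM : i ∈ M
              · simp [Finset.piecewise, hiB, hiM]
              · simpa [Finset.piecewise, hiB, hiM] using hu i
            · simp [Finset.piecewise, hiB]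
      rw [h1] at h0
      have h2 := Finset.sum_powerset_apply_card (fun i => (-1 : ℤ) ^ (i + e) * a i) (x := A1)
      rw [h2, hA1c] at h0
      have h3 : (-1 : ℤ) ^ e *
          ∑ i ∈ Finset.range (r + 1), (-1 : ℤ) ^ i * (r.choose i) * a i = 0 := by
        rw [← h0, Finset.mul_sum]
        refine Finset.sum_congr rfl fun i _ => ?_
        rw [pow_add]; simp only [nsmul_eq_mul]; ring
      rcases mul_eq_zero.1 h3 with h6 | h6
      · exact absurd h6 (by positivity)
      · exact h6
    have ha0 : a 0 = 0 := by
      have h1 := ih (fun i => if i ∈ M then p else u i) (by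
        intro i
        by_cases hi : i ∈ M
        · simp [hi]
        · have h2 := hu i
          have h3 : u i ≠ p ∧ u i ≠ q := by
            have := Finset.mem_compl.2 hi
            rw [hMc] at this
            simpa using this
          simp only [hi, if_false]
          simp only [Finset.mem_insert] at h2 ⊢
          tauto)
      rw [map_three M ∅ (by simp) p q u] at h1
      · simpa [a] using h1
      · intro i hi; simp at hi
      · intro i hi _; simp [hi]
      · intro i hi; simp [hi]
    have hall : ∀ i ≤ m, a i = 0 := by
      rcases Nat.lt_or_ge m 2 with hm2 | hm2
      · intro i hi
        rcases Nat.eq_zero_or_pos i with h0 | h0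
        · rw [h0]; exact ha0
        · have hi1 : i = 1 := by omega
          have hm1 : m = 1 := by omega
          have := key 1 (by omega) (by omega)
          simp [Finset.sum_range_succ, ha0] at this
          rw [hi1]; exact this
      · let α : ℕ → Bool := fun i => decide (a i = 1)
        have hα : ∀ i, (if α i then (1 : ℤ) else 0) = a i := by
          intro i
          rcases hc (Multiset.replicate i q + Multiset.replicate (m - i) p +
            Multiset.map u (Mᶜ).val) with h | h
          · have : a i = 0 := h
            simp [α, this]
          · have : a i = 1 := h
            simp [α, this]
        have := gDef_spec k hk m hm2 (by omega) α (by
          intro r hr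
          rw [Finset.mem_Icc] at hr
          refine (Finset.sum_congr rfl fun i _ => ?_).trans (key r hr.1 hr.2)
          rw [hα])
        intro i hi
        rw [← hα, this i hi, hα, ha0]
    have hfin := map_three M (univ.filter (fun i => u i = q)) (by
      intro i; simp only [hM, Finset.mem_filter]; tauto) p q u u
      (by intro i hi; simpa using hi)
      (by intro i hi hi'; simp [hM] at hi hi'; tauto) (by intros; rfl)
    rw [hfin]
    exact hall _ (Finset.card_le_card (by
      intro i; simp only [hM, Finset.mem_filter]; tauto))

theorem partZ (k : ℕ) (hk : 2 ≤ k) {Q : Type*} [DecidableEq Q] [Fintype Q] (c : Multiset Q → ℤ)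
    (hc : ∀ s, c s = 0 ∨ c s = 1)
    (hD : ∀ A : Finset (Fin k), k - gDef k ≤ A.card → ∀ x y,
      DD (fun u => c ((univ : Finset (Fin k)).val.map u)) A x y = 0) (u v : Fin k → Q) :
    c ((univ : Finset (Fin k)).val.map u) = c ((univ : Finset (Fin k)).val.map v) := by
  have : 0 < k := by omega
  let p : Q := u ⟨0, this⟩
  rcases hc ((univ : Finset (Fin k)).val.map (fun _ => p)) with h | h
  · rw [partZ0 k hk c hc hD p h univ u (by simp), partZ0 k hk c hc hD p h univ v (by simp)]
  · have hc' : ∀ s, (1 - c s) = 0 ∨ (1 - c s) = 1 := by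
      intro s; rcases hc s with h | h <;> simp [h]
    have hD' : ∀ A : Finset (Fin k), k - gDef k ≤ A.card → ∀ x y,
      DD (fun u => 1 - c ((univ : Finset (Fin k)).val.map u)) A x y = 0 := by
      intro A hA x y
      have h1 := hD A hA x y
      unfold DD at h1 ⊢
      simp only [mul_sub, Finset.sum_sub_distrib, h1, mul_one, sub_zero]
      rw [Finset.sum_powerset_neg_one_pow_card]
      have := gDef_le k hk
      rw [if_neg]
      rintro rfl
      simp at hA
      omega
    have h1 := partZ0 k hk (fun s => 1 - c s) hc' hD' p (sub_eq_zero.2 h.symm) univ u (by simp)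
    have h2 := partZ0 k hk (fun s => 1 - c s) hc' hD' p (sub_eq_zero.2 h.symm) univ v (by simp)
    linarith


theorem ramsey {C : Type*} [Fintype C] [DecidableEq C] (k : ℕ) :
    ∀ L : ℕ, ∃ M : ℕ, ∀ X : Finset ℕ, M ≤ X.card → ∀ χ : Finset ℕ → C,
      ∃ H ⊆ X, H.card = L ∧ ∃ c, ∀ J ⊆ H, J.card = k → χ J = c := by
  induction k with
  | zero =>
    intro L
    refine ⟨L, fun X hX χ => ?_⟩
    obtain ⟨H, hH, hHc⟩ := Finset.exists_subset_card_eq hX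
    refine ⟨H, hH, hHc, χ ∅, fun J _ hJ => ?_⟩
    rw [Finset.card_eq_zero.1 hJ]
  | succ k ih =>
    have sub : ∀ p : ℕ, ∃ M : ℕ, ∀ X : Finset ℕ, M ≤ X.card → ∀ χ : Finset ℕ → C,
        ∃ H ⊆ X, H.card = p ∧ ∃ col : ℕ → C, ∀ J ⊆ H, J.card = k + 1 →
          ∀ v ∈ J, (∀ w ∈ J, v ≤ w) → χ J = col v := by
      intro p
      induction p with
      | zero =>
        refine ⟨0, fun X _ χ => ⟨∅, by simp, rfl, fun _ => χ ∅, ?_⟩⟩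
        intro J hJ hJc
        rw [Finset.subset_empty.1 hJ] at hJc
        simp at hJc
      | succ p ihp =>
        obtain ⟨Mp, hMp⟩ := ihp
        obtain ⟨N, hN⟩ := ih Mp
        refine ⟨N + 1, fun X hX χ => ?_⟩
        have hne : X.Nonempty := by
          rw [← Finset.card_pos]; omega
        set v := X.min' hne with hv
        have hvX : v ∈ X := X.min'_mem hne
        obtain ⟨H', hH', hH'c, c, hc⟩ := hN (X.erase v) (by
          rw [Finset.card_erase_of_mem hvX]; omega) (fun S => χ (insert v S))
        obtain ⟨H, hH, hHc, col, hcol⟩ := hMp H' hH'c.ge χ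
        have hvH : v ∉ H := fun h => by
          have := hH' (hH h)
          simp at this
        refine ⟨insert v H, ?_, ?_, Function.update col v c, ?_⟩
        · intro x hx
          rcases Finset.mem_insert.1 hx with rfl | h
          · exact hvX
          · exact Finset.mem_of_mem_erase (hH' (hH h))
        · rw [Finset.card_insert_of_notMem hvH, hHc]
        · intro J hJ hJc x hxJ hx
          by_cases hvJ : v ∈ J
          · have hxv : x = v := by
              apply le_antisymm (hx v hvJ)
              apply X.min'_le
              rcases Finset.mem_insert.1 (hJ hxJ) with h | h
              · rw [h]; exact hvX
              · exact Finset.mem_of_mem_erase (hH' (hH h))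
            rw [hxv, Function.update_self]
            have := hc (J.erase v) (by
              intro y hy
              have h1 := Finset.mem_erase.1 hy
              rcases Finset.mem_insert.1 (hJ h1.2) with h | h
              · exact absurd h h1.1
              · exact hH h) (by rw [Finset.card_erase_of_mem hvJ]; omega)
            rwa [Finset.insert_erase hvJ] at this
          · have hxv : x ≠ v := fun h => hvJ (h ▸ hxJ)
            rw [Function.update_of_ne hxv]
            apply hcol J _ hJc x hxJ hx
            intro y hy
            rcases Finset.mem_insert.1 (hJ hy) with h | h
            · exact absurd (h ▸ hy) hvJ
            · exact h
    intro L
    obtain ⟨M, hM⟩ := sub (Fintype.card C * L)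
    refine ⟨M, fun X hX χ => ?_⟩
    obtain ⟨H, hH, hHc, col, hcol⟩ := hM X hX χ
    have : Nonempty C := ⟨χ ∅⟩
    obtain ⟨c, -, hc⟩ := Finset.exists_le_card_fiber_of_mul_le_card_of_maps_to
      (s := H) (t := (univ : Finset C)) (f := col) (n := L) (by simp) (by simp)
      (by rw [hHc]; simp)
    obtain ⟨H2, hH2, hH2c⟩ := Finset.exists_subset_card_eq hc
    refine ⟨H2, fun x hx => hH (Finset.mem_filter.1 (hH2 hx)).1, hH2c, c, fun J hJ hJc => ?_⟩
    have hne : J.Nonempty := by rw [← Finset.card_pos]; omega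
    have h1 := J.min'_mem hne
    rw [hcol J (fun x hx => (Finset.mem_filter.1 (hH2 (hJ hx))).1) hJc _ h1
      (fun w hw => J.min'_le w hw)]
    exact (Finset.mem_filter.1 (hH2 (hJ h1))).2

theorem partR (k : ℕ) (hk : 2 ≤ k) : ∃ M : ℕ, 0 < M ∧ ∀ (V : Type) (F : (Fin k → V) → ℤ)
    (_ : ∀ u, F u = 0 ∨ F u = 1)
    (_ : ∀ u, ∀ π : Equiv.Perm (Fin k), F (u ∘ π) = F u)
    (w : Fin (k + k) → Fin M → V)
    (_ : ∀ ι : Fin k → Fin M, F (fun i => w (Fin.castAdd k i) (ι i)) = 1)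
    (_ : ∀ ι : Fin k → Fin M, F (fun i => w (Fin.natAdd k i) (ι i)) = 0)
    (_ : ∀ A : Finset (Fin k), k - gDef k ≤ A.card → ∀ a b : Fin k → Fin (k + k) × Fin M,
      Function.Injective (Sum.elim a b) →
      DD F A (fun i => w (a i).1 (a i).2) (fun i => w (b i).1 (b i).2) = 0), False := by
  classical
  obtain ⟨M, hM⟩ := ramsey (C := (Fin k → Fin (k + k)) → Bool) k ((k + k) * (k + k))
  refine ⟨M + 1, by omega, ?_⟩
  intro V F h01 hsym w hw1 hw0 hD
  let w' : Fin (k + k) → ℕ → V := fun q m => w q (Fin.ofNat (M + 1) m)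
  let χ : Finset ℕ → ((Fin k → Fin (k + k)) → Bool) := fun J q =>
    if h : J.card = k then decide (F (fun i => w' (q i) (J.orderEmbOfFin h i)) = 1) else false
  obtain ⟨H, hHX, hHc, κ, hκ⟩ := hM (Finset.range (M + 1)) (by simp) χ
  let enc : Fin (k + k) × Fin (k + k) → ℕ := fun z =>
    H.orderEmbOfFin hHc (finProdFinEquiv z)
  have henc_mem : ∀ z, enc z ∈ H := fun z => Finset.orderEmbOfFin_mem _ _ _
  have henc_inj : Function.Injective enc := by
    intro z z' h
    exact finProdFinEquiv.injective ((H.orderEmbOfFin hHc).injective h)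
  have henc_mono : ∀ z z', enc z ≤ enc z' → z.1 ≤ z'.1 := by
    intro z z' h
    have h1 : finProdFinEquiv z ≤ finProdFinEquiv z' := (H.orderEmbOfFin hHc).le_iff_le.1 h
    rw [Fin.le_def] at h1 ⊢
    simp only [finProdFinEquiv_apply_val] at h1
    by_contra hcon
    push Not at hcon
    have h2 := z'.2.isLt
    have h3 : (k + k) * ((z'.1 : ℕ) + 1) ≤ (k + k) * (z.1 : ℕ) := Nat.mul_le_mul_left _ hcon
    rw [Nat.mul_add] at h3
    omega
  let d0 : Fin (k + k) := ⟨0, by omega⟩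
  let c : Multiset (Fin (k + k)) → ℤ := fun s =>
    if κ (fun i => (s.sort (· ≤ ·)).getD i d0) then 1 else 0
  have key : ∀ (u l : Fin k → Fin (k + k)), Function.Injective (fun i => (u i, l i)) →
      F (fun i => w' (u i) (enc (u i, l i))) = c ((univ : Finset (Fin k)).val.map u) := by
    intro u l hul
    let s : Fin k → ℕ := fun i => enc (u i, l i)
    have hs : Function.Injective s := henc_inj.comp hul
    let π := Tuple.sort s
    have hmono : Monotone (s ∘ π) := Tuple.monotone_sort s
    have hsm : StrictMono (s ∘ π) := hmono.strictMono_of_injective (hs.comp π.injective)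
    have humono : Monotone (u ∘ π) := fun i j hij => henc_mono _ _ (hmono hij)
    let J : Finset ℕ := univ.image s
    have hJc : J.card = k := by
      rw [Finset.card_image_of_injective _ hs]; simp
    have hJH : J ⊆ H := by
      intro x hx
      obtain ⟨i, -, rfl⟩ := Finset.mem_image.1 hx
      exact henc_mem _
    have h1 := congrFun (hκ J hJH hJc) (u ∘ π)
    have h2 : (s ∘ π) = J.orderEmbOfFin hJc :=
      Finset.orderEmbOfFin_unique hJc (fun x => Finset.mem_image.2 ⟨π x, mem_univ _, rfl⟩) hsm
    have h3 : ((univ : Finset (Fin k)).val.map u).sort (· ≤ ·) = List.ofFn (u ∘ π) := by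
      have e1 : (univ : Finset (Fin k)).val.map u = (List.ofFn (u ∘ π) : Multiset _) := by
        have e2 : (univ : Finset (Fin k)).val.map u
            = (univ : Finset (Fin k)).val.map (u ∘ π) := by
          rw [← Multiset.map_map]
          congr 1
          exact (congrArg Finset.val (Finset.map_univ_equiv π)).symm
        rw [e2, List.ofFn_eq_map]
        rfl
      rw [e1]
      apply List.Perm.eq_of_pairwise' (r := (· ≤ ·))
      · exact Multiset.pairwise_sort _ _
      · exact List.pairwise_ofFn.2 fun i j hij => humono hij.le
      · exact Multiset.coe_eq_coe.1 (Multiset.sort_eq _ _)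
    have h4 : (fun i : Fin k => (((univ : Finset (Fin k)).val.map u).sort (· ≤ ·)).getD i d0)
        = u ∘ π := by
      funext i
      rw [h3, List.getD_eq_getElem _ _ (by simp)]
      simp
    have h5 : F (fun i => w' (u i) (enc (u i, l i))) =
        F (fun i => w' ((u ∘ π) i) (J.orderEmbOfFin hJc i)) := by
      rw [← hsym _ π, ← h2]
      rfl
    simp only [χ, hJc, dif_pos] at h1
    simp only [c, h4]
    rw [h5, ← h1]
    rcases h01 (fun i => w' ((u ∘ π) i) (J.orderEmbOfFin hJc i)) with h | h
    · rw [h]; simp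
    · rw [h]; simp
  have hcc : ∀ s, c s = 0 ∨ c s = 1 := by
    intro s; simp only [c]; split_ifs <;> simp
  have hlt : ∀ z, enc z < M + 1 := fun z => Finset.mem_range.1 (hHX (henc_mem z))
  have hDc : ∀ A : Finset (Fin k), k - gDef k ≤ A.card → ∀ x y,
      DD (fun u => c ((univ : Finset (Fin k)).val.map u)) A x y = 0 := by
    intro A hA x y
    let l1 : Fin k → Fin (k + k) := fun i => Fin.castAdd k i
    let l2 : Fin k → Fin (k + k) := fun i => Fin.natAdd k i
    have := hD A hA (fun i => (x i, Fin.ofNat (M + 1) (enc (x i, l1 i))))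
      (fun i => (y i, Fin.ofNat (M + 1) (enc (y i, l2 i)))) (by
        have hof : ∀ z z', Fin.ofNat (M + 1) (enc z) = Fin.ofNat (M + 1) (enc z') → z = z' := by
          intro z z' h
          have := congrArg Fin.val h
          simp only [Fin.ofNat, Nat.mod_eq_of_lt (hlt _)] at this
          exact henc_inj this
        rintro (i | i) (j | j) h
        · have := congrArg Prod.snd (hof _ _ (congrArg Prod.snd h))
          simp [l1] at this
          rw [this]
        · have := congrArg Fin.val (congrArg Prod.snd (hof _ _ (congrArg Prod.snd h)))
          simp [l1, l2] at this
          omega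
        · have := congrArg Fin.val (congrArg Prod.snd (hof _ _ (congrArg Prod.snd h)))
          simp [l1, l2] at this
          omega
        · have := congrArg Prod.snd (hof _ _ (congrArg Prod.snd h))
          simp [l2] at this
          rw [this])
    rw [← this]
    unfold DD
    refine Finset.sum_congr rfl fun B _ => ?_
    congr 1
    show c ((univ : Finset (Fin k)).val.map (B.piecewise y x)) = _
    rw [← key (B.piecewise y x) (B.piecewise l2 l1)]
    · congr 1
      funext i
      by_cases hi : i ∈ B <;> simp [Finset.piecewise, hi, w']
    · intro i j hij
      have h2 := congrArg Fin.val (congrArg Prod.snd hij)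
      by_cases hi : i ∈ B <;> by_cases hj : j ∈ B <;>
        simp [Finset.piecewise, hi, hj, l1, l2] at h2 <;> ext <;> omega
  have hfin := partZ k hk c hcc hDc (fun i => Fin.castAdd k i) (fun i => Fin.natAdd k i)
  rw [← key _ (fun i => Fin.castAdd k i), ← key _ (fun i => Fin.castAdd k i)] at hfin
  · have h1 := hw1 (fun i => Fin.ofNat (M + 1) (enc (Fin.castAdd k i, Fin.castAdd k i)))
    have h0 := hw0 (fun i => Fin.ofNat (M + 1) (enc (Fin.natAdd k i, Fin.castAdd k i)))
    simp only [w'] at hfin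
    rw [h1, h0] at hfin
    simp at hfin
  · intro i j hij
    have := congrArg Prod.snd hij
    simpa using this
  · intro i j hij
    have := congrArg Prod.snd hij
    simpa using this


theorem kst (M : ℕ) (m : ℕ) : ∀ (V Y : Type) [Fintype V] [Fintype Y]
    (φ : (Fin m → V) → Y → ℝ) (_ : ∀ u y, 0 ≤ φ u y) (δ : ℝ) (_ : 0 ≤ δ)
    (_ : δ * (Fintype.card V : ℝ) ^ m * (Fintype.card Y : ℝ) ≤ ∑ u, ∑ y, φ u y),
    δ ^ ((M + 1) ^ m) * (Fintype.card V : ℝ) ^ (m * (M + 1)) * (Fintype.card Y : ℝ) ≤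
      ∑ w : Fin m → Fin (M + 1) → V, ∑ y, ∏ ι : Fin m → Fin (M + 1), φ (fun i => w i (ι i)) y := by
  induction m with
  | zero =>
    intro V Y _ _ φ hφ δ hδ h
    simp only [pow_zero, pow_one, zero_mul, Finset.univ_unique, Finset.sum_singleton,
      Finset.prod_singleton] at h ⊢
    convert h using 4
  | succ m ih =>
    intro V Y _ _ φ hφ δ hδ h
    have h1 := ih V (V × Y) (fun u z => φ (Fin.cons z.1 u) z.2) (fun _ _ => hφ _ _) δ hδ (by
      refine le_trans (le_of_eq ?_) (le_trans h (le_of_eq ?_))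
      · simp only [Fintype.card_prod, Nat.cast_mul]; ring
      · rw [← (Fin.consEquiv (fun _ => V)).sum_comp, Fintype.sum_prod_type, Finset.sum_comm]
        refine Finset.sum_congr rfl fun u _ => ?_
        rw [Fintype.sum_prod_type]
        rfl)
    let ψ : V → ((Fin m → Fin (M + 1) → V) × Y) → ℝ := fun v z =>
      ∏ ι : Fin m → Fin (M + 1), φ (Fin.cons v (fun i => z.1 i (ι i))) z.2
    have hψ : ∀ v z, 0 ≤ ψ v z := fun v z => Finset.prod_nonneg fun _ _ => hφ _ _
    have h2 : (∑ w : Fin m → Fin (M + 1) → V, ∑ z : V × Y,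
        ∏ ι : Fin m → Fin (M + 1), φ (Fin.cons z.1 (fun i => w i (ι i))) z.2)
        = ∑ z, ∑ v, ψ v z := by
      rw [Fintype.sum_prod_type]
      refine Finset.sum_congr rfl fun w _ => ?_
      rw [Fintype.sum_prod_type, Finset.sum_comm]
    have h3 : (∑ w : Fin (m + 1) → Fin (M + 1) → V, ∑ y,
        ∏ ι : Fin (m + 1) → Fin (M + 1), φ (fun i => w i (ι i)) y)
        = ∑ z, (∑ v, ψ v z) ^ (M + 1) := by
      rw [← (Fin.consEquiv (fun _ => Fin (M + 1) → V)).sum_comp, Fintype.sum_prod_type,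
        Finset.sum_comm, Fintype.sum_prod_type]
      refine Finset.sum_congr rfl fun w _ => ?_
      rw [Finset.sum_comm]
      refine Finset.sum_congr rfl fun y _ => ?_
      rw [Fintype.sum_pow]
      refine Finset.sum_congr rfl fun w0 _ => ?_
      rw [← (Fin.consEquiv (fun _ => Fin (M + 1))).prod_comp, Fintype.prod_prod_type]
      refine Finset.prod_congr rfl fun j _ => ?_
      refine Finset.prod_congr rfl fun ι _ => ?_
      congr 1
      funext i
      refine Fin.cases ?_ (fun i => ?_) i <;> simp [Fin.consEquiv]
    rw [h3]
    rw [h2] at h1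
    have h4 := pow_sum_div_card_le_sum_pow (s := (univ : Finset ((Fin m → Fin (M + 1) → V) × Y)))
      (f := fun z => ∑ v, ψ v z) (fun z _ => Finset.sum_nonneg fun _ _ => hψ _ _) M
    refine le_trans ?_ h4
    set K : ℝ := (Fintype.card V : ℝ) ^ (m * (M + 1)) * (Fintype.card Y : ℝ) with hK
    have hcard : ((univ : Finset ((Fin m → Fin (M + 1) → V) × Y)).card : ℝ) = K := by
      rw [Finset.card_univ]
      simp only [Fintype.card_prod, Fintype.card_pi, Finset.prod_const, Finset.card_univ,
        Fintype.card_fin, hK, Nat.cast_mul, Nat.cast_pow]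
      rw [← pow_mul, mul_comm (M + 1) m]
    rw [hcard]
    have hK0 : 0 ≤ K := by positivity
    rcases hK0.eq_or_lt with hK0 | hK0
    · have : (0 : ℝ) ≤ (∑ z, ∑ v, ψ v z) ^ (M + 1) / K ^ M := by
        apply div_nonneg _ (by rw [← hK0]; positivity)
        apply pow_nonneg
        exact Finset.sum_nonneg fun _ _ => Finset.sum_nonneg fun _ _ => hψ _ _
      refine le_trans (le_of_eq ?_) this
      rw [add_mul, pow_add]
      calc _ = δ ^ (M + 1) ^ (m + 1) * (Fintype.card V : ℝ) ^ (1 * (M + 1)) * K := by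
            rw [hK]; ring
        _ = 0 := by rw [← hK0]; ring
    · rw [le_div_iff₀ (by positivity)]
      calc _ = (δ ^ (M + 1) ^ m * (Fintype.card V : ℝ) * K) ^ (M + 1) := by
            rw [mul_pow, mul_pow, pow_succ K, ← pow_mul, ← pow_succ, add_mul, pow_add, hK]; ring
        _ ≤ _ := by
            apply pow_le_pow_left₀ (by positivity)
            refine le_trans (le_of_eq ?_) h1
            simp only [Fintype.card_prod, Nat.cast_mul, hK]; ring


/-- The indicator of edges on tuples. -/
def tupF {n k : ℕ} (G : Finset (Finset (Fin n))) (u : Fin k → Fin n) : ℤ :=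
  if univ.image u ∈ G then 1 else 0

lemma tupF_01 {n k : ℕ} (G : Finset (Finset (Fin n))) (u : Fin k → Fin n) :
    tupF G u = 0 ∨ tupF G u = 1 := by
  unfold tupF; split_ifs <;> simp

lemma tupF_symm {n k : ℕ} (G : Finset (Finset (Fin n))) (u : Fin k → Fin n)
    (π : Equiv.Perm (Fin k)) : tupF G (u ∘ π) = tupF G u := by
  unfold tupF
  have : univ.image (u ∘ π) = univ.image u := by
    rw [← Finset.image_image, Finset.image_univ_equiv]
  rw [this]

lemma sum_update' {ι V R : Type*} [Fintype ι] [DecidableEq ι] [Fintype V] [CommRing R]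
    (g : (ι → V) → R) (i : ι) :
    ∑ v : V, ∑ x : ι → V, g (Function.update x i v) = (Fintype.card V : R) * ∑ x, g x := by
  have hinv : Function.Involutive
      (fun z : V × (ι → V) => (z.2 i, Function.update z.2 i z.1)) := by
    intro z; simp
  have h1 : ∑ z : V × (ι → V), g (Function.update z.2 i z.1) = ∑ z : V × (ι → V), g z.2 := by
    refine Fintype.sum_equiv hinv.toPerm _ _ ?_
    intro z
    rfl
  rw [Fintype.sum_prod_type, Fintype.sum_prod_type] at h1
  rw [h1]
  simp

lemma count_lem {n k : ℕ} (G : Finset (Finset (Fin n))) (hG : ∀ e ∈ G, e.card = k) :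
    ∀ (j : ℕ) (A : Finset (Fin k)) (m : Fin k → Fin n), A.card + j = k → Set.InjOn m A →
    ∑ x' : Fin k → Fin n, tupF G (A.piecewise m x') =
      (n : ℤ) ^ A.card * (j.factorial : ℤ) * ((G.filter (fun S => A.image m ⊆ S)).card : ℤ) := by
  intro j
  induction j with
  | zero =>
    intro A m hA hm
    have hAu : A = univ := by
      apply Finset.eq_univ_of_card; simpa using hA
    subst hAu
    have hinj : Function.Injective m := by
      intro a b hab; exact hm (by simp) (by simp) hab
    have hc : (univ.image m).card = k := by
      rw [Finset.card_image_of_injective _ hinj]; simp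
    have h1 : G.filter (fun S => univ.image m ⊆ S) = G.filter (fun S => S = univ.image m) := by
      apply Finset.filter_congr
      intro S hS
      constructor
      · intro h
        exact (Finset.eq_of_subset_of_card_le h (by rw [hG S hS, hc])).symm
      · rintro rfl; exact Finset.Subset.refl _
    rw [h1]
    simp only [Finset.piecewise_univ, Finset.sum_const, Finset.card_univ]
    rw [Finset.filter_eq']
    unfold tupF
    split_ifs <;> simp
  | succ j ih =>
    intro A m hA hm
    obtain ⟨i, hi⟩ : ∃ i, i ∉ A := by
      by_contra hcon
      push Not at hcon
      have : A = univ := Finset.eq_univ_iff_forall.2 hcon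
      rw [this] at hA
      simp at hA
    have h1 : (n : ℤ) * ∑ x' : Fin k → Fin n, tupF G (A.piecewise m x')
        = ∑ v : Fin n, ∑ x' : Fin k → Fin n,
          tupF G ((insert i A).piecewise (Function.update m i v) x') := by
      have := sum_update' (fun x' : Fin k → Fin n => tupF G (A.piecewise m x')) i
      rw [Fintype.card_fin] at this
      rw [← this]
      refine Finset.sum_congr rfl fun v _ => Finset.sum_congr rfl fun x' _ => ?_
      congr 1
      funext l
      by_cases hl : l = i
      · subst hl; simp [Finset.piecewise, hi]
      · by_cases hlA : l ∈ A <;> simp [Finset.piecewise, hl, hlA]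
    have h2 : ∀ v : Fin n, ∑ x' : Fin k → Fin n,
          tupF G ((insert i A).piecewise (Function.update m i v) x')
        = if v ∈ A.image m then 0 else (n : ℤ) ^ (A.card + 1) * (j.factorial : ℤ) *
          ((G.filter (fun S => insert v (A.image m) ⊆ S)).card : ℤ) := by
      intro v
      split_ifs with hv
      · apply Finset.sum_eq_zero
        intro x' _
        obtain ⟨l, hl, hlv⟩ := Finset.mem_image.1 hv
        have hli : l ≠ i := fun h => hi (h ▸ hl)
        unfold tupF
        rw [if_neg]
        intro hmem
        have hc := hG _ hmem
        have hinj : Function.Injective ((insert i A).piecewise (Function.update m i v) x') := by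
          have hio := Finset.card_image_iff.1 (show (univ.image
            ((insert i A).piecewise (Function.update m i v) x')).card
              = (univ : Finset (Fin k)).card by rw [hc]; simp)
          exact fun a b h => hio (by simp) (by simp) h
        apply hli
        apply hinj
        simp [Finset.piecewise, hl, hli, hlv]
      · have hinj : Set.InjOn (Function.update m i v) (insert i A : Finset (Fin k)) := by
          intro a ha b hb hab
          have ha' : a = i ∨ a ∈ A := by simpa using ha
          have hb' : b = i ∨ b ∈ A := by simpa using hb
          by_cases hai : a = i <;> by_cases hbi : b = i
          · rw [hai, hbi]
          · exfalso
            apply hv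
            simp [hai, hbi] at hab
            exact Finset.mem_image.2 ⟨b, by tauto, hab.symm⟩
          · exfalso
            apply hv
            simp [hai, hbi] at hab
            exact Finset.mem_image.2 ⟨a, by tauto, hab⟩
          · simp [hai, hbi] at hab
            exact hm (by simpa [hai] using ha) (by simpa [hbi] using hb) hab
        rw [ih (insert i A) (Function.update m i v) (by
          rw [Finset.card_insert_of_notMem hi]; omega) hinj, Finset.card_insert_of_notMem hi]
        have h3 : (insert i A).image (Function.update m i v) = insert v (A.image m) := by
          rw [Finset.image_insert, Function.update_self]
          congr 1
          apply Finset.image_congr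
          intro a ha
          have ha1 : a ∈ A := by simpa using ha
          have hne : a ≠ i := by
            rintro rfl
            exact hi ha1
          exact Function.update_of_ne hne _ _
        rw [h3]
    have h4 : ∑ v : Fin n, (if v ∈ A.image m then (0 : ℤ) else
        ((G.filter (fun S => insert v (A.image m) ⊆ S)).card : ℤ))
        = ((j + 1 : ℕ) : ℤ) * ((G.filter (fun S => A.image m ⊆ S)).card : ℤ) := by
      have h5 : ∀ v : Fin n, (if v ∈ A.image m then (0 : ℤ) else
          ((G.filter (fun S => insert v (A.image m) ⊆ S)).card : ℤ))
          = ∑ S ∈ G.filter (fun S => A.image m ⊆ S), if v ∈ S \ A.image m then 1 else 0 := by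
        intro v
        split_ifs with hv
        · symm
          apply Finset.sum_eq_zero
          intro S _
          rw [if_neg]
          simp only [Finset.mem_sdiff]; tauto
        · rw [← Finset.sum_filter, Finset.filter_filter, Finset.card_eq_sum_ones]
          push_cast
          refine Finset.sum_congr ?_ (fun _ _ => rfl)
          ext S
          simp only [Finset.mem_filter, Finset.insert_subset_iff, Finset.mem_sdiff]
          tauto
      simp_rw [h5]
      rw [Finset.sum_comm]
      have h6 : ∀ S ∈ G.filter (fun S => A.image m ⊆ S),
          (∑ v : Fin n, if v ∈ S \ A.image m then (1 : ℤ) else 0) = ((j + 1 : ℕ) : ℤ) := by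
        intro S hS
        rw [Finset.mem_filter] at hS
        rw [← Finset.sum_filter]
        simp only [Finset.sum_const, nsmul_eq_mul, mul_one]
        congr 1
        have : univ.filter (fun v => v ∈ S \ A.image m) = S \ A.image m := by ext; simp
        rw [this, Finset.card_sdiff_of_subset hS.2, hG S hS.1, Finset.card_image_of_injOn hm]
        omega
      rw [Finset.sum_congr rfl h6]
      simp [mul_comm]
    simp_rw [h2] at h1
    have h7 : (n : ℤ) * ∑ x' : Fin k → Fin n, tupF G (A.piecewise m x')
        = (n : ℤ) * ((n : ℤ) ^ A.card * ((j + 1).factorial : ℤ) *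
          ((G.filter (fun S => A.image m ⊆ S)).card : ℤ)) := by
      rw [h1]
      have h8 : ∀ v : Fin n, (if v ∈ A.image m then (0 : ℤ) else (n : ℤ) ^ (A.card + 1) *
          (j.factorial : ℤ) * ((G.filter (fun S => insert v (A.image m) ⊆ S)).card : ℤ))
          = (n : ℤ) ^ (A.card + 1) * (j.factorial : ℤ) * (if v ∈ A.image m then (0 : ℤ) else
          ((G.filter (fun S => insert v (A.image m) ⊆ S)).card : ℤ)) := by
        intro v; split_ifs <;> simp
      simp_rw [h8]
      rw [← Finset.mul_sum, h4, Nat.factorial_succ]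
      push_cast
      ring
    rcases Nat.eq_zero_or_pos n with hn | hn
    · exact (Fin.elim0 (hn ▸ m i))
    · exact mul_left_cancel₀ (by exact_mod_cast hn.ne') h7

/-- The alternating degree sum. -/
def UU {n : ℕ} {ι : Type*} (G : Finset (Finset (Fin n))) (A : Finset ι) (x y : ι → Fin n) : ℤ :=
  ∑ S ∈ G, ∏ i ∈ A, ((if x i ∈ S then 1 else 0) - (if y i ∈ S then 1 else 0))

lemma UU_eq {n k : ℕ} (G : Finset (Finset (Fin n))) (hG : ∀ e ∈ G, e.card = k)
    (A : Finset (Fin k)) (x y : Fin k → Fin n) (hxy : Function.Injective (Sum.elim x y)) :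
    ∑ x' : Fin k → Fin n, DD (tupF G) A (A.piecewise x x') y =
      (n : ℤ) ^ A.card * ((k - A.card).factorial : ℤ) * UU G A x y := by
  have hAk : A.card ≤ k := by simpa using Finset.card_le_univ A
  have hx : Function.Injective x := fun a b h => by
    have := @hxy (Sum.inl a) (Sum.inl b) h
    simpa using this
  have hy : Function.Injective y := fun a b h => by
    have := @hxy (Sum.inr a) (Sum.inr b) h
    simpa using this
  have hne : ∀ a b, x a ≠ y b := fun a b h => by
    have := @hxy (Sum.inl a) (Sum.inr b) h
    simp at this
  unfold DD
  rw [Finset.sum_comm]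
  have h1 : ∀ B ∈ A.powerset, ∑ x' : Fin k → Fin n, (-1 : ℤ) ^ B.card *
      tupF G (B.piecewise y (A.piecewise x x')) = (n : ℤ) ^ A.card *
      ((k - A.card).factorial : ℤ) * ((-1 : ℤ) ^ B.card *
        ((G.filter (fun S => A.image (B.piecewise y x) ⊆ S)).card : ℤ)) := by
    intro B hB
    rw [Finset.mem_powerset] at hB
    rw [← Finset.mul_sum]
    have h2 : ∀ x' : Fin k → Fin n, B.piecewise y (A.piecewise x x')
        = A.piecewise (B.piecewise y x) x' := by
      intro x'
      funext i
      by_cases hiB : i ∈ B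
      · simp [Finset.piecewise, hiB, hB hiB]
      · by_cases hiA : i ∈ A <;> simp [Finset.piecewise, hiB, hiA]
    simp_rw [h2]
    rw [count_lem G hG (k - A.card) A (B.piecewise y x) (by omega)]
    · ring
    · intro a _ b _ hab
      by_cases ha : a ∈ B <;> by_cases hb : b ∈ B <;> simp [Finset.piecewise, ha, hb] at hab
      · exact hy hab
      · exact absurd hab.symm (hne _ _)
      · exact absurd hab (hne _ _)
      · exact hx hab
  rw [Finset.sum_congr rfl h1, ← Finset.mul_sum]
  congr 1
  unfold UU
  have h3 : ∀ S : Finset (Fin n), (∏ i ∈ A, ((if x i ∈ S then (1 : ℤ) else 0)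
      - (if y i ∈ S then 1 else 0)))
      = ∑ B ∈ A.powerset, (-1 : ℤ) ^ B.card *
        (if A.image (B.piecewise y x) ⊆ S then 1 else 0) := by
    intro S
    have h4 : ∀ i, ((if x i ∈ S then (1 : ℤ) else 0) - (if y i ∈ S then 1 else 0))
        = (-(if y i ∈ S then (1 : ℤ) else 0)) + (if x i ∈ S then 1 else 0) := by
      intro i; ring
    simp_rw [h4]
    rw [Finset.prod_add]
    refine Finset.sum_congr rfl fun B hB => ?_
    rw [Finset.mem_powerset] at hB
    rw [Finset.prod_neg, mul_assoc]
    congr 1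
    rw [Finset.prod_ite_zero, Finset.prod_ite_zero]
    simp only [Finset.prod_const_one, ← ite_and, mul_ite, mul_one, mul_zero]
    refine if_congr ?_ rfl rfl
    rw [Finset.image_subset_iff]
    constructor
    · rintro ⟨h5, h6⟩ i hi
      by_cases hiB : i ∈ B
      · simpa [Finset.piecewise, hiB] using h6 i hiB
      · simpa [Finset.piecewise, hiB] using h5 i (Finset.mem_sdiff.2 ⟨hi, hiB⟩)
    · intro h
      refine ⟨fun i hi => ?_, fun i hi => ?_⟩
      · rw [Finset.mem_sdiff] at hi
        simpa [Finset.piecewise, hi.2] using h i hi.1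
      · simpa [Finset.piecewise, hi] using h i (hB hi)
  simp_rw [h3]
  rw [Finset.sum_comm]
  refine Finset.sum_congr rfl fun B _ => ?_
  rw [← Finset.mul_sum]
  simp

lemma sum_comp_inj {ι κ V : Type*} [Fintype ι] [Fintype κ] [DecidableEq ι] [DecidableEq κ]
    [Fintype V] (e : ι → κ) (he : Function.Injective e) (g : (ι → V) → ℝ) :
    (∑ w : κ → V, g (w ∘ e)) * (Fintype.card V : ℝ) ^ Fintype.card ι
      = (Fintype.card V : ℝ) ^ Fintype.card κ * ∑ x : ι → V, g x := by
  classical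
  let eq1 : ι ⊕ ((Set.range e)ᶜ : Set κ) ≃ κ :=
    (Equiv.sumCongr (Equiv.ofInjective e he) (Equiv.refl _)).trans (Equiv.Set.sumCompl (Set.range e))
  let eq2 : (κ → V) ≃ (ι → V) × (((Set.range e)ᶜ : Set κ) → V) :=
    (Equiv.arrowCongr eq1.symm (Equiv.refl V)).trans (Equiv.sumArrowEquivProdArrow _ _ _)
  have h1 : ∑ w : κ → V, g (w ∘ e)
      = ∑ z : (ι → V) × (((Set.range e)ᶜ : Set κ) → V), g z.1 := by
    refine Fintype.sum_equiv eq2 _ _ ?_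
    intro w
    congr 1
  have hc : Fintype.card κ = Fintype.card ι + Fintype.card ((Set.range e)ᶜ : Set κ) := by
    rw [← Fintype.card_sum]; exact (Fintype.card_congr eq1).symm
  rw [h1, Fintype.sum_prod_type, hc, pow_add]
  simp only [Finset.sum_const, Finset.card_univ, Fintype.card_fun, nsmul_eq_mul,
    Nat.cast_pow, ← Finset.mul_sum]
  ring

lemma sum_tupF {n k : ℕ} (hn : 0 < n) (G : Finset (Finset (Fin n))) (hG : ∀ e ∈ G, e.card = k) :
    ∑ x : Fin k → Fin n, tupF G x = (k.factorial : ℤ) * G.card := by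
  have := count_lem G hG k ∅ (fun _ => ⟨0, hn⟩) (by simp) (by simp)
  simpa using this

lemma sum_DD {n k K M : ℕ} (F : (Fin k → Fin n) → ℤ) (A : Finset (Fin k))
    (a b : Fin k → Fin K × Fin M) (hgi : Function.Injective (Sum.elim a b)) :
    (∑ w : Fin K → Fin M → Fin n, |(DD F A (fun i => w (a i).1 (a i).2)
      (fun i => w (b i).1 (b i).2) : ℝ)|) * (n : ℝ) ^ (k + k)
      = (n : ℝ) ^ (K * M) *
        ((∑ x : Fin k → Fin n, ∑ y : Fin k → Fin n, |DD F A x y| : ℤ) : ℝ) := by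
  have h1 := sum_comp_inj (V := Fin n) (Sum.elim a b) hgi
    (fun z => |(DD F A (z ∘ Sum.inl) (z ∘ Sum.inr) : ℝ)|)
  have h2 : ∑ w : Fin K × Fin M → Fin n,
      |(DD F A ((w ∘ Sum.elim a b) ∘ Sum.inl)
        ((w ∘ Sum.elim a b) ∘ Sum.inr) : ℝ)|
      = ∑ w : Fin K → Fin M → Fin n, |(DD F A (fun i => w (a i).1 (a i).2)
      (fun i => w (b i).1 (b i).2) : ℝ)| :=
    Fintype.sum_equiv (Equiv.curry _ _ _) _ _ (fun w => rfl)
  have h3 : ∑ z : Fin k ⊕ Fin k → Fin n, |(DD F A (z ∘ Sum.inl) (z ∘ Sum.inr) : ℝ)|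
      = ((∑ x : Fin k → Fin n, ∑ y : Fin k → Fin n, |DD F A x y| : ℤ) : ℝ) := by
    push_cast
    rw [← Fintype.sum_prod_type']
    exact Fintype.sum_equiv (Equiv.sumArrowEquivProdArrow _ _ _) _ _ (fun w => rfl)
  rw [h2, h3] at h1
  simpa only [Fintype.card_sum, Fintype.card_fin, Fintype.card_prod] using h1

set_option maxHeartbeats 400000 in
theorem partS (k : ℕ) (hk : 2 ≤ k) (δ : ℝ) (hδ : 0 < δ) : ∃ η : ℝ, 0 < η ∧
    ∀ (n : ℕ), 0 < n → ∀ (G : Finset (Finset (Fin n))), (∀ e ∈ G, e.card = k) →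
    δ * (n : ℝ) ^ k ≤ (G.card : ℝ) → (G.card : ℝ) ≤ (n.choose k : ℝ) - δ * (n : ℝ) ^ k →
    (∀ A : Finset (Fin k), k - gDef k ≤ A.card →
      ((∑ x : Fin k → Fin n, ∑ y : Fin k → Fin n, |DD (tupF G) A x y| : ℤ) : ℝ)
        ≤ η * (n : ℝ) ^ (k + k)) → False := by
  obtain ⟨M, hM, hR⟩ := partR k hk
  obtain ⟨M, rfl⟩ : ∃ M', M = M' + 1 := ⟨M - 1, by omega⟩
  set κ : ℝ := (δ ^ 2) ^ ((M + 1) ^ (k + k)) with hκ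
  have hκ0 : 0 < κ := by positivity
  set Idx := Finset (Fin k) × (Fin k → Fin (k + k) × Fin (M + 1)) ×
    (Fin k → Fin (k + k) × Fin (M + 1)) with hIdx
  set L : ℝ := (Fintype.card Idx : ℝ) with hL
  have hL0 : 0 ≤ L := by positivity
  refine ⟨κ / (2 * (L + 1)), by positivity, ?_⟩
  intro n hn G hG hd1 hd2 hsmall
  have hn0 : (0 : ℝ) < n := by exact_mod_cast hn
  set F : (Fin k → Fin n) → ℤ := tupF G with hF
  -- densities
  have hs1 : (∑ x : Fin k → Fin n, (F x : ℝ)) = (k.factorial : ℝ) * G.card := by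
    have := sum_tupF hn G hG
    exact_mod_cast this
  have hfac : (1 : ℝ) ≤ k.factorial := by exact_mod_cast Nat.one_le_iff_ne_zero.2 (Nat.factorial_ne_zero k)
  have hlow1 : δ * (n : ℝ) ^ k ≤ ∑ x : Fin k → Fin n, (F x : ℝ) := by
    rw [hs1]; nlinarith [Nat.cast_nonneg (α := ℝ) G.card]
  have hch : (k.factorial : ℝ) * (n.choose k : ℝ) ≤ (n : ℝ) ^ k := by
    have := Nat.descFactorial_le_pow n k
    rw [Nat.descFactorial_eq_factorial_mul_choose] at this
    exact_mod_cast this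
  have hpk : 0 < δ * (n : ℝ) ^ k := by positivity
  have hlow2 : δ * (n : ℝ) ^ k ≤ ∑ x : Fin k → Fin n, (1 - (F x : ℝ)) := by
    rw [Finset.sum_sub_distrib, hs1]
    simp only [Finset.sum_const, Finset.card_univ, Fintype.card_fun, Fintype.card_fin, nsmul_eq_mul,
      mul_one, Nat.cast_pow]
    nlinarith
  let φ : (Fin (k + k) → Fin n) → Unit → ℝ := fun u _ =>
    (F (fun i => u (Fin.castAdd k i)) : ℝ) * (1 - (F (fun i => u (Fin.natAdd k i)) : ℝ))
  have hF01 : ∀ u, F u = 0 ∨ F u = 1 := tupF_01 G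
  have hφ01 : ∀ u y, φ u y = 0 ∨ φ u y = 1 := by
    intro u y
    simp only [φ]
    rcases hF01 (fun i => u (Fin.castAdd k i)) with h | h <;>
    rcases hF01 (fun i => u (Fin.natAdd k i)) with h' | h' <;> rw [h, h'] <;> norm_num
  have hφ0 : ∀ u y, 0 ≤ φ u y := by
    intro u y; rcases hφ01 u y with h | h <;> rw [h]; exact zero_le_one
  have hφs : ∑ u, ∑ y, φ u y = (∑ x : Fin k → Fin n, (F x : ℝ)) *
      ∑ x : Fin k → Fin n, (1 - (F x : ℝ)) := by
    have hz : ∑ u, ∑ y, φ u y = ∑ u, φ u () := by simp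
    rw [hz, Finset.sum_mul_sum, ← Fintype.sum_prod_type'
      (f := fun x y : Fin k → Fin n => (F x : ℝ) * (1 - (F y : ℝ)))]
    refine Fintype.sum_equiv (Fin.appendEquiv k k).symm _ _ ?_
    intro u
    rfl
  have hkst := kst M (k + k) (Fin n) Unit φ hφ0 (δ ^ 2) (by positivity) (by
    rw [hφs]
    simp only [Fintype.card_fin, Fintype.card_unit, Nat.cast_one, mul_one]
    calc δ ^ 2 * (n : ℝ) ^ (k + k) = (δ * (n : ℝ) ^ k) * (δ * (n : ℝ) ^ k) := by ring
      _ ≤ _ := mul_le_mul hlow1 hlow2 hpk.le (hpk.le.trans hlow1))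
  simp only [Fintype.card_fin, Fintype.card_unit, Nat.cast_one, mul_one, Finset.univ_unique,
    Finset.sum_singleton] at hkst
  rw [← hκ] at hkst
  -- pointwise bound
  classical
  let good : Idx → Prop := fun t => k - gDef k ≤ t.1.card ∧ Function.Injective (Sum.elim t.2.1 t.2.2)
  let term : Idx → (Fin (k + k) → Fin (M + 1) → Fin n) → ℝ := fun t w =>
    if good t then |(DD F t.1 (fun i => w (t.2.1 i).1 (t.2.1 i).2)
      (fun i => w (t.2.2 i).1 (t.2.2 i).2) : ℝ)| else 0
  have hterm0 : ∀ t w, 0 ≤ term t w := by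
    intro t w; simp only [term]; split_ifs <;> positivity
  have hpt : ∀ w : Fin (k + k) → Fin (M + 1) → Fin n,
      ∏ ι : Fin (k + k) → Fin (M + 1), φ (fun i => w i (ι i)) () ≤ ∑ t : Idx, term t w := by
    intro w
    by_cases hall : ∀ ι : Fin (k + k) → Fin (M + 1), φ (fun i => w i (ι i)) () = 1
    · by_contra hcon
      push Not at hcon
      rw [Finset.prod_eq_one (fun ι _ => hall ι)] at hcon
      refine hR (Fin n) F hF01 (tupF_symm G) w ?_ ?_ ?_
      · intro ι
        have := hall (Fin.append ι ι)
        simp only [φ, Fin.append_left, Fin.append_right] at this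
        rcases hF01 (fun i => w (Fin.castAdd k i) (ι i)) with h | h
        · rw [h] at this; simp at this
        · exact h
      · intro ι
        have := hall (Fin.append ι ι)
        simp only [φ, Fin.append_left, Fin.append_right] at this
        rcases hF01 (fun i => w (Fin.natAdd k i) (ι i)) with h | h
        · exact h
        · rw [h] at this; simp at this
      · intro A hA a b hab
        by_contra hne
        have h1 : (1 : ℝ) ≤ term (A, a, b) w := by
          simp only [term]
          rw [if_pos ⟨hA, hab⟩]
          have := Int.one_le_abs hne
          exact_mod_cast this
        have h2 := Finset.single_le_sum (f := fun t => term t w) (fun t _ => hterm0 t w)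
          (Finset.mem_univ ((A, a, b) : Idx))
        linarith
    · push Not at hall
      obtain ⟨ι, hι⟩ := hall
      have h0 : φ (fun i => w i (ι i)) () = 0 := by
        rcases hφ01 (fun i => w i (ι i)) () with h | h
        · exact h
        · exact absurd h hι
      have h00 : ∏ ι : Fin (k + k) → Fin (M + 1), φ (fun i => w i (ι i)) () = 0 :=
        Finset.prod_eq_zero (Finset.mem_univ ι) h0
      rw [h00]
      exact Finset.sum_nonneg fun t _ => hterm0 t w
  have hsum : ∀ t : Idx, ∑ w, term t w ≤ κ / (2 * (L + 1)) * (n : ℝ) ^ ((k + k) * (M + 1)) := by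
    rintro ⟨A, a, b⟩
    by_cases hg : good (A, a, b)
    · have hgi : Function.Injective (Sum.elim a b) := hg.2
      simp only [term, if_pos hg]
      have h1 := sum_DD F A a b hgi
      have h4 := hsmall A hg.1
      have hp : (0 : ℝ) < (n : ℝ) ^ (k + k) := by positivity
      refine le_of_mul_le_mul_right ?_ hp
      rw [h1]
      calc _ ≤ (n : ℝ) ^ ((k + k) * (M + 1)) * (κ / (2 * (L + 1)) * (n : ℝ) ^ (k + k)) := by gcongr
        _ = _ := by ring
    · simp only [term, if_neg hg, Finset.sum_const_zero]
      positivity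
  have hfin : κ * (n : ℝ) ^ ((k + k) * (M + 1)) ≤
      L * (κ / (2 * (L + 1)) * (n : ℝ) ^ ((k + k) * (M + 1))) := by
    refine hkst.trans ((Finset.sum_le_sum fun w _ => hpt w).trans ?_)
    rw [Finset.sum_comm]
    refine (Finset.sum_le_sum fun t _ => hsum t).trans ?_
    simp [hL]
  have hp : (0 : ℝ) < (n : ℝ) ^ ((k + k) * (M + 1)) := by positivity
  have : κ ≤ L * (κ / (2 * (L + 1))) := by
    refine le_of_mul_le_mul_right ?_ hp
    linarith
  rw [mul_div_assoc', le_div_iff₀ (by positivity)] at this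
  nlinarith

lemma DD_insert {k : ℕ} {V : Type*} (F : (Fin k → V) → ℤ) (A : Finset (Fin k)) (i : Fin k)
    (hi : i ∉ A) (u y : Fin k → V) (w : V) :
    DD F A u y - DD F A (Function.update u i w) y = DD F (insert i A) u (Function.update y i w) := by
  unfold DD
  rw [Finset.sum_powerset_insert hi, sub_eq_add_neg, ← Finset.sum_neg_distrib]
  congr 1
  · refine Finset.sum_congr rfl fun B hB => ?_
    rw [Finset.mem_powerset] at hB
    congr 2
    funext l
    by_cases hl : l ∈ B
    · have : l ≠ i := by
        rintro rfl
        exact hi (hB hl)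
      simp [Finset.piecewise, hl, this]
    · simp [Finset.piecewise, hl]
  · refine Finset.sum_congr rfl fun B hB => ?_
    rw [Finset.mem_powerset] at hB
    have hiB : i ∉ B := fun h => hi (hB h)
    rw [Finset.card_insert_of_notMem hiB, pow_succ]
    have : B.piecewise y (Function.update u i w)
        = (insert i B).piecewise (Function.update y i w) u := by
      funext l
      by_cases hli : l = i
      · subst hli; simp [Finset.piecewise, hiB]
      · by_cases hl : l ∈ B <;> simp [Finset.piecewise, hl, hli]
    rw [this]
    ring

lemma tele_aux {k : ℕ} {V : Type*} [Fintype V] (F : (Fin k → V) → ℤ) (A : Finset (Fin k)) :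
    ∀ T : Finset (Fin k), Disjoint T A →
    ∑ x : Fin k → V, ∑ x' : Fin k → V, ∑ y : Fin k → V,
      |DD F A x y - DD F A (T.piecewise x' x) y|
    ≤ (Fintype.card (Fin k → V) : ℤ) * ∑ i ∈ T, ∑ x : Fin k → V, ∑ y : Fin k → V,
        |DD F (insert i A) x y| := by
  intro T
  induction T using Finset.induction_on with
  | empty => intro _; simp
  | insert i T hiT ih =>
    intro hd
    rw [Finset.disjoint_insert_left] at hd
    have ih' := ih hd.2
    have key : ∑ x : Fin k → V, ∑ x' : Fin k → V, ∑ y : Fin k → V,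
        |DD F (insert i A) (T.piecewise x' x) (Function.update y i (x' i))|
        = (Fintype.card (Fin k → V) : ℤ) * ∑ x : Fin k → V, ∑ y : Fin k → V,
          |DD F (insert i A) x y| := by
      have hinv1 : Function.Involutive (fun z : (Fin k → V) × (Fin k → V) =>
          (T.piecewise z.2 z.1, T.piecewise z.1 z.2)) := by
        intro z
        ext l <;> by_cases hl : l ∈ T <;> simp [Finset.piecewise, hl]
      have hinv2 : Function.Involutive (fun z : (Fin k → V) × (Fin k → V) =>
          (Function.update z.1 i (z.2 i), Function.update z.2 i (z.1 i))) := by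
        intro z
        simp
      have e1 : ∑ z : (Fin k → V) × (Fin k → V), ∑ y : Fin k → V,
          |DD F (insert i A) (T.piecewise z.2 z.1) (Function.update y i (z.2 i))|
          = ∑ z : (Fin k → V) × (Fin k → V), ∑ y : Fin k → V,
          |DD F (insert i A) z.1 (Function.update y i (z.2 i))| := by
        refine Fintype.sum_equiv hinv1.toPerm _ _ ?_
        intro z
        refine Finset.sum_congr rfl fun y _ => ?_
        simp [Function.Involutive.toPerm, hiT]
      have e2 : ∀ x : Fin k → V, ∑ z : (Fin k → V) × (Fin k → V),
          |DD F (insert i A) x (Function.update z.2 i (z.1 i))|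
          = ∑ z : (Fin k → V) × (Fin k → V), |DD F (insert i A) x z.2| := by
        intro x
        refine Fintype.sum_equiv hinv2.toPerm _ _ ?_
        intro z
        rfl
      rw [Fintype.sum_prod_type, Fintype.sum_prod_type] at e1
      rw [e1, Finset.mul_sum]
      refine Finset.sum_congr rfl fun x _ => ?_
      have e3 := e2 x
      rw [Fintype.sum_prod_type, Fintype.sum_prod_type] at e3
      simp only at e3 ⊢
      rw [e3]
      simp
    rw [Finset.sum_insert hiT, mul_add, ← key, add_comm]
    refine le_trans ?_ (add_le_add_left ih' _)
    rw [← Finset.sum_add_distrib]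
    refine Finset.sum_le_sum fun x _ => ?_
    rw [← Finset.sum_add_distrib]
    refine Finset.sum_le_sum fun x' _ => ?_
    rw [← Finset.sum_add_distrib]
    refine Finset.sum_le_sum fun y _ => ?_
    rw [← DD_insert F A i hd.1]
    have : (insert i T).piecewise x' x = Function.update (T.piecewise x' x) i (x' i) := by
      rw [Finset.piecewise_insert]
    rw [this]
    exact abs_sub_le _ _ _

lemma tele {k : ℕ} {V : Type*} [Fintype V] (F : (Fin k → V) → ℤ) (A : Finset (Fin k)) :
    (Fintype.card (Fin k → V) : ℤ) * ∑ x : Fin k → V, ∑ y : Fin k → V, |DD F A x y|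
    ≤ (∑ x : Fin k → V, ∑ y : Fin k → V, |∑ x' : Fin k → V, DD F A (A.piecewise x x') y|)
      + (Fintype.card (Fin k → V) : ℤ) * ∑ i ∈ Aᶜ, ∑ x : Fin k → V, ∑ y : Fin k → V,
        |DD F (insert i A) x y| := by
  have h := tele_aux F A Aᶜ (disjoint_compl_left)
  refine le_trans ?_ (add_le_add_right h _)
  rw [Finset.mul_sum, ← Finset.sum_add_distrib]
  refine Finset.sum_le_sum fun x _ => ?_
  rw [Finset.mul_sum, Finset.sum_comm, ← Finset.sum_add_distrib]
  refine Finset.sum_le_sum fun y _ => ?_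
  have h1 : ∀ x' : Fin k → V, Aᶜ.piecewise x' x = A.piecewise x x' := by
    intro x'; rw [Finset.piecewise_compl]
  simp_rw [h1]
  have h2 : (Fintype.card (Fin k → V) : ℤ) * DD F A x y
      = ∑ x' : Fin k → V, DD F A (A.piecewise x x') y
        + ∑ x' : Fin k → V, (DD F A x y - DD F A (A.piecewise x x') y) := by
    rw [← Finset.sum_add_distrib]
    simp
  have h3 : (Fintype.card (Fin k → V) : ℤ) * |DD F A x y|
      = |(Fintype.card (Fin k → V) : ℤ) * DD F A x y| := by
    rw [abs_mul, Nat.abs_cast]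
  rw [h3, h2]
  refine (abs_add_le _ _).trans (add_le_add_right (Finset.abs_sum_le_sum_abs _ _) _)

lemma perm_ext {n : ℕ} {ι : Type*} (p q : ι → Fin n) (hp : Function.Injective p)
    (hq : Function.Injective q) : ∃ a : Equiv.Perm (Fin n), ∀ i, a (p i) = q i := by
  classical
  let e : {z // z ∈ Set.range p} ≃ {z // z ∈ Set.range q} :=
    (Equiv.ofInjective p hp).symm.trans (Equiv.ofInjective q hq)
  refine ⟨e.extendSubtype, fun i => ?_⟩
  rw [Equiv.extendSubtype_apply_of_mem e (p i) ⟨i, rfl⟩]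
  have : (Equiv.ofInjective p hp).symm ⟨p i, ⟨i, rfl⟩⟩ = i := by
    rw [Equiv.symm_apply_eq]; rfl
  simp only [e, Equiv.trans_apply, this]
  rfl

/-- The permutation average of alternating sums. -/
def UA {n r : ℕ} (G : Finset (Finset (Fin n))) (X Y : Fin r → Fin n) : ℤ :=
  ∑ a : Equiv.Perm (Fin n), |UU G univ (a ∘ X) (a ∘ Y)|

lemma UA_eq {n k r : ℕ} (G : Finset (Finset (Fin n))) (A : Finset (Fin k)) (hA : A.card = r)
    (x y : Fin k → Fin n) (hxy : Function.Injective (Sum.elim x y))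
    (X Y : Fin r → Fin n) (hXY : Function.Injective (Sum.elim X Y)) :
    ∑ a : Equiv.Perm (Fin n), |UU G A (a ∘ x) (a ∘ y)| = UA G X Y := by
  subst hA
  let e : Fin A.card ≃ A := A.equivFin.symm
  have h1 : ∀ x y : Fin k → Fin n, UU G A x y = UU G univ (fun i => x (e i)) (fun i => y (e i)) := by
    intro x y
    unfold UU
    refine Finset.sum_congr rfl fun S _ => ?_
    rw [← Finset.prod_coe_sort]
    exact (Equiv.prod_comp e (fun i : A => ((if x i ∈ S then (1 : ℤ) else 0)
      - (if y i ∈ S then 1 else 0)))).symm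
  have hinj : Function.Injective (fun z : Fin A.card ⊕ Fin A.card =>
      Sum.elim x y (Sum.map (fun i => (e i : Fin k)) (fun i => (e i : Fin k)) z)) := by
    refine hxy.comp ?_
    have : Function.Injective (fun i => (e i : Fin k)) := Subtype.val_injective.comp e.injective
    exact Sum.map_injective.2 ⟨this, this⟩
  obtain ⟨a0, ha0⟩ := perm_ext _ _ hXY hinj
  unfold UA
  simp_rw [h1]
  refine Fintype.sum_equiv (Equiv.mulRight a0) _ _ ?_
  intro a
  congr 2
  · funext i
    have := ha0 (Sum.inl i)
    simp at this
    simp [this]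
  · funext i
    have := ha0 (Sum.inr i)
    simp at this
    simp [this]

lemma noninj_count {ι V : Type*} [Fintype ι] [DecidableEq ι] [Fintype V] [DecidableEq V]
    [DecidablePred (fun z : ι → V => ¬ Function.Injective z)] :
    (Fintype.card V : ℝ) * ∑ z : ι → V, (if ¬ Function.Injective z then (1 : ℝ) else 0)
      ≤ (Fintype.card ι : ℝ) ^ 2 * (Fintype.card V : ℝ) ^ Fintype.card ι := by
  have h1 : ∀ z : ι → V, (if ¬ Function.Injective z then (1 : ℝ) else 0)
      ≤ ∑ i : ι, ∑ j : ι, (if i ≠ j ∧ z i = z j then (1 : ℝ) else 0) := by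
    intro z
    have hnn : ∀ i j : ι, (0 : ℝ) ≤ (if i ≠ j ∧ z i = z j then (1 : ℝ) else 0) := by
      intro i j; split_ifs <;> norm_num
    split_ifs with h
    · exact Finset.sum_nonneg fun i _ => Finset.sum_nonneg fun j _ => hnn i j
    · unfold Function.Injective at h
      push Not at h
      obtain ⟨i, j, hij, hne⟩ := h
      have h2 := Finset.single_le_sum (f := fun j => (if i ≠ j ∧ z i = z j then (1 : ℝ) else 0))
        (fun j _ => hnn i j) (Finset.mem_univ j)
      have h3 := Finset.single_le_sum (f := fun i => ∑ j : ι,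
        (if i ≠ j ∧ z i = z j then (1 : ℝ) else 0))
        (fun i _ => Finset.sum_nonneg fun j _ => hnn i j) (Finset.mem_univ i)
      rw [if_pos ⟨hne, hij⟩] at h2
      exact h2.trans h3
  have h2 : ∀ i j : ι, (Fintype.card V : ℝ) * ∑ z : ι → V,
      (if i ≠ j ∧ z i = z j then (1 : ℝ) else 0) ≤ (Fintype.card V : ℝ) ^ Fintype.card ι := by
    intro i j
    rw [← sum_update' (fun z : ι → V => (if i ≠ j ∧ z i = z j then (1 : ℝ) else 0)) i]
    by_cases hij : i = j
    · simp [hij]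
    · have : ∀ (v : V) (z : ι → V), (if i ≠ j ∧ Function.update z i v i = Function.update z i v j
          then (1 : ℝ) else 0) = if v = z j then 1 else 0 := by
        intro v z
        simp [hij, Ne.symm hij]
      simp_rw [this]
      rw [Finset.sum_comm]
      simp
  calc _ ≤ (Fintype.card V : ℝ) * ∑ z : ι → V, ∑ i : ι, ∑ j : ι,
        (if i ≠ j ∧ z i = z j then (1 : ℝ) else 0) := by
        gcongr with z; exact h1 z
    _ = ∑ i : ι, ∑ j : ι, (Fintype.card V : ℝ) * ∑ z : ι → V,
        (if i ≠ j ∧ z i = z j then (1 : ℝ) else 0) := by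
        rw [Finset.sum_comm, Finset.mul_sum]
        refine Finset.sum_congr rfl fun i _ => ?_
        rw [Finset.sum_comm, Finset.mul_sum]
    _ ≤ ∑ i : ι, ∑ j : ι, (Fintype.card V : ℝ) ^ Fintype.card ι := by
        gcongr with i _ j _; exact h2 i j
    _ = _ := by simp; ring

lemma first_term {n k r : ℕ} (hn : 0 < n) (G : Finset (Finset (Fin n)))
    (hG : ∀ e ∈ G, e.card = k) (A : Finset (Fin k)) (hA : A.card = r) (ε : ℝ) (hε : 0 ≤ ε)
    (X Y : Fin r → Fin n) (hXY : Function.Injective (Sum.elim X Y))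
    (hU : (UA G X Y : ℝ) ≤ ε * (n : ℝ) ^ (k - r) * n.factorial) :
    ((∑ x : Fin k → Fin n, ∑ y : Fin k → Fin n,
      |∑ x' : Fin k → Fin n, DD (tupF G) A (A.piecewise x x') y| : ℤ) : ℝ)
    ≤ (k.factorial * ε + 4 * k ^ 2 * 2 ^ k / n) * (n : ℝ) ^ (k + k + k) := by
  classical
  have hn0 : (0 : ℝ) < n := by exact_mod_cast hn
  have hrk : r ≤ k := by rw [← hA]; simpa using Finset.card_le_univ A
  let Q : (Fin k ⊕ Fin k → Fin n) → ℝ := fun z =>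
    |((∑ x' : Fin k → Fin n, DD (tupF G) A (A.piecewise (z ∘ Sum.inl) x') (z ∘ Sum.inr) : ℤ) : ℝ)|
  have h0 : ((∑ x : Fin k → Fin n, ∑ y : Fin k → Fin n,
      |∑ x' : Fin k → Fin n, DD (tupF G) A (A.piecewise x x') y| : ℤ) : ℝ) = ∑ z, Q z := by
    push_cast
    rw [← Fintype.sum_prod_type']
    refine (Fintype.sum_equiv (Equiv.sumArrowEquivProdArrow _ _ _) _ _ (fun w => ?_)).symm
    simp only [Q]
    push_cast
    rfl
  rw [h0]
  -- the trivial bound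
  have hDD : ∀ u y, |((DD (tupF G) A u y : ℤ) : ℝ)| ≤ 2 ^ k := by
    intro u y
    have h1 : |DD (tupF G) A u y| ≤ 2 ^ A.card := by
      unfold DD
      refine (Finset.abs_sum_le_sum_abs _ _).trans ?_
      have : ∀ B ∈ A.powerset, |(-1 : ℤ) ^ B.card * tupF G (B.piecewise y u)| ≤ 1 := by
        intro B _
        rw [abs_mul, abs_pow]
        rcases tupF_01 G (B.piecewise y u) with h | h <;> simp [h]
      refine (Finset.sum_le_sum this).trans ?_
      simp
    have h2 : (2 : ℤ) ^ A.card ≤ 2 ^ k := by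
      apply pow_le_pow_right₀ (by norm_num); omega
    exact_mod_cast h1.trans h2
  have hQ1 : ∀ z, Q z ≤ (n : ℝ) ^ k * 2 ^ k := by
    intro z
    simp only [Q]
    push_cast
    refine (Finset.abs_sum_le_sum_abs _ _).trans ?_
    refine (Finset.sum_le_sum fun x' _ => hDD _ _).trans ?_
    simp
  let U : (Fin k ⊕ Fin k → Fin n) → ℝ := fun z =>
    if Function.Injective z then |(UU G A (z ∘ Sum.inl) (z ∘ Sum.inr) : ℝ)| else 0
  have hQ2 : ∀ z, Q z ≤ (n : ℝ) ^ r * (k - r).factorial * U z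
      + (n : ℝ) ^ k * 2 ^ k * (if ¬ Function.Injective z then (1 : ℝ) else 0) := by
    intro z
    by_cases hz : Function.Injective z
    · have hz' : Function.Injective (Sum.elim (z ∘ Sum.inl) (z ∘ Sum.inr)) := by
        rwa [Sum.elim_comp_inl_inr]
      simp only [Q, U, hz, if_true, not_true_eq_false, if_false, mul_zero, add_zero]
      rw [UU_eq G hG A _ _ hz', hA]
      push_cast
      rw [abs_mul]
      apply le_of_eq
      congr 1
      apply abs_of_nonneg
      positivity
    · have := hQ1 z
      simp only [U, hz, if_false, not_false_eq_true, if_true]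
      linarith
  have hUsum : ∑ z, U z ≤ ε * (n : ℝ) ^ (k - r) * (n : ℝ) ^ (k + k) := by
    have hf : (0 : ℝ) < n.factorial := by exact_mod_cast Nat.factorial_pos n
    refine le_of_mul_le_mul_left ?_ hf
    have h1 : ∀ a : Equiv.Perm (Fin n), ∑ z, U z = ∑ z : Fin k ⊕ Fin k → Fin n, U (a ∘ z) := by
      intro a
      refine (Fintype.sum_equiv (Equiv.arrowCongr (Equiv.refl _) a) _ _ ?_).symm
      intro z
      rfl
    have h2 : (n.factorial : ℝ) * ∑ z, U z
        = ∑ z : Fin k ⊕ Fin k → Fin n, ∑ a : Equiv.Perm (Fin n), U (a ∘ z) := by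
      rw [Finset.sum_comm, Finset.sum_congr rfl (fun a _ => (h1 a).symm)]
      simp [Fintype.card_perm]
    rw [h2]
    have h3 : ∀ z : Fin k ⊕ Fin k → Fin n, ∑ a : Equiv.Perm (Fin n), U (a ∘ z)
        ≤ ε * (n : ℝ) ^ (k - r) * n.factorial := by
      intro z
      by_cases hz : Function.Injective z
      · have hz' : Function.Injective (Sum.elim (z ∘ Sum.inl) (z ∘ Sum.inr)) := by
          rwa [Sum.elim_comp_inl_inr]
        have h4 := UA_eq G A hA (z ∘ Sum.inl) (z ∘ Sum.inr) hz' X Y hXY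
        refine le_trans (le_of_eq ?_) hU
        rw [← h4]
        push_cast
        refine Finset.sum_congr rfl fun a _ => ?_
        simp only [U, a.injective.comp hz, if_true]
        rfl
      · have : ∀ a : Equiv.Perm (Fin n), U (a ∘ z) = 0 := by
          intro a
          simp only [U]
          rw [if_neg]
          rwa [a.injective.of_comp_iff]
        rw [Finset.sum_congr rfl (fun a _ => this a)]
        simp only [Finset.sum_const_zero]
        positivity
    refine (Finset.sum_le_sum fun z _ => h3 z).trans (le_of_eq ?_)
    simp
    ring
  have hcount := noninj_count (ι := Fin k ⊕ Fin k) (V := Fin n)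
  simp only [Fintype.card_sum, Fintype.card_fin] at hcount
  set Cn := ∑ z : Fin k ⊕ Fin k → Fin n, (if ¬ Function.Injective z then (1 : ℝ) else 0) with hCn
  have hcount' : Cn ≤ 4 * k ^ 2 * (n : ℝ) ^ (k + k) / n := by
    rw [le_div_iff₀ hn0, mul_comm]
    refine hcount.trans (le_of_eq ?_)
    push_cast
    ring
  have hfac : ((k - r).factorial : ℝ) ≤ k.factorial := by
    exact_mod_cast Nat.factorial_le (Nat.sub_le k r)
  calc ∑ z, Q z ≤ (n : ℝ) ^ r * (k - r).factorial * ∑ z, U z + (n : ℝ) ^ k * 2 ^ k * Cn := by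
        rw [hCn, Finset.mul_sum, Finset.mul_sum, ← Finset.sum_add_distrib]
        exact Finset.sum_le_sum fun z _ => hQ2 z
    _ ≤ (n : ℝ) ^ r * k.factorial * (ε * (n : ℝ) ^ (k - r) * (n : ℝ) ^ (k + k))
        + (n : ℝ) ^ k * 2 ^ k * (4 * k ^ 2 * (n : ℝ) ^ (k + k) / n) := by
        gcongr
    _ = k.factorial * ε * ((n : ℝ) ^ r * (n : ℝ) ^ (k - r)) * (n : ℝ) ^ (k + k)
        + (n : ℝ) ^ k * 2 ^ k * (4 * k ^ 2 * (n : ℝ) ^ (k + k) / n) := by ring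
    _ = _ := by
        rw [← pow_add, Nat.add_sub_cancel' hrk]
        ring

theorem part1 (k : ℕ) (hk : 2 ≤ k) (δ : ℝ) (hδ : 0 < δ) : ∃ ε : ℝ, 0 < ε ∧ ∃ n₀ : ℕ,
    ∀ (n : ℕ), n₀ ≤ n → ∀ (G : Finset (Finset (Fin n))), (∀ e ∈ G, e.card = k) →
    δ * (n : ℝ) ^ k ≤ (G.card : ℝ) → (G.card : ℝ) ≤ (n.choose k : ℝ) - δ * (n : ℝ) ^ k →
    ∃ r, k - gDef k ≤ r ∧ r ≤ k ∧ ∀ X Y : Fin r → Fin n, Function.Injective (Sum.elim X Y) →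
      ε * (n : ℝ) ^ (k - r) * n.factorial ≤ (UA G X Y : ℝ) := by
  obtain ⟨η, hη, hS⟩ := partS k hk δ hδ
  have hkf : (0 : ℝ) < k.factorial := by exact_mod_cast Nat.factorial_pos k
  set D : ℝ := ((k : ℝ) + 1) ^ k with hD
  have hD0 : 0 < D := by positivity
  set ε := η / (2 * D * k.factorial) with hε
  have hε0 : 0 < ε := by positivity
  obtain ⟨n₁, hn₁⟩ := exists_nat_gt (D * (4 * k ^ 2 * 2 ^ k) / (η / 2))
  refine ⟨ε, hε0, n₁ + 1, ?_⟩
  intro n hn G hG hd1 hd2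
  have hnpos : 0 < n := by omega
  have hn0 : (0 : ℝ) < n := by exact_mod_cast hnpos
  by_contra hcon
  push Not at hcon
  set E : ℝ := k.factorial * ε + 4 * k ^ 2 * 2 ^ k / n with hE
  have hE0 : 0 ≤ E := by positivity
  have hmain : ∀ j : ℕ, ∀ A : Finset (Fin k), A.card + j = k → k - gDef k ≤ A.card →
      ((∑ x : Fin k → Fin n, ∑ y : Fin k → Fin n, |DD (tupF G) A x y| : ℤ) : ℝ)
        ≤ ((k : ℝ) + 1) ^ j * E * (n : ℝ) ^ (k + k) := by
    intro j
    induction j with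
    | zero =>
      intro A hA hA2
      obtain ⟨X, Y, hXY, hU⟩ := hcon A.card hA2 (by omega)
      have h1 := first_term hnpos G hG A rfl ε hε0.le X Y hXY hU.le
      have h2 := tele (tupF G) A
      have hAc : Aᶜ = ∅ := by
        rw [Finset.compl_eq_empty_iff]
        apply Finset.eq_univ_of_card
        simpa using hA
      rw [hAc, Finset.sum_empty, mul_zero, add_zero] at h2
      have h3 := (Int.cast_le (R := ℝ).2 h2).trans h1
      simp only [Fintype.card_fun, Fintype.card_fin] at h3
      have hp : (0 : ℝ) < (n : ℝ) ^ k := by positivity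
      refine le_of_mul_le_mul_left ?_ hp
      rw [Int.cast_mul] at h3
      refine le_trans (le_of_eq ?_) (h3.trans (le_of_eq ?_))
      · push_cast; rfl
      · ring
    | succ j ih =>
      intro A hA hA2
      obtain ⟨X, Y, hXY, hU⟩ := hcon A.card hA2 (by omega)
      have h1 := first_term hnpos G hG A rfl ε hε0.le X Y hXY hU.le
      have h2 := tele (tupF G) A
      have h3 := (Int.cast_le (R := ℝ).2 h2)
      rw [Int.cast_add, Int.cast_mul, Int.cast_mul, Int.cast_sum (s := Aᶜ)] at h3
      simp only [Fintype.card_fun, Fintype.card_fin] at h3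
      have h4 : ∑ i ∈ Aᶜ, ((∑ x : Fin k → Fin n, ∑ y : Fin k → Fin n,
          |DD (tupF G) (insert i A) x y| : ℤ) : ℝ)
          ≤ k * (((k : ℝ) + 1) ^ j * E * (n : ℝ) ^ (k + k)) := by
        have h5 : ∀ i ∈ Aᶜ, ((∑ x : Fin k → Fin n, ∑ y : Fin k → Fin n,
          |DD (tupF G) (insert i A) x y| : ℤ) : ℝ) ≤ ((k : ℝ) + 1) ^ j * E * (n : ℝ) ^ (k + k) := by
          intro i hi
          rw [Finset.mem_compl] at hi
          have hc := Finset.card_insert_of_notMem hi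
          exact ih (insert i A) (by omega) (by omega)
        refine (Finset.sum_le_sum h5).trans ?_
        rw [Finset.sum_const, nsmul_eq_mul]
        gcongr
        simpa using Finset.card_le_univ Aᶜ
      have hp : (0 : ℝ) < (n : ℝ) ^ k := by positivity
      refine le_of_mul_le_mul_left ?_ hp
      have hone : (1 : ℝ) ≤ ((k : ℝ) + 1) ^ j := one_le_pow₀ (by linarith [Nat.cast_nonneg (α := ℝ) k])
      calc _ ≤ _ := by
            refine le_trans (le_of_eq ?_) h3
            push_cast; rfl
        _ ≤ E * (n : ℝ) ^ (k + k + k) + (n : ℝ) ^ k *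
            (k * (((k : ℝ) + 1) ^ j * E * (n : ℝ) ^ (k + k))) := by
            push_cast at h1 h4 ⊢
            gcongr
        _ ≤ ((k : ℝ) + 1) ^ j * E * (n : ℝ) ^ (k + k + k) + (n : ℝ) ^ k *
            (k * (((k : ℝ) + 1) ^ j * E * (n : ℝ) ^ (k + k))) := by
            gcongr
            exact le_mul_of_one_le_left hE0 hone
        _ = _ := by ring
  refine hS n hnpos G hG hd1 hd2 ?_
  intro A hA
  have hAk : A.card ≤ k := by simpa using Finset.card_le_univ A
  refine (hmain (k - A.card) A (by omega) hA).trans ?_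
  gcongr
  have h1 : ((k : ℝ) + 1) ^ (k - A.card) ≤ D := by
    rw [hD]
    exact pow_le_pow_right₀ (by linarith [Nat.cast_nonneg (α := ℝ) k]) (Nat.sub_le _ _)
  have h2 : D * (4 * k ^ 2 * 2 ^ k / n) ≤ η / 2 := by
    rw [div_lt_iff₀ (by positivity)] at hn₁
    rw [mul_div_assoc', div_le_iff₀ hn0]
    have : (n₁ : ℝ) ≤ n := by exact_mod_cast (by omega : n₁ ≤ n)
    nlinarith
  have h3 : D * (k.factorial * ε) = η / 2 := by
    rw [hε]; field_simp
  calc _ ≤ D * E := by gcongr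
    _ = D * (k.factorial * ε) + D * (4 * k ^ 2 * 2 ^ k / n) := by rw [hE]; ring
    _ ≤ η := by linarith

lemma interp (k : ℕ) (hk : 1 ≤ k) : ∃ ρ l : Fin (k + 1) → ℝ, (∀ j, 0 ≤ ρ j ∧ ρ j ≤ 1) ∧
    ∀ d : ℕ, d ≤ k → ∑ j, l j * ρ j ^ d = if d = 1 then 1 else 0 := by
  let ρ : Fin (k + 1) → ℝ := fun j => 1 / ((j : ℝ) + 1)
  have hinj : Function.Injective ρ := by
    intro a b h
    simp only [ρ] at h
    have ha : ((a : ℕ) : ℝ) + 1 ≠ 0 := by positivity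
    have hb : ((b : ℕ) : ℝ) + 1 ≠ 0 := by positivity
    rw [div_eq_div_iff ha hb] at h
    have : ((a : ℕ) : ℝ) = (b : ℕ) := by linarith
    exact Fin.ext (by exact_mod_cast this)
  let V := Matrix.vandermonde ρ
  have hdet : V.det ≠ 0 := Matrix.det_vandermonde_ne_zero_iff.2 hinj
  have hinv : V⁻¹ * V = 1 := Matrix.nonsing_inv_mul V (isUnit_iff_ne_zero.2 hdet)
  refine ⟨ρ, fun j => V⁻¹ ⟨1, by omega⟩ j, ?_, ?_⟩
  · intro j
    refine ⟨by simp only [ρ]; positivity, ?_⟩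
    simp only [ρ]
    rw [div_le_one (by positivity)]
    linarith [Nat.cast_nonneg (α := ℝ) (j : ℕ)]
  · intro d hd
    have h1 := congrFun (congrFun hinv ⟨1, by omega⟩) ⟨d, by omega⟩
    rw [Matrix.mul_apply, Matrix.one_apply] at h1
    simp only [V, Matrix.vandermonde_apply, Fin.mk.injEq] at h1
    rw [h1]
    simp [eq_comm]

/-- The sign character. -/
def chi (b : Bool) : ℝ := if b then -1 else 1

lemma chi_sq (b : Bool) : chi b * chi b = 1 := by
  cases b <;> simp [chi]

lemma abs_chi (b : Bool) : |chi b| = 1 := by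
  cases b <;> simp [chi]

lemma zexp {N : ℕ} (Y : (Fin N → Bool) → ℝ) (θ : Fin N → ℝ) (z : ℂ) :
    ∑ s : Fin N → Bool, (Y s : ℂ) * ∏ i, (1 + z * (θ i : ℂ) * (chi (s i) : ℂ))
    = ∑ R : Finset (Fin N), z ^ R.card * (((∏ i ∈ R, θ i) * ∑ s : Fin N → Bool,
        Y s * ∏ i ∈ R, chi (s i) : ℝ) : ℂ) := by
  simp_rw [Finset.prod_one_add, Finset.powerset_univ]
  simp_rw [Finset.mul_sum]
  rw [Finset.sum_comm]
  refine Finset.sum_congr rfl fun R _ => ?_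
  push_cast
  rw [Finset.mul_sum]
  refine Finset.sum_congr rfl fun s _ => ?_
  simp_rw [Finset.prod_mul_distrib, Finset.prod_const]
  ring

lemma og_core {k N : ℕ} (ρ l : Fin (k + 1) → ℝ)
    (hl : ∀ d : ℕ, d ≤ k → ∑ j, l j * ρ j ^ d = if d = 1 then 1 else 0)
    (Y : (Fin N → Bool) → ℝ)
    (hdeg : ∀ R : Finset (Fin N), k < R.card → ∑ s, Y s * ∏ i ∈ R, chi (s i) = 0)
    (c : ℂ) (B : ℝ)
    (hB : ∀ θ : Fin N → ℝ, (∀ i, |θ i| ≤ 1) → ∀ j, ‖∑ s : Fin N → Bool, (Y s : ℂ) *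
      ∏ i, (1 + c * (ρ j : ℂ) * (θ i : ℂ) * (chi (s i) : ℂ))‖ ≤ B) :
    ‖c‖ * ∑ i, |∑ s, Y s * chi (s i)| ≤ (∑ j, |l j|) * B := by
  set W : Fin N → ℝ := fun i => ∑ s, Y s * chi (s i) with hW
  let θ : Fin N → ℝ := fun i => SignType.sign (W i)
  have hθ : ∀ i, |θ i| ≤ 1 := by
    intro i
    simp only [θ]
    rcases lt_trichotomy (W i) 0 with h | h | h <;> simp [h]
  have hθW : ∀ i, θ i * W i = |W i| := by
    intro i
    simp only [θ]
    exact sign_mul_self _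
  set y : Finset (Fin N) → ℝ := fun R => (∏ i ∈ R, θ i) * ∑ s : Fin N → Bool,
        Y s * ∏ i ∈ R, chi (s i) with hy
  have key : ∑ j, (l j : ℂ) * ∑ s : Fin N → Bool, (Y s : ℂ) *
      ∏ i, (1 + c * (ρ j : ℂ) * (θ i : ℂ) * (chi (s i) : ℂ))
      = c * ((∑ i, |W i| : ℝ) : ℂ) := by
    simp_rw [zexp]
    simp_rw [Finset.mul_sum]
    rw [Finset.sum_comm]
    have h1 : ∀ R : Finset (Fin N), ∑ j, (l j : ℂ) * ((c * (ρ j : ℂ)) ^ R.card * ((y R : ℝ) : ℂ))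
        = if R.card = 1 then c * ((y R : ℝ) : ℂ) else 0 := by
      intro R
      have h2 : ∑ j, (l j : ℂ) * ((c * (ρ j : ℂ)) ^ R.card * ((y R : ℝ) : ℂ))
          = c ^ R.card * ((∑ j, l j * ρ j ^ R.card : ℝ) : ℂ) * ((y R : ℝ) : ℂ) := by
        push_cast
        rw [Finset.mul_sum, Finset.sum_mul]
        refine Finset.sum_congr rfl fun j _ => ?_
        ring
      rw [h2]
      by_cases hR : R.card ≤ k
      · rw [hl _ hR]
        split_ifs with h
        · rw [h]; simp
        · simp
      · have h3 : y R = 0 := by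
          simp only [hy]
          rw [hdeg R (by omega), mul_zero]
        rw [h3]; simp
    simp only [hy, Finset.mul_sum] at h1
    rw [Finset.sum_congr rfl (fun R _ => h1 R)]
    rw [← Finset.sum_filter]
    have h4 : (univ.filter (fun R : Finset (Fin N) => R.card = 1))
        = univ.map ⟨fun i : Fin N => ({i} : Finset (Fin N)), Finset.singleton_injective⟩ := by
      ext R
      simp [Finset.card_eq_one, eq_comm]
    rw [h4, Finset.sum_map]
    push_cast
    rw [Finset.mul_sum]
    refine Finset.sum_congr rfl fun i _ => ?_
    rw [← hθW i]
    simp only [Function.Embedding.coeFn_mk, Finset.prod_singleton, hW]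
    push_cast
    simp only [Finset.mul_sum]
  have h5 : ‖c‖ * ∑ i, |W i| = ‖c * ((∑ i, |W i| : ℝ) : ℂ)‖ := by
    rw [norm_mul, Complex.norm_real, Real.norm_of_nonneg (Finset.sum_nonneg fun i _ => abs_nonneg _)]
  rw [h5, ← key, Finset.sum_mul]
  refine (norm_sum_le _ _).trans (Finset.sum_le_sum fun j _ => ?_)
  rw [norm_mul, Complex.norm_real, Real.norm_eq_abs]
  exact mul_le_mul_of_nonneg_left (hB θ hθ j) (abs_nonneg _)

lemma one_group (k : ℕ) (hk : 1 ≤ k) : ∃ C : ℝ, 1 ≤ C ∧ ∀ (N : ℕ) (Y : (Fin N → Bool) → ℝ),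
    (∀ R : Finset (Fin N), k < R.card → ∑ s, Y s * ∏ i ∈ R, chi (s i) = 0) →
    (∀ D, (∀ s, |Y s| ≤ D) → ∑ i, |∑ s, Y s * chi (s i)| ≤ C * (2 ^ N * D)) ∧
    ∑ i, |∑ s, Y s * chi (s i)| ≤ C * √N * ∑ s, |Y s| := by
  obtain ⟨ρ, l, hρ, hl⟩ := interp k hk
  set L := ∑ j, |l j| with hL
  have hL0 : 0 ≤ L := Finset.sum_nonneg fun j _ => abs_nonneg _
  refine ⟨2 * L + 1, by linarith, ?_⟩
  intro N Y hdeg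
  have hle : ∀ (θ : Fin N → ℝ), (∀ i, |θ i| ≤ 1) → ∀ j i b, |ρ j * θ i * chi b| ≤ 1 := by
    intro θ hθ j i b
    rw [abs_mul, abs_mul, abs_chi, mul_one, abs_of_nonneg (hρ j).1]
    exact mul_le_one₀ (hρ j).2 (abs_nonneg _) (hθ i)
  constructor
  · intro D hD
    have hD0 : 0 ≤ D := (abs_nonneg _).trans (hD (fun _ => true))
    have h1 := og_core ρ l hl Y hdeg 1 (2 ^ N * D) (by
      intro θ hθ j
      refine (norm_sum_le _ _).trans ?_
      have h2 : ∀ s : Fin N → Bool, ‖(Y s : ℂ) *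
          ∏ i, (1 + 1 * (ρ j : ℂ) * (θ i : ℂ) * (chi (s i) : ℂ))‖
          ≤ D * ∏ i, (1 + ρ j * θ i * chi (s i)) := by
        intro s
        have h3 : ∏ i, (1 + 1 * (ρ j : ℂ) * (θ i : ℂ) * (chi (s i) : ℂ))
            = ((∏ i, (1 + ρ j * θ i * chi (s i)) : ℝ) : ℂ) := by
          push_cast
          simp
        have h4 : 0 ≤ ∏ i, (1 + ρ j * θ i * chi (s i)) := by
          refine Finset.prod_nonneg fun i _ => ?_
          have := (abs_le.1 (hle θ hθ j i (s i))).1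
          linarith
        rw [h3, norm_mul, Complex.norm_real, Complex.norm_real, Real.norm_eq_abs,
          Real.norm_of_nonneg h4]
        exact mul_le_mul_of_nonneg_right (hD s) h4
      refine (Finset.sum_le_sum fun s _ => h2 s).trans ?_
      rw [← Finset.mul_sum]
      have h5 : ∑ s : Fin N → Bool, ∏ i, (1 + ρ j * θ i * chi (s i)) = 2 ^ N := by
        have h6 := Finset.prod_univ_sum (fun _ : Fin N => (univ : Finset Bool))
          (fun i b => 1 + ρ j * θ i * chi b)
        rw [Fintype.piFinset_univ] at h6
        rw [← h6]
        have h7 : ∀ i : Fin N, ∑ b : Bool, (1 + ρ j * θ i * chi b) = 2 := by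
          intro i
          simp [chi]
          ring
        rw [Finset.prod_congr rfl (fun i _ => h7 i)]
        simp
      rw [h5, mul_comm])
    rw [norm_one, one_mul] at h1
    refine h1.trans ?_
    have : 0 ≤ 2 ^ N * D := by positivity
    rw [← hL]
    nlinarith
  · rcases Nat.eq_zero_or_pos N with hN | hN
    · subst hN; simp
    have hN0 : (0 : ℝ) < N := by exact_mod_cast hN
    have hs0 : 0 < √(N : ℝ) := Real.sqrt_pos.2 hN0
    have h1 := og_core ρ l hl Y hdeg (Complex.I * ((1 / √(N : ℝ) : ℝ) : ℂ)) (2 * ∑ s, |Y s|) (by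
      intro θ hθ j
      refine (norm_sum_le _ _).trans ?_
      rw [Finset.mul_sum]
      refine Finset.sum_le_sum fun s _ => ?_
      rw [norm_mul, Complex.norm_real, Real.norm_eq_abs, mul_comm]
      refine mul_le_mul_of_nonneg_right ?_ (abs_nonneg _)
      rw [norm_prod]
      have h2 : ∀ i : Fin N, ‖1 + Complex.I * ((1 / √(N : ℝ) : ℝ) : ℂ) * (ρ j : ℂ) * (θ i : ℂ)
          * (chi (s i) : ℂ)‖ ≤ √(1 + 1 / N) := by
        intro i
        have h3 : 1 + Complex.I * ((1 / √(N : ℝ) : ℝ) : ℂ) * (ρ j : ℂ) * (θ i : ℂ)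
          * (chi (s i) : ℂ) = ((1 : ℝ) : ℂ) + (((ρ j * θ i * chi (s i)) / √N : ℝ) : ℂ) * Complex.I := by
          push_cast
          ring
        rw [h3, Complex.norm_add_mul_I]
        apply Real.sqrt_le_sqrt
        rw [div_pow, Real.sq_sqrt hN0.le, one_pow]
        gcongr
        have := hle θ hθ j i (s i)
        rw [← sq_abs]
        exact pow_le_one₀ (abs_nonneg _) this
      refine (Finset.prod_le_prod (fun i _ => norm_nonneg _) (fun i _ => h2 i)).trans ?_
      rw [Finset.prod_const, Finset.card_univ, Fintype.card_fin]
      have h4 : (√(1 + 1 / (N : ℝ)) ^ N) ^ 2 ≤ 2 ^ 2 := by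
        rw [← pow_mul, mul_comm, pow_mul, Real.sq_sqrt (by positivity)]
        have h5 : 1 + 1 / (N : ℝ) ≤ Real.exp (1 / N) := by
          linarith [Real.add_one_le_exp (1 / (N : ℝ))]
        calc (1 + 1 / (N : ℝ)) ^ N ≤ (Real.exp (1 / N)) ^ N := by gcongr
          _ = Real.exp 1 := by rw [← Real.exp_nat_mul]; congr 1; field_simp
          _ ≤ 2 ^ 2 := by linarith [Real.exp_one_lt_d9]
      exact le_of_sq_le_sq h4 (by norm_num))
    have h6 : ‖Complex.I * ((1 / √(N : ℝ) : ℝ) : ℂ)‖ = 1 / √N := by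
      rw [norm_mul, Complex.norm_I, one_mul, Complex.norm_real, Real.norm_of_nonneg (by positivity)]
    rw [h6, one_div, inv_mul_le_iff₀ hs0, ← hL] at h1
    refine h1.trans ?_
    have h7 : 0 ≤ ∑ s, |Y s| := Finset.sum_nonneg fun s _ => abs_nonneg _
    have h8 : 0 ≤ √(N : ℝ) * ∑ s, |Y s| := by positivity
    nlinarith

lemma sum_fin_cons {α β : Type*} [Fintype α] [AddCommMonoid β] {r : ℕ}
    (g : (Fin (r + 1) → α) → β) : ∑ s, g s = ∑ s' : Fin r → α, ∑ a : α, g (Fin.cons a s') := by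
  rw [Finset.sum_comm, ← Fintype.sum_prod_type']
  exact (Fintype.sum_equiv (Fin.consEquiv (fun _ : Fin (r + 1) => α)) _ _ (fun _ => rfl)).symm

/-- Bounded degree in each group of variables. -/
def DegLe (k : ℕ) {r N : ℕ} (Y : (Fin r → Fin N → Bool) → ℝ) : Prop :=
  ∀ (j : Fin r) (s : Fin r → Fin N → Bool) (R : Finset (Fin N)), k < R.card →
    ∑ t : Fin N → Bool, Y (Function.update s j t) * ∏ i ∈ R, chi (t i) = 0

lemma DegLe.zero {k r N : ℕ} {Y : (Fin (r + 1) → Fin N → Bool) → ℝ} (h : DegLe k Y)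
    (s' : Fin r → Fin N → Bool) (R : Finset (Fin N)) (hR : k < R.card) :
    ∑ t : Fin N → Bool, Y (Fin.cons t s') * ∏ i ∈ R, chi (t i) = 0 := by
  have := h 0 (Fin.cons (fun _ => true) s') R hR
  simpa [Fin.update_cons_zero] using this

lemma DegLe.succ {k r N : ℕ} {Y : (Fin (r + 1) → Fin N → Bool) → ℝ} (h : DegLe k Y) (i0 : Fin N) :
    DegLe k (fun s' : Fin r → Fin N → Bool => ∑ t : Fin N → Bool, Y (Fin.cons t s') * chi (t i0)) := by
  intro j s R hR
  simp_rw [Finset.sum_mul]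
  rw [Finset.sum_comm]
  refine Finset.sum_eq_zero fun t _ => ?_
  have := h j.succ (Fin.cons t s) R hR
  simp_rw [← Fin.cons_update] at this
  calc _ = chi (t i0) * ∑ x : Fin N → Bool, Y (Fin.cons t (Function.update s j x))
        * ∏ i ∈ R, chi (x i) := by
        rw [Finset.mul_sum]
        refine Finset.sum_congr rfl fun x _ => ?_
        ring
    _ = 0 := by rw [this, mul_zero]

lemma split_coef {r N : ℕ} (Y : (Fin (r + 1) → Fin N → Bool) → ℝ) (I' : Fin r → Fin N) (i0 : Fin N) :
    ∑ s, Y s * ∏ j, chi (s j ((Fin.cons i0 I' : Fin (r + 1) → Fin N) j))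
    = ∑ s' : Fin r → Fin N → Bool, (∑ t : Fin N → Bool, Y (Fin.cons t s') * chi (t i0))
        * ∏ j, chi (s' j (I' j)) := by
  rw [sum_fin_cons]
  refine Finset.sum_congr rfl fun s' _ => ?_
  rw [Finset.sum_mul]
  refine Finset.sum_congr rfl fun t _ => ?_
  rw [Fin.prod_univ_succ]
  simp [mul_assoc]

lemma multi_l1 {k N : ℕ} (C : ℝ) (hC : 0 ≤ C)
    (h1 : ∀ Y : (Fin N → Bool) → ℝ,
      (∀ R : Finset (Fin N), k < R.card → ∑ s, Y s * ∏ i ∈ R, chi (s i) = 0) →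
      ∑ i, |∑ s, Y s * chi (s i)| ≤ C * √N * ∑ s, |Y s|) :
    ∀ (r : ℕ) (Y : (Fin r → Fin N → Bool) → ℝ), DegLe k Y →
      ∑ I : Fin r → Fin N, |∑ s, Y s * ∏ j, chi (s j (I j))| ≤ (C * √N) ^ r * ∑ s, |Y s| := by
  intro r
  induction r with
  | zero => intro Y _; simp
  | succ r ih =>
    intro Y hY
    rw [sum_fin_cons (g := fun I : Fin (r + 1) → Fin N => |∑ s, Y s * ∏ j, chi (s j (I j))|)]
    simp_rw [split_coef]
    rw [Finset.sum_comm]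
    calc _ ≤ ∑ i0 : Fin N, (C * √N) ^ r * ∑ s' : Fin r → Fin N → Bool,
          |∑ t : Fin N → Bool, Y (Fin.cons t s') * chi (t i0)| :=
          Finset.sum_le_sum fun i0 _ => ih _ (hY.succ i0)
      _ = (C * √N) ^ r * ∑ s' : Fin r → Fin N → Bool, ∑ i0 : Fin N,
          |∑ t : Fin N → Bool, Y (Fin.cons t s') * chi (t i0)| := by
          rw [← Finset.mul_sum, Finset.sum_comm]
      _ ≤ (C * √N) ^ r * ∑ s' : Fin r → Fin N → Bool, C * √N * ∑ t, |Y (Fin.cons t s')| := by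
          gcongr with s' _
          exact h1 _ (hY.zero s')
      _ = _ := by
          rw [← Finset.mul_sum, ← sum_fin_cons (g := fun s => |Y s|)]
          ring

theorem multi_group (k : ℕ) (hk : 1 ≤ k) : ∃ C : ℝ, 1 ≤ C ∧
    ∀ (r N : ℕ) (Y : (Fin (r + 1) → Fin N → Bool) → ℝ), DegLe k Y → ∀ D, (∀ s, |Y s| ≤ D) →
      ∑ I : Fin (r + 1) → Fin N, |∑ s, Y s * ∏ j, chi (s j (I j))|
        ≤ C ^ (r + 1) * √N ^ r * ((2 ^ N) ^ (r + 1) * D) := by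
  obtain ⟨C, hC, hog⟩ := one_group k hk
  refine ⟨C, hC, ?_⟩
  intro r N Y hY D hD
  have hC0 : 0 ≤ C := by linarith
  rw [sum_fin_cons (g := fun I : Fin (r + 1) → Fin N => |∑ s, Y s * ∏ j, chi (s j (I j))|)]
  simp_rw [split_coef]
  rw [Finset.sum_comm]
  calc _ ≤ ∑ i0 : Fin N, (C * √N) ^ r * ∑ s' : Fin r → Fin N → Bool,
          |∑ t : Fin N → Bool, Y (Fin.cons t s') * chi (t i0)| :=
          Finset.sum_le_sum fun i0 _ => multi_l1 C hC0 (fun Y hY => (hog N Y hY).2) r _ (hY.succ i0)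
      _ = (C * √N) ^ r * ∑ s' : Fin r → Fin N → Bool, ∑ i0 : Fin N,
          |∑ t : Fin N → Bool, Y (Fin.cons t s') * chi (t i0)| := by
          rw [← Finset.mul_sum, Finset.sum_comm]
      _ ≤ (C * √N) ^ r * ∑ s' : Fin r → Fin N → Bool, C * (2 ^ N * D) := by
          gcongr with s' _
          exact (hog N _ (hY.zero s')).1 D (fun t => hD _)
      _ = _ := by
          simp
          ring

/-- Integer sign character. -/
def chiZ (b : Bool) : ℤ := if b then -1 else 1

lemma chiZ_cast (b : Bool) : ((chiZ b : ℤ) : ℝ) = chi b := by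
  cases b <;> simp [chiZ, chi]

/-- The permutation flips the pairs selected by `c` and fixes the other ones pointwise. -/
def IsFlip {n r : ℕ} (π : Equiv.Perm (Fin n)) (X Y : Fin r → Fin n) (c : Fin r → Bool) : Prop :=
  ∀ j, π (X j) = (if c j then Y j else X j) ∧ π (Y j) = (if c j then X j else Y j)

lemma prod_chiZ {r : ℕ} (c : Fin r → Bool) : (∏ j, chiZ (c j)) = 1 ∨ (∏ j, chiZ (c j)) = -1 := by
  have : IsUnit (∏ j, chiZ (c j)) := by
    refine IsUnit.prod_univ_iff.2 fun j => ?_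
    cases c j <;> simp [chiZ]
  exact Int.isUnit_iff.1 this

lemma UU_flip {n r : ℕ} (G : Finset (Finset (Fin n))) (X Y : Fin r → Fin n)
    (π a : Equiv.Perm (Fin n)) (c : Fin r → Bool) (h : IsFlip π X Y c) :
    UU G univ (⇑(a * π) ∘ X) (⇑(a * π) ∘ Y) = (∏ j, chiZ (c j)) * UU G univ (a ∘ X) (a ∘ Y) := by
  unfold UU
  rw [Finset.mul_sum]
  refine Finset.sum_congr rfl fun S _ => ?_
  rw [← Finset.prod_mul_distrib]
  refine Finset.prod_congr rfl fun j _ => ?_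
  simp only [Function.comp, Equiv.Perm.mul_apply, (h j).1, (h j).2]
  cases c j <;> simp [chiZ]

/-- Sign of the alternating sum. -/
def theta {n r : ℕ} (G : Finset (Finset (Fin n))) (X Y : Fin r → Fin n)
    (a : Equiv.Perm (Fin n)) : ℤ := (UU G univ (a ∘ X) (a ∘ Y)).sign

lemma theta_flip {n r : ℕ} (G : Finset (Finset (Fin n))) (X Y : Fin r → Fin n)
    (π a : Equiv.Perm (Fin n)) (c : Fin r → Bool) (h : IsFlip π X Y c) :
    theta G X Y (a * π) = (∏ j, chiZ (c j)) * theta G X Y a := by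
  unfold theta
  rw [UU_flip G X Y π a c h, Int.sign_mul]
  rcases prod_chiZ c with h | h <;> simp [h]

lemma theta_flip' {n r : ℕ} (G : Finset (Finset (Fin n))) (X Y : Fin r → Fin n)
    (π a : Equiv.Perm (Fin n)) (c : Fin r → Bool) (h : IsFlip π X Y c) :
    theta G X Y a = (∏ j, chiZ (c j)) * theta G X Y (a * π) := by
  rw [theta_flip G X Y π a c h]
  rcases prod_chiZ c with h | h <;> simp [h]

/-- Indicator that the relabelled set is an edge. -/
def ind {n : ℕ} (G : Finset (Finset (Fin n))) (a : Equiv.Perm (Fin n)) (S : Finset (Fin n)) : ℤ :=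
  if S.image a ∈ G then 1 else 0

lemma ind_image {n : ℕ} (G : Finset (Finset (Fin n))) (a π : Equiv.Perm (Fin n))
    (S : Finset (Fin n)) : ind G a (S.image π) = ind G (a * π) S := by
  unfold ind
  rw [Finset.image_image]
  rfl

/-- Correlation of an edge indicator with the sign. -/
def Psi {n r : ℕ} (G : Finset (Finset (Fin n))) (X Y : Fin r → Fin n) (S : Finset (Fin n)) : ℤ :=
  ∑ a : Equiv.Perm (Fin n), theta G X Y a * ind G a S

lemma Psi_flip {n r : ℕ} (G : Finset (Finset (Fin n))) (X Y : Fin r → Fin n)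
    (π : Equiv.Perm (Fin n)) (c : Fin r → Bool) (h : IsFlip π X Y c) (S : Finset (Fin n)) :
    Psi G X Y (S.image π) = (∏ j, chiZ (c j)) * Psi G X Y S := by
  unfold Psi
  rw [Finset.mul_sum]
  refine Fintype.sum_equiv (Equiv.mulRight π) _ _ ?_
  intro a
  rw [ind_image, theta_flip' G X Y π a c h]
  simp [mul_assoc]

/-- Transversal sign of a set. -/
def sgn {n r : ℕ} (X Y : Fin r → Fin n) (S : Finset (Fin n)) : ℤ :=
  ∏ j, ((if X j ∈ S then 1 else 0) - (if Y j ∈ S then 1 else 0))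

lemma UU_ind {n k r : ℕ} (G : Finset (Finset (Fin n))) (hG : ∀ e ∈ G, e.card = k)
    (X Y : Fin r → Fin n) (a : Equiv.Perm (Fin n)) :
    ∑ S ∈ powersetCard k univ, ind G a S * sgn X Y S = UU G univ (a ∘ X) (a ∘ Y) := by
  unfold UU ind
  simp only [ite_mul, one_mul, zero_mul]
  rw [← Finset.sum_filter]
  refine Finset.sum_nbij (fun S => S.image a) ?_ ?_ ?_ ?_
  · intro S hS
    exact (Finset.mem_filter.1 hS).2
  · intro S _ S' _ h
    exact Finset.image_injective a.injective h
  · intro T hT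
    have hT' : T ∈ G := by simpa using hT
    have h1 : (T.image a.symm).image a = T := by
      rw [Finset.image_image]; simp
    refine ⟨T.image a.symm, ?_, h1⟩
    simp only [Finset.coe_filter, Finset.mem_powersetCard, Finset.subset_univ, true_and,
      Set.mem_ofPred_eq, h1]
    refine ⟨?_, hT'⟩
    rw [Finset.card_image_of_injective _ a.symm.injective, hG T hT']
  · intro S _
    unfold sgn
    refine Finset.prod_congr rfl fun j _ => ?_
    simp

lemma perm_ext_set {n : ℕ} {ι : Type*} [Fintype ι] (p q : ι → Fin n) (hp : Function.Injective p)
    (hq : Function.Injective q) (S S' : Finset (Fin n)) (hS : S.card = S'.card)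
    (h : ∀ i, p i ∈ S ↔ q i ∈ S') :
    ∃ a : Equiv.Perm (Fin n), (∀ i, a (p i) = q i) ∧ S.image a = S' := by
  classical
  have hc : ∀ (p : ι → Fin n) (_ : Function.Injective p) (S : Finset (Fin n)),
      (S \ univ.image p).card = S.card - (univ.filter (fun i => p i ∈ S)).card := by
    intro p hp S
    rw [Finset.card_sdiff]
    congr 1
    rw [← Finset.card_image_of_injective _ hp]
    congr 1
    ext v
    simp only [Finset.mem_inter, Finset.mem_image, Finset.mem_univ, true_and, Finset.mem_filter]
    constructor
    · rintro ⟨⟨i, rfl⟩, hv⟩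
      exact ⟨i, hv, rfl⟩
    · rintro ⟨i, hi, rfl⟩
      exact ⟨⟨i, rfl⟩, hi⟩
  have hcard : (S \ univ.image p).card = (S' \ univ.image q).card := by
    rw [hc p hp, hc q hq, hS]
    congr 2
    ext i
    simp [h i]
  let e : (S \ univ.image p : Finset (Fin n)) ≃ (S' \ univ.image q : Finset (Fin n)) :=
    Finset.equivOfCardEq hcard
  have hpi : Function.Injective (Sum.elim p (fun z : (S \ univ.image p : Finset (Fin n)) => (z : Fin n))) := by
    refine Function.Injective.sumElim hp Subtype.val_injective ?_
    rintro i ⟨z, hz⟩ heq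
    rw [Finset.mem_sdiff] at hz
    exact hz.2 (Finset.mem_image.2 ⟨i, Finset.mem_univ _, heq⟩)
  have hqi : Function.Injective (Sum.elim q (fun z : (S \ univ.image p : Finset (Fin n)) => (e z : Fin n))) := by
    refine Function.Injective.sumElim hq (Subtype.val_injective.comp e.injective) ?_
    intro i z heq
    have hz := (e z).2
    rw [Finset.mem_sdiff] at hz
    exact hz.2 (Finset.mem_image.2 ⟨i, Finset.mem_univ _, heq⟩)
  obtain ⟨a, ha⟩ := perm_ext _ _ hpi hqi
  refine ⟨a, fun i => ha (Sum.inl i), ?_⟩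
  apply Finset.eq_of_subset_of_card_le
  · intro v hv
    obtain ⟨u, hu, rfl⟩ := Finset.mem_image.1 hv
    by_cases hup : u ∈ univ.image p
    · obtain ⟨i, _, rfl⟩ := Finset.mem_image.1 hup
      have := ha (Sum.inl i)
      simp only [Sum.elim_inl] at this
      rw [this]
      exact (h i).1 hu
    · have := ha (Sum.inr ⟨u, Finset.mem_sdiff.2 ⟨hu, hup⟩⟩)
      simp only [Sum.elim_inr] at this
      rw [this]
      exact (Finset.mem_sdiff.1 (e _).2).1
  · rw [Finset.card_image_of_injective _ a.injective, hS]

lemma pair_lem {n r : ℕ} (G : Finset (Finset (Fin n))) (X Y : Fin r → Fin n)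
    (hXY : Function.Injective (Sum.elim X Y)) (S S' : Finset (Fin n)) (hS : S.card = S'.card) :
    Psi G X Y S * (sgn X Y S' * sgn X Y S') = sgn X Y S * (sgn X Y S' * Psi G X Y S') := by
  have hX : Function.Injective X := fun a b h => by
    have := @hXY (Sum.inl a) (Sum.inl b) h
    simpa using this
  have hY : Function.Injective Y := fun a b h => by
    have := @hXY (Sum.inr a) (Sum.inr b) h
    simpa using this
  have hne : ∀ a b, X a ≠ Y b := fun a b h => by
    have := @hXY (Sum.inl a) (Sum.inr b) h
    simp at this
  by_cases h' : sgn X Y S' = 0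
  · simp [h']
  by_cases h0 : sgn X Y S = 0
  · have hPsi : Psi G X Y S = 0 := by
      unfold sgn at h0
      obtain ⟨j, _, hj⟩ := Finset.prod_eq_zero_iff.1 h0
      have hiff : X j ∈ S ↔ Y j ∈ S := by
        by_cases h1 : X j ∈ S <;> by_cases h2 : Y j ∈ S <;> simp [h1, h2] at hj ⊢
      have hflip : IsFlip (Equiv.swap (X j) (Y j)) X Y (fun l => decide (l = j)) := by
        intro l
        by_cases hl : l = j
        · subst hl; simp
        · simp only [hl, decide_false, Bool.false_eq_true, if_false]
          exact ⟨Equiv.swap_apply_of_ne_of_ne (fun h => hl (hX h)) (hne _ _),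
            Equiv.swap_apply_of_ne_of_ne (hne _ _).symm (fun h => hl (hY h))⟩
      have himg : S.image (Equiv.swap (X j) (Y j)) = S := by
        apply Finset.eq_of_subset_of_card_le
        · intro v hv
          obtain ⟨u, hu, rfl⟩ := Finset.mem_image.1 hv
          rw [Equiv.swap_apply_def]
          split_ifs with h1 h2
          · rw [h1] at hu; exact hiff.1 hu
          · rw [h2] at hu; exact hiff.2 hu
          · exact hu
        · rw [Finset.card_image_of_injective _ (Equiv.injective _)]
      have h3 := Psi_flip G X Y _ _ hflip S
      rw [himg] at h3
      have h4 : ∏ l, chiZ (decide (l = j)) = -1 := by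
        rw [Finset.prod_eq_single j]
        · simp [chiZ]
        · intro l _ hl
          simp [chiZ, hl]
        · simp
      rw [h4] at h3
      linarith
    rw [h0, hPsi]; ring
  · have htr : ∀ (S : Finset (Fin n)), sgn X Y S ≠ 0 → ∀ j, (Y j ∈ S ↔ X j ∉ S) := by
      intro S hS j
      have := Finset.prod_ne_zero_iff.1 hS j (Finset.mem_univ j)
      by_cases h1 : X j ∈ S <;> by_cases h2 : Y j ∈ S <;> simp [h1, h2] at this ⊢
    have ht := htr S h0
    have ht' := htr S' h'
    classical
    let c : Fin r → Bool := fun j => !decide (X j ∈ S ↔ X j ∈ S')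
    have hcs : ∀ j, c j = true ↔ ¬ (X j ∈ S ↔ X j ∈ S') := by intro j; simp [c]
    let q : Fin r ⊕ Fin r → Fin n :=
      Sum.elim (fun j => if c j then Y j else X j) (fun j => if c j then X j else Y j)
    have hq : Function.Injective q := by
      refine Function.Injective.sumElim ?_ ?_ ?_
      · intro a b hab
        simp only at hab
        split_ifs at hab
        · exact hY hab
        · exact absurd hab.symm (hne _ _)
        · exact absurd hab (hne _ _)
        · exact hX hab
      · intro a b hab
        simp only at hab
        split_ifs at hab
        · exact hX hab
        · exact absurd hab (hne _ _)
        · exact absurd hab.symm (hne _ _)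
        · exact hY hab
      · intro a b hab
        split_ifs at hab with h1 h2 h2
        · exact absurd hab.symm (hne _ _)
        · rw [hY hab] at h1; exact h2 h1
        · rw [hX hab] at h1; exact h1 h2
        · exact absurd hab (hne _ _)
    obtain ⟨π, hπ, hπS⟩ := perm_ext_set (Sum.elim X Y) q hXY hq S S' hS (by
      rintro (j | j)
      · simp only [q, Sum.elim_inl]
        have h1 := hcs j
        have h3 := ht' j
        split_ifs with h2 <;> tauto
      · simp only [q, Sum.elim_inr]
        have h1 := hcs j
        have h3 := ht' j
        have h4 := ht j
        split_ifs with h2 <;> tauto)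
    have hflip : IsFlip π X Y c := fun j => ⟨hπ (Sum.inl j), hπ (Sum.inr j)⟩
    have h1 := Psi_flip G X Y π c hflip S
    rw [hπS] at h1
    have h2 : sgn X Y S' = (∏ j, chiZ (c j)) * sgn X Y S := by
      unfold sgn
      rw [← Finset.prod_mul_distrib]
      refine Finset.prod_congr rfl fun j _ => ?_
      have h3 := ht' j
      have h4 := ht j
      by_cases h5 : X j ∈ S <;> by_cases h6 : X j ∈ S' <;> simp [h3, h4, h5, h6, c, chiZ]
    rw [h1, h2]
    rcases prod_chiZ c with h | h <;> rw [h] <;> ring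

/-- Number of common edges after relabelling. -/
def Lam {n : ℕ} (k : ℕ) (G H : Finset (Finset (Fin n))) (a b : Equiv.Perm (Fin n)) : ℤ :=
  ∑ S ∈ powersetCard k univ, ind G a S * ind H b S

/-- Number of transversal sets. -/
def TT {n r : ℕ} (k : ℕ) (X Y : Fin r → Fin n) : ℤ :=
  ∑ S ∈ powersetCard k univ, sgn X Y S * sgn X Y S

lemma theta_Lam {n k r : ℕ} (G H : Finset (Finset (Fin n))) (hG : ∀ e ∈ G, e.card = k)
    (hH : ∀ e ∈ H, e.card = k) (X Y : Fin r → Fin n)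
    (hXY : Function.Injective (Sum.elim X Y)) (b : Equiv.Perm (Fin n)) :
    (∑ a, theta G X Y a * Lam k G H a b) * TT k X Y
      = UA G X Y * UU H univ (b ∘ X) (b ∘ Y) := by
  have h1 : ∑ a, theta G X Y a * Lam k G H a b
      = ∑ S ∈ powersetCard k univ, Psi G X Y S * ind H b S := by
    unfold Lam Psi
    simp_rw [Finset.mul_sum, Finset.sum_mul]
    rw [Finset.sum_comm]
    refine Finset.sum_congr rfl fun S _ => Finset.sum_congr rfl fun a _ => ?_
    ring
  have h2 : ∑ S' ∈ powersetCard k univ, sgn X Y S' * Psi G X Y S' = UA G X Y := by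
    unfold Psi UA
    simp_rw [Finset.mul_sum]
    rw [Finset.sum_comm]
    refine Finset.sum_congr rfl fun a _ => ?_
    rw [← Int.sign_mul_self_eq_abs, ← UU_ind G hG X Y a, Finset.mul_sum]
    refine Finset.sum_congr rfl fun S _ => ?_
    unfold theta
    rw [UU_ind G hG X Y a]
    ring
  have h3 : ∀ S ∈ powersetCard k (univ : Finset (Fin n)),
      Psi G X Y S * TT k X Y = sgn X Y S * UA G X Y := by
    intro S hS
    rw [← h2]
    unfold TT
    rw [Finset.mul_sum, Finset.mul_sum]
    refine Finset.sum_congr rfl fun S' hS' => ?_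
    apply pair_lem G X Y hXY
    rw [(Finset.mem_powersetCard.1 hS).2, (Finset.mem_powersetCard.1 hS').2]
  rw [h1, ← UU_ind H hH X Y b, Finset.sum_mul, Finset.mul_sum]
  refine Finset.sum_congr rfl fun S hS => ?_
  calc _ = (Psi G X Y S * TT k X Y) * ind H b S := by ring
    _ = _ := by rw [h3 S hS]; ring

lemma TT_le {n k r : ℕ} (X Y : Fin r → Fin n) (hXY : Function.Injective (Sum.elim X Y)) :
    (TT k X Y : ℝ) ≤ 2 ^ r * (n : ℝ) ^ (k - r) := by
  classical
  have hX : Function.Injective X := fun a b h => by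
    have := @hXY (Sum.inl a) (Sum.inl b) h
    simpa using this
  have hY : Function.Injective Y := fun a b h => by
    have := @hXY (Sum.inr a) (Sum.inr b) h
    simpa using this
  have hne : ∀ a b, X a ≠ Y b := fun a b h => by
    have := @hXY (Sum.inl a) (Sum.inr b) h
    simp at this
  let ch : (Fin r → Bool) → Finset (Fin n) := fun c => univ.image (fun j => if c j then X j else Y j)
  have hch : ∀ c, (ch c).card = r := by
    intro c
    simp only [ch]
    rw [Finset.card_image_of_injective]
    · simp
    · intro a b hab
      simp only at hab
      split_ifs at hab
      · exact hX hab
      · exact absurd hab (hne _ _)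
      · exact absurd hab.symm (hne _ _)
      · exact hY hab
  have h1 : (powersetCard k (univ : Finset (Fin n))).filter (fun S => sgn X Y S ≠ 0) ⊆
      ((univ : Finset (Fin r → Bool)) ×ˢ powersetCard (k - r) (univ : Finset (Fin n))).image
        (fun z => z.2 ∪ ch z.1) := by
    intro S hS
    rw [Finset.mem_filter, Finset.mem_powersetCard] at hS
    obtain ⟨⟨_, hSk⟩, hs⟩ := hS
    have hsub : ch (fun j => decide (X j ∈ S)) ⊆ S := by
      intro v hv
      obtain ⟨j, _, rfl⟩ := Finset.mem_image.1 hv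
      have := Finset.prod_ne_zero_iff.1 hs j (Finset.mem_univ j)
      by_cases h1 : X j ∈ S <;> by_cases h2 : Y j ∈ S <;> simp [h1, h2] at this ⊢
    rw [Finset.mem_image]
    refine ⟨(fun j => decide (X j ∈ S), S \ ch (fun j => decide (X j ∈ S))), ?_, ?_⟩
    · rw [Finset.mem_product, Finset.mem_powersetCard]
      refine ⟨Finset.mem_univ _, Finset.subset_univ _, ?_⟩
      rw [Finset.card_sdiff_of_subset hsub, hch, hSk]
    · exact Finset.sdiff_union_of_subset hsub
  have h2 : TT k X Y ≤ (((powersetCard k (univ : Finset (Fin n))).filter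
      (fun S => sgn X Y S ≠ 0)).card : ℤ) := by
    unfold TT
    rw [Finset.card_filter]
    push_cast
    refine Finset.sum_le_sum fun S _ => ?_
    split_ifs with h
    · unfold sgn
      rw [← Finset.prod_mul_distrib]
      apply Finset.prod_le_one
      · intro j _; exact mul_self_nonneg _
      · intro j _; split_ifs <;> simp
    · push Not at h
      simp [h]
  have h3 := (Finset.card_le_card h1).trans Finset.card_image_le
  rw [Finset.card_product, Finset.card_powersetCard] at h3
  simp only [Finset.card_univ, Fintype.card_fun, Fintype.card_bool, Fintype.card_fin] at h3
  have h4 := h3.trans (Nat.mul_le_mul_left _ (Nat.choose_le_pow n (k - r)))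
  have h5 : TT k X Y ≤ ((2 ^ r * n ^ (k - r) : ℕ) : ℤ) := h2.trans (by exact_mod_cast h4)
  exact_mod_cast h5

/-- Flip pairs in the index set. -/
def sigmaP {r N : ℕ} (s : Fin r → Fin N → Bool) : Equiv.Perm (Fin r × Fin N × Bool) :=
  Function.Involutive.toPerm (fun z => (z.1, z.2.1, xor z.2.2 (s z.1 z.2.1))) (by
    intro z; simp)

/-- The permutation flipping the pairs selected by `s`. -/
noncomputable def tau {n r N : ℕ} (e : Fin r × Fin N × Bool ↪ Fin n) (s : Fin r → Fin N → Bool) :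
    Equiv.Perm (Fin n) := (sigmaP s).viaEmbedding e

lemma tau_apply {n r N : ℕ} (e : Fin r × Fin N × Bool ↪ Fin n) (s : Fin r → Fin N → Bool)
    (j : Fin r) (i : Fin N) (b : Bool) : tau e s (e (j, i, b)) = e (j, i, xor b (s j i)) := by
  unfold tau
  rw [Equiv.Perm.viaEmbedding_apply]
  rfl

lemma tau_flip {n r N : ℕ} (e : Fin r × Fin N × Bool ↪ Fin n) (s : Fin r → Fin N → Bool)
    (I : Fin r → Fin N) : IsFlip (tau e s) (fun j => e (j, I j, false)) (fun j => e (j, I j, true))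
      (fun j => s j (I j)) := by
  intro j
  rw [tau_apply, tau_apply]
  cases h : s j (I j) <;> simp [h]

lemma XY_inj {n r N : ℕ} (e : Fin r × Fin N × Bool ↪ Fin n) (I : Fin r → Fin N) :
    Function.Injective (Sum.elim (fun j => e (j, I j, false)) (fun j => e (j, I j, true))) := by
  refine Function.Injective.sumElim ?_ ?_ ?_
  · intro a b h
    have := e.injective h
    simp only [Prod.mk.injEq] at this
    exact this.1
  · intro a b h
    have := e.injective h
    simp only [Prod.mk.injEq] at this
    exact this.1
  · intro a b h
    have := e.injective h
    simp at this

lemma flip_zero {N : ℕ} (g : (Fin N → Bool) → ℝ) (R : Finset (Fin N)) (i : Fin N) (hi : i ∈ R)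
    (hg : ∀ t, g (Function.update t i (!t i)) = g t) :
    ∑ t : Fin N → Bool, g t * ∏ l ∈ R, chi (t l) = 0 := by
  have hinv : Function.Involutive (fun t : Fin N → Bool => Function.update t i (!t i)) := by
    intro t; simp
  have h1 : ∑ t : Fin N → Bool, g t * ∏ l ∈ R, chi (t l)
      = ∑ t : Fin N → Bool, -(g t * ∏ l ∈ R, chi (t l)) := by
    refine Fintype.sum_equiv (Function.Involutive.toPerm _ hinv) _ _ ?_
    intro t
    show g t * _ = -(g (Function.update t i (!t i)) * ∏ l ∈ R, chi (Function.update t i (!t i) l))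
    rw [hg, ← Finset.mul_prod_erase R _ hi, ← Finset.mul_prod_erase R _ hi]
    have h3 : ∏ l ∈ R.erase i, chi (Function.update t i (!t i) l) = ∏ l ∈ R.erase i, chi (t l) := by
      refine Finset.prod_congr rfl fun l hl => ?_
      rw [Function.update_of_ne (Finset.ne_of_mem_erase hl)]
    rw [h3, Function.update_self]
    cases t i <;> simp [chi]
  rw [Finset.sum_neg_distrib] at h1
  linarith

lemma tau_image {n r N : ℕ} (e : Fin r × Fin N × Bool ↪ Fin n) (s : Fin r → Fin N → Bool)
    (j : Fin r) (i : Fin N) (t : Fin N → Bool) (S : Finset (Fin n)) (hS : ∀ b, e (j, i, b) ∉ S) :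
    S.image (tau e (Function.update s j (Function.update t i (!t i))))
      = S.image (tau e (Function.update s j t)) := by
  apply Finset.image_congr
  intro v hv
  have hv' : v ∈ S := by simpa using hv
  by_cases hr : v ∈ Set.range e
  · obtain ⟨⟨j', i', b⟩, rfl⟩ := hr
    rw [tau_apply, tau_apply]
    by_cases hj : j' = j
    · subst hj
      by_cases hi : i' = i
      · subst hi
        exact absurd hv' (hS b)
      · simp [hi]
    · simp [hj]
  · unfold tau
    rw [Equiv.Perm.viaEmbedding_apply_of_notMem _ _ _ hr,
      Equiv.Perm.viaEmbedding_apply_of_notMem _ _ _ hr]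

lemma Y_deg {n k r N : ℕ} (G H : Finset (Finset (Fin n))) (e : Fin r × Fin N × Bool ↪ Fin n)
    (a b : Equiv.Perm (Fin n)) (C0 : ℝ) :
    DegLe k (fun s => (Lam k G H (a * tau e s) b : ℝ) - C0) := by
  intro j s R hR
  simp_rw [sub_mul]
  rw [Finset.sum_sub_distrib]
  have h1 : ∑ t : Fin N → Bool, C0 * ∏ i ∈ R, chi (t i) = 0 := by
    obtain ⟨i, hi⟩ := Finset.card_pos.1 (by omega : 0 < R.card)
    exact flip_zero (fun _ => C0) R i hi (fun _ => rfl)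
  rw [h1, sub_zero]
  unfold Lam
  push_cast
  simp_rw [Finset.sum_mul]
  rw [Finset.sum_comm]
  refine Finset.sum_eq_zero fun S hS => ?_
  have hSk := (Finset.mem_powersetCard.1 hS).2
  obtain ⟨i, hi, hiS⟩ : ∃ i ∈ R, ∀ b, e (j, i, b) ∉ S := by
    by_contra hcon
    push Not at hcon
    have hcon' : ∀ i : Fin N, ∃ b, i ∈ R → e (j, i, b) ∈ S := by
      intro i
      by_cases hi : i ∈ R
      · obtain ⟨b, hb⟩ := hcon i hi
        exact ⟨b, fun _ => hb⟩
      · exact ⟨true, fun h => absurd h hi⟩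
    choose f hf using hcon'
    have := Finset.card_le_card_of_injOn (fun i => e (j, i, f i)) (s := R) (t := S)
      (fun i hi => hf i hi) (by
        intro x _ y _ hxy
        have := e.injective hxy
        simp only [Prod.mk.injEq] at this
        exact this.2.1)
    omega
  refine flip_zero (fun t => (ind G (a * tau e (Function.update s j t)) S : ℝ) * (ind H b S : ℝ))
    R i hi ?_
  intro t
  rw [← ind_image, ← ind_image, tau_image e s j i t S hiS]

lemma theta_abs {n r : ℕ} (G : Finset (Finset (Fin n))) (X Y : Fin r → Fin n)
    (a : Equiv.Perm (Fin n)) : |(theta G X Y a : ℝ)| ≤ 1 := by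
  unfold theta
  rcases lt_trichotomy (UU G univ (a ∘ X) (a ∘ Y)) 0 with h | h | h
  · rw [Int.sign_eq_neg_one_of_neg h]; simp
  · rw [h]; simp
  · rw [Int.sign_eq_one_of_pos h]; simp

lemma lower {n k r N : ℕ} (G H : Finset (Finset (Fin n))) (hG : ∀ e ∈ G, e.card = k)
    (hH : ∀ e ∈ H, e.card = k) (e : Fin (r + 1) × Fin N × Bool ↪ Fin n) (C0 : ℝ)
    (I : Fin (r + 1) → Fin N) :
    (2 ^ N) ^ (r + 1) * ((UA G (fun j => e (j, I j, false)) (fun j => e (j, I j, true)) : ℝ)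
      * UA H (fun j => e (j, I j, false)) (fun j => e (j, I j, true)))
    ≤ TT k (fun j => e (j, I j, false)) (fun j => e (j, I j, true)) *
      ∑ a : Equiv.Perm (Fin n), ∑ b : Equiv.Perm (Fin n),
        |∑ s : Fin (r + 1) → Fin N → Bool, ((Lam k G H (a * tau e s) b : ℝ) - C0)
          * ∏ j, chi (s j (I j))| := by
  set X : Fin (r + 1) → Fin n := fun j => e (j, I j, false) with hX
  set Y : Fin (r + 1) → Fin n := fun j => e (j, I j, true) with hY
  have hXY : Function.Injective (Sum.elim X Y) := XY_inj e I
  have hTT : (0 : ℝ) ≤ TT k X Y := by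
    have : 0 ≤ TT k X Y := Finset.sum_nonneg fun S _ => mul_self_nonneg _
    exact_mod_cast this
  have hUG : (0 : ℝ) ≤ UA G X Y := by
    have : 0 ≤ UA G X Y := Finset.sum_nonneg fun S _ => abs_nonneg _
    exact_mod_cast this
  -- the sign has mean zero
  have hθ0 : ∑ a, (theta G X Y a : ℝ) = 0 := by
    have hf := tau_flip e (fun j _ => decide (j = 0)) I
    have h4 : ∏ l : Fin (r + 1), chiZ (decide (l = 0)) = -1 := by
      rw [Finset.prod_eq_single 0]
      · simp [chiZ]
      · intro l _ hl
        simp [chiZ, hl]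
      · simp
    have h1 : ∑ a, (theta G X Y a : ℝ) = ∑ a, -(theta G X Y a : ℝ) := by
      refine Fintype.sum_equiv (Equiv.mulRight (tau e (fun j _ => decide (j = 0)))) _ _ ?_
      intro a
      rw [theta_flip' G X Y _ a _ hf, h4]
      push_cast
      simp
    rw [Finset.sum_neg_distrib] at h1
    linarith
  have hmain : ∀ b : Equiv.Perm (Fin n), ∑ a, (theta G X Y a : ℝ) *
      (∑ s : Fin (r + 1) → Fin N → Bool, ((Lam k G H (a * tau e s) b : ℝ) - C0)
          * ∏ j, chi (s j (I j)))
      = (2 ^ N) ^ (r + 1) * ((∑ a, theta G X Y a * Lam k G H a b : ℤ) : ℝ) := by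
    intro b
    simp_rw [Finset.mul_sum]
    rw [Finset.sum_comm]
    have h1 : ∀ s : Fin (r + 1) → Fin N → Bool, ∑ a, (theta G X Y a : ℝ) *
        (((Lam k G H (a * tau e s) b : ℝ) - C0) * ∏ j, chi (s j (I j)))
        = ((∑ a, theta G X Y a * Lam k G H a b : ℤ) : ℝ) := by
      intro s
      have h2 : ∑ a, (theta G X Y a : ℝ) *
          (((Lam k G H (a * tau e s) b : ℝ) - C0) * ∏ j, chi (s j (I j)))
          = ∑ a, (theta G X Y a : ℝ) * ((Lam k G H a b : ℝ) - C0) := by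
        refine Fintype.sum_equiv (Equiv.mulRight (tau e s)) _ _ ?_
        intro a
        rw [theta_flip' G X Y _ a _ (tau_flip e s I)]
        push_cast
        simp_rw [chiZ_cast]
        have h3 : (∏ j, chi (s j (I j))) * (∏ j, chi (s j (I j))) = 1 := by
          rw [← Finset.prod_mul_distrib]
          exact Finset.prod_eq_one fun j _ => chi_sq _
        simp only [Equiv.coe_mulRight]
        linear_combination ((theta G X Y (a * tau e s) : ℝ) *
          ((Lam k G H (a * tau e s) b : ℝ) - C0)) * h3
      rw [h2]
      simp_rw [mul_sub]
      rw [Finset.sum_sub_distrib, ← Finset.sum_mul, hθ0]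
      push_cast
      ring
    rw [Finset.sum_congr rfl (fun s _ => h1 s)]
    simp
  have hb : ∀ b : Equiv.Perm (Fin n), (2 ^ N) ^ (r + 1) * ((UA G X Y : ℝ) *
      |(UU H univ (b ∘ X) (b ∘ Y) : ℝ)|) ≤ TT k X Y * ∑ a : Equiv.Perm (Fin n),
        |∑ s : Fin (r + 1) → Fin N → Bool, ((Lam k G H (a * tau e s) b : ℝ) - C0)
          * ∏ j, chi (s j (I j))| := by
    intro b
    have h1 : |∑ a, (theta G X Y a : ℝ) *
      (∑ s : Fin (r + 1) → Fin N → Bool, ((Lam k G H (a * tau e s) b : ℝ) - C0)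
          * ∏ j, chi (s j (I j)))| ≤ ∑ a : Equiv.Perm (Fin n),
        |∑ s : Fin (r + 1) → Fin N → Bool, ((Lam k G H (a * tau e s) b : ℝ) - C0)
          * ∏ j, chi (s j (I j))| := by
      refine (Finset.abs_sum_le_sum_abs _ _).trans (Finset.sum_le_sum fun a _ => ?_)
      rw [abs_mul]
      exact mul_le_of_le_one_left (abs_nonneg _) (theta_abs G X Y a)
    refine le_trans (le_of_eq ?_) (mul_le_mul_of_nonneg_left h1 hTT)
    rw [hmain b]
    have h2 := theta_Lam G H hG hH X Y hXY b
    have h3 : ((∑ a, theta G X Y a * Lam k G H a b : ℤ) : ℝ) * (TT k X Y : ℝ)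
        = (UA G X Y : ℝ) * (UU H univ (b ∘ X) (b ∘ Y) : ℝ) := by exact_mod_cast h2
    rw [abs_mul, abs_of_nonneg (by positivity : (0 : ℝ) ≤ (2 ^ N) ^ (r + 1))]
    have h4 : (TT k X Y : ℝ) * |((∑ a, theta G X Y a * Lam k G H a b : ℤ) : ℝ)|
        = (UA G X Y : ℝ) * |(UU H univ (b ∘ X) (b ∘ Y) : ℝ)| := by
      rw [← abs_of_nonneg hUG, ← abs_mul, ← h3, abs_mul, abs_of_nonneg hTT]
      ring
    rw [← h4]
    ring
  have h5 := Finset.sum_le_sum fun b (_ : b ∈ (univ : Finset (Equiv.Perm (Fin n)))) => hb b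
  rw [← Finset.mul_sum, ← Finset.mul_sum, ← Finset.mul_sum, Finset.sum_comm] at h5
  refine le_trans (le_of_eq ?_) h5
  congr 2
  unfold UA
  push_cast
  rfl

lemma Lam_disc {n k : ℕ} (G H : Finset (Finset (Fin n))) (hG : ∀ e ∈ G, e.card = k)
    (a b : Equiv.Perm (Fin n)) :
    |(Lam k G H a b : ℝ) - ((G.card : ℝ) * H.card) / (n.choose k)| ≤ disc n k G H := by
  have hmem : ∀ (F : Finset (Finset (Fin n))) (a : Equiv.Perm (Fin n)) (S : Finset (Fin n)),
      S ∈ permEdges a⁻¹ F ↔ S.image a ∈ F := by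
    intro F a S
    unfold permEdges
    rw [Finset.mem_image]
    constructor
    · rintro ⟨T, hT, rfl⟩
      rw [Finset.image_image]
      have : (⇑a ∘ ⇑a⁻¹) = id := by funext v; simp
      rw [this, Finset.image_id]
      exact hT
    · intro h
      refine ⟨_, h, ?_⟩
      rw [Finset.image_image]
      have : (⇑a⁻¹ ∘ ⇑a) = id := by funext v; simp
      rw [this, Finset.image_id]
  have h1 : Lam k G H a b = ((permEdges a⁻¹ G ∩ permEdges b⁻¹ H).card : ℤ) := by
    unfold Lam ind
    have h2 : ∀ S : Finset (Fin n), (if S.image a ∈ G then (1 : ℤ) else 0) *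
        (if S.image b ∈ H then 1 else 0) =
        if S ∈ permEdges a⁻¹ G ∩ permEdges b⁻¹ H then 1 else 0 := by
      intro S
      have h5 : S ∈ permEdges a⁻¹ G ∩ permEdges b⁻¹ H ↔ S.image a ∈ G ∧ S.image b ∈ H := by
        rw [Finset.mem_inter, hmem, hmem]
      by_cases h3 : S.image a ∈ G <;> by_cases h4 : S.image b ∈ H <;> simp only [h5, h3, h4] <;> simp
    simp_rw [h2]
    rw [← Finset.sum_filter, Finset.sum_const, nsmul_eq_mul, mul_one]
    congr 2
    ext S
    rw [Finset.mem_filter, Finset.mem_powersetCard]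
    constructor
    · exact fun h => h.2
    · intro h
      refine ⟨⟨Finset.subset_univ _, ?_⟩, h⟩
      have h5 := hG _ ((hmem G a S).1 (Finset.mem_inter.1 h).1)
      rwa [Finset.card_image_of_injective _ a.injective] at h5
  rw [h1]
  unfold disc
  exact le_ciSup (f := fun p : Equiv.Perm (Fin n) × Equiv.Perm (Fin n) =>
    |((permEdges p.1 G ∩ permEdges p.2 H).card : ℝ) -
      ((G.card : ℝ) * H.card) / (n.choose k)|) (Set.finite_range _).bddAbove (a⁻¹, b⁻¹)

theorem part2 (k : ℕ) (hk : 1 ≤ k) (ε : ℝ) (hε : 0 < ε) : ∃ c : ℝ, 0 < c ∧ ∃ n₀ : ℕ,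
    ∀ n : ℕ, n₀ ≤ n → ∀ G H : Finset (Finset (Fin n)), (∀ e ∈ G, e.card = k) →
    (∀ e ∈ H, e.card = k) → ∀ r, 1 ≤ r → r ≤ k →
    (∀ X Y : Fin r → Fin n, Function.Injective (Sum.elim X Y) →
      ε * (n : ℝ) ^ (k - r) * n.factorial ≤ (UA G X Y : ℝ)) →
    (∀ X Y : Fin r → Fin n, Function.Injective (Sum.elim X Y) →
      ε * (n : ℝ) ^ (k - r) * n.factorial ≤ (UA H X Y : ℝ)) →
    c * (n : ℝ) ^ (((k : ℝ) + 1) / 2) ≤ disc n k G H := by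
  obtain ⟨C, hC, hmg⟩ := multi_group k hk
  have hk0 : (0 : ℝ) < k := by exact_mod_cast hk
  have hk1 : (1 : ℝ) ≤ k := by exact_mod_cast hk
  have hC0 : 0 < C := by linarith
  refine ⟨ε ^ 2 / ((4 * k) ^ (k + 1) * (2 * C) ^ k), by positivity, 2 * k, ?_⟩
  intro n hn G H hG hH r hr hrk hUG hUH
  obtain ⟨r, rfl⟩ : ∃ r', r = r' + 1 := ⟨r - 1, by omega⟩
  have hnpos : 0 < n := by omega
  have hn0 : (0 : ℝ) < n := by exact_mod_cast hnpos
  have hn1 : (1 : ℝ) ≤ n := by exact_mod_cast hnpos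
  set N := n / (2 * (r + 1)) with hN
  have hNpos : 0 < N := Nat.div_pos (by omega) (by omega)
  have hNle : N * (2 * (r + 1)) ≤ n := Nat.div_mul_le_self _ _
  have hNgt : n < 2 * (r + 1) * (N + 1) := Nat.lt_mul_div_succ n (by omega)
  have hn4 : n ≤ 4 * k * N := by
    calc n ≤ 2 * (r + 1) * (N + 1) := hNgt.le
      _ ≤ 2 * k * (2 * N) := Nat.mul_le_mul (by omega) (by omega)
      _ = 4 * k * N := by ring
  obtain ⟨e⟩ : Nonempty (Fin (r + 1) × Fin N × Bool ↪ Fin n) := by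
    apply Function.Embedding.nonempty_of_card_le
    simp only [Fintype.card_prod, Fintype.card_fin, Fintype.card_bool]
    calc (r + 1) * (N * 2) = N * (2 * (r + 1)) := by ring
      _ ≤ n := hNle
  set D := disc n k G H with hD
  set C0 : ℝ := ((G.card : ℝ) * H.card) / (n.choose k) with hC0'
  have hN0 : (0 : ℝ) < N := by exact_mod_cast hNpos
  let cc : (Fin (r + 1) → Fin N) → Equiv.Perm (Fin n) → Equiv.Perm (Fin n) → ℝ := fun I a b =>
    |∑ s : Fin (r + 1) → Fin N → Bool, ((Lam k G H (a * tau e s) b : ℝ) - C0)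
          * ∏ j, chi (s j (I j))|
  have hupper : ∀ a b, ∑ I, cc I a b ≤ C ^ (r + 1) * √N ^ r * ((2 ^ N) ^ (r + 1) * D) := by
    intro a b
    exact hmg r N _ (Y_deg G H e a b C0) D (fun s => Lam_disc G H hG _ _)
  have hfpos : (0 : ℝ) < n.factorial := by exact_mod_cast Nat.factorial_pos n
  have hlower : ∀ I, (2 ^ N) ^ (r + 1) * (ε * (n : ℝ) ^ (k - (r + 1)) * n.factorial) ^ 2
      ≤ 2 ^ (r + 1) * (n : ℝ) ^ (k - (r + 1)) * ∑ a, ∑ b, cc I a b := by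
    intro I
    have h1 := lower G H hG hH e C0 I
    have h2 := TT_le (k := k) _ _ (XY_inj e I)
    have h3 := hUG _ _ (XY_inj e I)
    have h4 := hUH _ _ (XY_inj e I)
    have hcc0 : 0 ≤ ∑ a, ∑ b, cc I a b :=
      Finset.sum_nonneg fun a _ => Finset.sum_nonneg fun b _ => abs_nonneg _
    have h5 : 0 ≤ ε * (n : ℝ) ^ (k - (r + 1)) * n.factorial := by positivity
    calc _ ≤ _ := by
          rw [sq]
          exact mul_le_mul_of_nonneg_left (mul_le_mul h3 h4 h5 (h5.trans h3)) (by positivity)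
      _ ≤ _ := h1
      _ ≤ _ := mul_le_mul_of_nonneg_right h2 hcc0
  have htot : (N : ℝ) ^ (r + 1) * ((2 ^ N) ^ (r + 1) *
      (ε * (n : ℝ) ^ (k - (r + 1)) * n.factorial) ^ 2)
      ≤ 2 ^ (r + 1) * (n : ℝ) ^ (k - (r + 1)) * ((n.factorial : ℝ) * (n.factorial *
        (C ^ (r + 1) * √N ^ r * ((2 ^ N) ^ (r + 1) * D)))) := by
    have h1 := Finset.sum_le_sum fun I (_ : I ∈ (univ : Finset (Fin (r + 1) → Fin N))) => hlower I
    simp only [Finset.sum_const, Finset.card_univ, Fintype.card_fun, Fintype.card_fin, nsmul_eq_mul,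
      Nat.cast_pow] at h1
    rw [← Finset.mul_sum] at h1
    have hp : (0 : ℝ) ≤ 2 ^ (r + 1) * (n : ℝ) ^ (k - (r + 1)) := by positivity
    refine h1.trans (mul_le_mul_of_nonneg_left ?_ hp)
    rw [Finset.sum_comm]
    have h2 : ∀ a : Equiv.Perm (Fin n), ∑ I, ∑ b, cc I a b ≤ n.factorial *
        (C ^ (r + 1) * √N ^ r * ((2 ^ N) ^ (r + 1) * D)) := by
      intro a
      rw [Finset.sum_comm]
      refine (Finset.sum_le_sum fun b _ => hupper a b).trans (le_of_eq ?_)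
      simp [Fintype.card_perm]
    refine (Finset.sum_le_sum fun a _ => h2 a).trans (le_of_eq ?_)
    simp [Fintype.card_perm]
  set x : ℝ := √N with hx
  have hx0 : 0 < x := Real.sqrt_pos.2 hN0
  have hxN : (N : ℝ) = x ^ 2 := (Real.sq_sqrt hN0.le).symm
  set P : ℝ := (n : ℝ) ^ (k - (r + 1)) with hP
  have hP0 : 0 < P := by positivity
  have hcancel : x ^ (r + 2) * ε ^ 2 * P ≤ (2 * C) ^ (r + 1) * D := by
    set K : ℝ := x ^ r * (2 ^ N) ^ (r + 1) * P * (n.factorial : ℝ) ^ 2 with hK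
    have hK0 : 0 < K := by positivity
    refine le_of_mul_le_mul_left ?_ hK0
    rw [hxN] at htot
    refine le_trans (le_of_eq ?_) (htot.trans (le_of_eq ?_))
    · rw [hK]; ring
    · rw [hK, mul_pow]; ring
  set y : ℝ := √n with hy
  have hy1 : 1 ≤ y := Real.one_le_sqrt.2 hn1
  have hyn : (n : ℝ) = y ^ 2 := (Real.sq_sqrt hn0.le).symm
  have hyx : y ≤ 4 * k * x := by
    apply Real.sqrt_le_iff.2
    refine ⟨by positivity, ?_⟩
    rw [mul_pow, ← hxN]
    have h1 : (n : ℝ) ≤ 4 * k * N := by exact_mod_cast hn4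
    refine h1.trans ?_
    gcongr
    exact le_self_pow₀ (by linarith) (by norm_num)
  have hD0 : 0 ≤ D := (abs_nonneg _).trans (Lam_disc G H hG 1 1)
  have hpow : (n : ℝ) ^ (((k : ℝ) + 1) / 2) = y ^ (k + 1) := by
    rw [hy, Real.sqrt_eq_rpow, ← Real.rpow_natCast, ← Real.rpow_mul hn0.le]
    congr 1
    push_cast
    ring
  rw [hpow, div_mul_eq_mul_div, div_le_iff₀ (by positivity)]
  have e1 : y ^ (k + 1) ≤ y ^ (r + 2) * P := by
    have h1 : y ^ (k - (r + 1)) ≤ P := by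
      rw [hP, hyn, ← pow_mul]
      exact pow_le_pow_right₀ hy1 (by omega)
    calc y ^ (k + 1) = y ^ (r + 2) * y ^ (k - (r + 1)) := by
          rw [← pow_add]; congr 1; omega
      _ ≤ _ := by gcongr
  have e2 : y ^ (r + 2) ≤ (4 * k) ^ (k + 1) * x ^ (r + 2) := by
    calc y ^ (r + 2) ≤ (4 * k * x) ^ (r + 2) := by gcongr
      _ = (4 * k) ^ (r + 2) * x ^ (r + 2) := by rw [mul_pow]
      _ ≤ _ := by
        gcongr ?_ * _
        exact pow_le_pow_right₀ (by linarith) (by omega)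
  have e3 : (2 * C) ^ (r + 1) ≤ (2 * C) ^ k := pow_le_pow_right₀ (by linarith) hrk
  calc ε ^ 2 * y ^ (k + 1) ≤ ε ^ 2 * (((4 * k) ^ (k + 1) * x ^ (r + 2)) * P) := by
        refine mul_le_mul_of_nonneg_left (e1.trans ?_) (by positivity)
        gcongr
    _ = (4 * k) ^ (k + 1) * (x ^ (r + 2) * ε ^ 2 * P) := by ring
    _ ≤ (4 * k) ^ (k + 1) * ((2 * C) ^ (r + 1) * D) := by gcongr
    _ ≤ (4 * k) ^ (k + 1) * ((2 * C) ^ k * D) := by gcongr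
    _ = _ := by ring


theorem stmt0 :
    ∀ k : ℕ, 2 ≤ k → ∀ δ : ℝ, 0 < δ →
      ∃ c : ℝ, 0 < c ∧ ∃ n₀ : ℕ, ∀ n : ℕ, n₀ ≤ n →
        ∀ G : Fin (gDef k + 2) → Finset (Finset (Fin n)),
          (∀ i, ∀ e ∈ G i, e.card = k) →
          (∀ i, δ * (n : ℝ) ^ k ≤ ((G i).card : ℝ) ∧
            ((G i).card : ℝ) ≤ (n.choose k : ℝ) - δ * (n : ℝ) ^ k) →
          ∃ i j : Fin (gDef k + 2), i < j ∧
            c * (n : ℝ) ^ (((k : ℝ) + 1) / 2) ≤ disc n k (G i) (G j) := by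
  intro k hk δ hδ
  obtain ⟨ε, hε, n₁, h1⟩ := part1 k hk δ hδ
  obtain ⟨c, hc, n₂, h2⟩ := part2 k (by omega) ε hε
  refine ⟨c, hc, max n₁ n₂, ?_⟩
  intro n hn G hG hcard
  have hg := gDef_le k hk
  choose r hr1 hr2 hr3 using fun i =>
    h1 n (le_trans (le_max_left _ _) hn) (G i) (hG i) (hcard i).1 (hcard i).2
  obtain ⟨i, _, j, _, hij, hrij⟩ := Finset.exists_ne_map_eq_of_card_lt_of_maps_to
    (s := (Finset.univ : Finset (Fin (gDef k + 2)))) (t := Finset.Icc (k - gDef k) k) (f := r)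
    (by rw [Nat.card_Icc, Finset.card_univ, Fintype.card_fin]; omega)
    (fun i _ => Finset.mem_coe.2 (Finset.mem_Icc.2 ⟨hr1 i, hr2 i⟩))
  have key : ∀ i j, r i = r j →
      c * (n : ℝ) ^ (((k : ℝ) + 1) / 2) ≤ disc n k (G i) (G j) := by
    intro i j h
    have hi := hr1 i
    have hj := hr3 j
    rw [← h] at hj
    exact h2 n (le_trans (le_max_right _ _) hn) (G i) (G j) (hG i) (hG j) (r i)
      (by omega) (hr2 i) (hr3 i) hj
  rcases lt_or_gt_of_ne hij with h | h
  · exact ⟨i, j, h, key i j hrij⟩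
  · exact ⟨j, i, h, key j i hrij.symm⟩
end

section
/- Let k, t ≥ 2 be integers and let F be a (k,t,k)-pattern satisfying W^k(F) = W^{k−1}(F) = ⋯ = W^{k−g(k)}(F) = 0. Then F is homogeneous. -/
open Finset

/-- Inner signed average over k-subsets R crossing each pair {a i, b i}:
E_R [ (-1)^{|R ∩ {b_1,...,b_r}|} f(R) ]. -/
noncomputable def signedAvg {V : Type*} [Fintype V] [DecidableEq V] (k : ℕ) {r : ℕ}
    (f : Finset V → ℝ) (a b : Fin r → V) : ℝ :=
  (∑ R ∈ (Finset.univ.powersetCard k).filter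
      (fun R => ∀ i, (R ∩ {a i, b i}).card = 1),
      (-1 : ℝ) ^ (R ∩ Finset.image b Finset.univ).card * f R) /
  (((Finset.univ.powersetCard k).filter
      (fun R => ∀ i, (R ∩ {a i, b i}).card = 1)).card)

/-- The level-r weight W^r(f) of a function on k-subsets: the square root of the
average, over all sequences (a_1,b_1,...,a_r,b_r) of 2r distinct vertices, of the
square of the inner signed average. -/
noncomputable def Wpow {V : Type*} [Fintype V] [DecidableEq V] (k r : ℕ)
    (f : Finset V → ℝ) : ℝ :=
  Real.sqrt
    ((∑ p ∈ (Finset.univ : Finset ((Fin r → V) × (Fin r → V))).filter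
        (fun p => Function.Injective (Sum.elim p.1 p.2)),
        (signedAvg k f p.1 p.2) ^ 2) /
      (((Finset.univ : Finset ((Fin r → V) × (Fin r → V))).filter
        (fun p => Function.Injective (Sum.elim p.1 p.2))).card))

/-- Indicator function of a hypergraph, viewed as a real-valued function on finsets. -/
def hyperInd {V : Type*} [DecidableEq V] (G : Finset (Finset V)) : Finset V → ℝ :=
  fun S => if S ∈ G then 1 else 0

lemma alt_sum_const (r : ℕ) (hr : 1 ≤ r) (c : ℤ) :
    ∑ i ∈ Finset.range (r + 1), (-1 : ℤ) ^ i * (r.choose i) * c = 0 := by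
  rw [← Finset.sum_mul, Int.alternating_sum_range_choose_of_ne (by omega), zero_mul]

lemma alpha_all (m : ℕ) (α : ℕ → Bool)
    (H : ∀ r, 1 ≤ r → r ≤ m → ∑ i ∈ Finset.range (r + 1),
            (-1 : ℤ) ^ i * (r.choose i) * (if α i then 1 else 0) = 0) :
    ∀ i ≤ m, α i = α 0 := by
  intro i
  induction i using Nat.strong_induction_on with
  | _ r ih =>
    intro hr
    rcases Nat.eq_zero_or_pos r with rfl | hpos
    · rfl
    have h1 := H r hpos hr
    have h2 := alt_sum_const r hpos (if α 0 then 1 else 0)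
    rw [Finset.sum_range_succ] at h1 h2
    have h3 : ∑ i ∈ Finset.range r, (-1 : ℤ) ^ i * (r.choose i) * (if α i then 1 else 0)
        = ∑ i ∈ Finset.range r, (-1 : ℤ) ^ i * (r.choose i) * (if α 0 then 1 else 0) := by
      apply Finset.sum_congr rfl
      intro i hi
      rw [Finset.mem_range] at hi
      rw [ih i hi (by omega)]
    have h4 : (-1 : ℤ) ^ r * (if α r then 1 else 0) = (-1 : ℤ) ^ r * (if α 0 then 1 else 0) := by
      simp only [Nat.choose_self, Nat.cast_one, mul_one] at h1 h2
      linarith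
    have h5 : (if α r then (1 : ℤ) else 0) = (if α 0 then 1 else 0) :=
      mul_left_cancel₀ (pow_ne_zero _ (by norm_num)) h4
    cases h : α r <;> cases h' : α 0 <;> simp_all

lemma alpha_const (k m : ℕ) (hm : m ≤ k) (α : ℕ → Bool)
    (H : ∀ r, 1 ≤ r → m - gDef k ≤ r → r ≤ m → ∑ i ∈ Finset.range (r + 1),
            (-1 : ℤ) ^ i * (r.choose i) * (if α i then 1 else 0) = 0) :
    ∀ i ≤ m, α i = α 0 := by
  by_cases hg : m - gDef k ≤ 1
  · exact alpha_all m α (fun r h1 h2 => H r h1 (by omega) h2)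
  · have hne : {g : ℕ |
      ∀ m : ℕ, 2 ≤ m → m ≤ k →
      ∀ α : ℕ → Bool,
        (∀ r ∈ Finset.Icc (m - g) m,
          ∑ i ∈ Finset.range (r + 1),
            (-1 : ℤ) ^ i * (r.choose i) * (if α i then 1 else 0) = 0) →
        ∀ i ≤ m, α i = α 0}.Nonempty := by
      refine ⟨k, ?_⟩
      intro m _ hm α h
      exact alpha_all m α (fun r h1 h2 => h r (by rw [Finset.mem_Icc]; omega))
    have hmem := Nat.sInf_mem hne
    refine hmem m (by omega) hm α ?_
    intro r hr
    rw [Finset.mem_Icc] at hr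
    have h0 : m - gDef k ≤ r := hr.1
    exact H r (by omega) h0 hr.2

section local_part

set_option linter.unusedSectionVars false

variable {V : Type*} [Fintype V] [DecidableEq V]

/-- The selection determined by `s`. -/
def selFn {r : ℕ} (a b : Fin r → V) (s : Fin r → Bool) (i : Fin r) : V :=
  if s i then b i else a i

/-- The set made of `Z` together with the selection. -/
def selSet {r : ℕ} (a b : Fin r → V) (Z : Finset V) (s : Fin r → Bool) : Finset V :=
  Z ∪ Finset.univ.image (selFn a b s)

/-- The sign of a selection. -/
def selSign {r : ℕ} (s : Fin r → Bool) : ℝ := ∏ i, (if s i then (-1 : ℝ) else 1)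

/-- The local difference. -/
def locD (f : Finset V → ℝ) {r : ℕ} (a b : Fin r → V) (Z : Finset V) : ℝ :=
  ∑ s : Fin r → Bool, selSign s * f (selSet a b Z s)

lemma selFn_inj {r : ℕ} {a b : Fin r → V} (h : Function.Injective (Sum.elim a b))
    (s : Fin r → Bool) : Function.Injective (selFn a b s) := by
  intro i j hij
  unfold selFn at hij
  split_ifs at hij
  · have := @h (Sum.inr i) (Sum.inr j) hij
    simpa using this
  · have := @h (Sum.inr i) (Sum.inl j) hij
    simp at this
  · have := @h (Sum.inl i) (Sum.inr j) hij
    simp at this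
  · have := @h (Sum.inl i) (Sum.inl j) hij
    simpa using this

/-- All vertices used by the pairs. -/
def pairU {r : ℕ} (a b : Fin r → V) : Finset V :=
  Finset.univ.image a ∪ Finset.univ.image b

lemma selFn_mem {r : ℕ} (a b : Fin r → V) (s : Fin r → Bool) (i : Fin r) :
    selFn a b s i ∈ pairU a b := by
  unfold selFn pairU
  split_ifs <;> simp

lemma selSet_card {r : ℕ} {a b : Fin r → V} (h : Function.Injective (Sum.elim a b))
    {Z : Finset V} (hZ : Disjoint Z (pairU a b)) (s : Fin r → Bool) :
    (selSet a b Z s).card = Z.card + r := by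
  unfold selSet
  rw [Finset.card_union_of_disjoint, Finset.card_image_of_injective _ (selFn_inj h s)]
  · simp
  · refine Finset.disjoint_of_subset_right ?_ hZ
    intro x hx
    rw [Finset.mem_image] at hx
    obtain ⟨i, -, rfl⟩ := hx
    exact selFn_mem a b s i

lemma locD_cons (f : Finset V → ℝ) {r : ℕ} (a b : Fin r → V) (Z : Finset V) (x y : V) :
    locD f (Fin.cons x a : Fin (r+1) → V) (Fin.cons y b) Z
      = locD f a b (insert x Z) - locD f a b (insert y Z) := by
  unfold locD
  rw [← (Fin.consEquiv (fun _ : Fin (r+1) => Bool)).sum_comp, Fintype.sum_prod_type,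
    Fintype.sum_bool, sub_eq_add_neg, add_comm, ← Finset.sum_neg_distrib]
  have key : ∀ (c : Bool) (s : Fin r → Bool),
      selSet (Fin.cons x a : Fin (r+1) → V) (Fin.cons y b) Z
        (Fin.cons c s : Fin (r+1) → Bool) = selSet a b (insert (if c then y else x) Z) s := by
    intro c s
    ext z
    simp only [selSet, selFn, Finset.mem_union, Finset.mem_image, Finset.mem_univ, true_and,
      Fin.exists_fin_succ, Fin.cons_zero, Fin.cons_succ, Finset.mem_insert]
    constructor
    · rintro (h | h | h)
      · tauto
      · exact Or.inl (Or.inl h.symm)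
      · tauto
    · rintro ((h | h) | h)
      · exact Or.inr (Or.inl h.symm)
      · tauto
      · tauto
  have key2 : ∀ (c : Bool) (s : Fin r → Bool),
      selSign (Fin.cons c s : Fin (r+1) → Bool) = (if c then -1 else 1) * selSign s := by
    intro c s
    simp [selSign, Fin.prod_univ_succ]
  congr 1
  · apply Finset.sum_congr rfl
    intro s _
    change selSign (Fin.cons false s : Fin (r+1) → Bool) * f (selSet _ _ _ (Fin.cons false s)) = _
    rw [key, key2]; simp
  · apply Finset.sum_congr rfl
    intro s _
    change selSign (Fin.cons true s : Fin (r+1) → Bool) * f (selSet _ _ _ (Fin.cons true s)) = _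
    rw [key, key2]; simp

lemma selSet_mem_b {r : ℕ} {a b : Fin r → V} (h : Function.Injective (Sum.elim a b))
    {Z : Finset V} (hZ : Disjoint Z (pairU a b)) (s : Fin r → Bool) (i : Fin r) :
    b i ∈ selSet a b Z s ↔ s i = true := by
  have hb : b i ∉ Z := fun hz => (Finset.disjoint_left.mp hZ hz) (by simp [pairU])
  simp only [selSet, Finset.mem_union, hb, false_or, Finset.mem_image, Finset.mem_univ, true_and,
    selFn]
  constructor
  · rintro ⟨j, hj⟩
    split_ifs at hj with hs
    · have := @h (Sum.inr j) (Sum.inr i) hj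
      simp at this
      exact this ▸ hs
    · have := @h (Sum.inl j) (Sum.inr i) hj
      simp at this
  · intro hs
    exact ⟨i, by simp [hs]⟩

lemma selSet_mem_a {r : ℕ} {a b : Fin r → V} (h : Function.Injective (Sum.elim a b))
    {Z : Finset V} (hZ : Disjoint Z (pairU a b)) (s : Fin r → Bool) (i : Fin r) :
    a i ∈ selSet a b Z s ↔ s i = false := by
  have hb : a i ∉ Z := fun hz => (Finset.disjoint_left.mp hZ hz) (by simp [pairU])
  simp only [selSet, Finset.mem_union, hb, false_or, Finset.mem_image, Finset.mem_univ, true_and,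
    selFn]
  constructor
  · rintro ⟨j, hj⟩
    split_ifs at hj with hs
    · have := @h (Sum.inr j) (Sum.inl i) hj
      simp at this
    · have := @h (Sum.inl j) (Sum.inl i) hj
      simp at this
      subst this
      simpa using hs
  · intro hs
    exact ⟨i, by simp [hs]⟩

lemma inter_pair_card {R : Finset V} {x y : V} (hxy : x ≠ y) :
    (R ∩ {x, y}).card = 1 ↔ (x ∈ R ↔ y ∉ R) := by
  by_cases hx : x ∈ R <;> by_cases hy : y ∈ R
  · rw [Finset.inter_eq_right.mpr (by intro z; simp; rintro (rfl | rfl) <;> assumption),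
      Finset.card_pair hxy]
    simp [hx, hy]
  · have : R ∩ {x, y} = {x} := by
      ext z; simp; constructor
      · rintro ⟨h, rfl | rfl⟩ <;> tauto
      · rintro rfl; tauto
    simp [this, hx, hy]
  · have : R ∩ {x, y} = {y} := by
      ext z; simp; constructor
      · rintro ⟨h, rfl | rfl⟩ <;> tauto
      · rintro rfl; tauto
    simp [this, hx, hy]
  · have : R ∩ {x, y} = ∅ := by
      ext z; simp; rintro h
      constructor
      · rintro rfl; tauto
      · rintro rfl; tauto
    simp [this, hx, hy]

lemma selSign_eq {r : ℕ} {a b : Fin r → V} (h : Function.Injective (Sum.elim a b))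
    {Z : Finset V} (hZ : Disjoint Z (pairU a b)) (s : Fin r → Bool) :
    (-1 : ℝ) ^ (selSet a b Z s ∩ Finset.image b Finset.univ).card = selSign s := by
  have hbinj : Function.Injective b := fun i j hij => by
    have := @h (Sum.inr i) (Sum.inr j) hij
    simpa using this
  have : selSet a b Z s ∩ Finset.image b Finset.univ
      = (Finset.univ.filter (fun i => s i = true)).image b := by
    ext z
    simp only [Finset.mem_inter, Finset.mem_image, Finset.mem_univ, true_and, Finset.mem_filter]
    constructor
    · rintro ⟨h1, i, rfl⟩
      exact ⟨i, (selSet_mem_b h hZ s i).mp h1, rfl⟩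
    · rintro ⟨i, hi, rfl⟩
      exact ⟨(selSet_mem_b h hZ s i).mpr hi, i, rfl⟩
  rw [this, Finset.card_image_of_injective _ hbinj, selSign, Finset.prod_ite]
  simp

lemma cross_sum (k : ℕ) (f : Finset V → ℝ) {r : ℕ} (hr : r ≤ k) {a b : Fin r → V}
    (h : Function.Injective (Sum.elim a b)) :
    ∑ R ∈ (Finset.univ.powersetCard k).filter
      (fun R => ∀ i, (R ∩ {a i, b i}).card = 1),
      (-1 : ℝ) ^ (R ∩ Finset.image b Finset.univ).card * f R
    = ∑ Z ∈ (pairU a b)ᶜ.powersetCard (k - r), locD f a b Z := by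
  unfold locD
  rw [← Finset.sum_product' ((pairU a b)ᶜ.powersetCard (k - r)) Finset.univ
    (fun Z s => selSign s * f (selSet a b Z s))]
  symm
  have hab : ∀ i, a i ≠ b i := fun i hi => by
    have := @h (Sum.inl i) (Sum.inr i) hi
    simp at this
  have hdis : ∀ Z : Finset V, Z ⊆ (pairU a b)ᶜ → Disjoint Z (pairU a b) := fun Z hZ =>
    Finset.disjoint_left.mpr (fun x hx => by simpa using hZ hx)
  have hback : ∀ R : Finset V, (∀ i, (R ∩ {a i, b i}).card = 1) →
      selSet a b (R \ pairU a b) (fun i => decide (b i ∈ R)) = R := by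
    intro R hR
    have hR' : ∀ i, (a i ∈ R ↔ b i ∉ R) := fun i => (inter_pair_card (hab i)).mp (hR i)
    ext z
    simp only [selSet, selFn, Finset.mem_union, Finset.mem_sdiff, pairU, Finset.mem_image,
      Finset.mem_univ, true_and, decide_eq_true_eq]
    constructor
    · rintro (h1 | ⟨i, hi⟩)
      · exact h1.1
      · split_ifs at hi with h2
        · exact hi ▸ h2
        · exact hi ▸ (hR' i).mpr h2
    · intro hz
      by_cases hu : (∃ i, a i = z) ∨ ∃ i, b i = z
      · right
        rcases hu with ⟨i, rfl⟩ | ⟨i, rfl⟩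
        · exact ⟨i, by rw [if_neg ((hR' i).mp hz)]⟩
        · exact ⟨i, by rw [if_pos hz]⟩
      · exact Or.inl ⟨hz, hu⟩
  refine Finset.sum_bij' (fun p _ => selSet a b p.1 p.2)
    (fun R _ => (R \ pairU a b, fun i => decide (b i ∈ R))) ?_ ?_ ?_ ?_ ?_
  · rintro ⟨Z, s⟩ hp
    simp only [Finset.mem_product, Finset.mem_powersetCard, Finset.mem_univ, and_true] at hp
    have hd := hdis Z hp.1
    simp only [Finset.mem_filter, Finset.mem_powersetCard, Finset.subset_univ, true_and]
    refine ⟨by rw [selSet_card h hd, hp.2]; omega, fun i => ?_⟩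
    rw [inter_pair_card (hab i), selSet_mem_a h hd, selSet_mem_b h hd]
    simp
  · intro R hR
    simp only [Finset.mem_filter, Finset.mem_powersetCard, Finset.subset_univ, true_and] at hR
    have hsub : R \ pairU a b ⊆ (pairU a b)ᶜ := by
      intro x hx
      rw [Finset.mem_sdiff] at hx
      simpa using hx.2
    simp only [Finset.mem_product, Finset.mem_powersetCard, Finset.mem_univ, and_true]
    refine ⟨hsub, ?_⟩
    have hc := selSet_card h (hdis _ hsub) (fun i => decide (b i ∈ R))
    rw [hback R hR.2, hR.1] at hc
    omega
  · rintro ⟨Z, s⟩ hp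
    simp only [Finset.mem_product, Finset.mem_powersetCard, Finset.mem_univ, and_true] at hp
    have hd := hdis Z hp.1
    ext z
    · simp only [Finset.mem_sdiff]
      constructor
      · rintro ⟨h1, h2⟩
        rw [selSet, Finset.mem_union] at h1
        rcases h1 with h1 | h1
        · exact h1
        · rw [Finset.mem_image] at h1
          obtain ⟨i, -, rfl⟩ := h1
          exact absurd (selFn_mem a b s i) h2
      · intro hz
        exact ⟨by rw [selSet, Finset.mem_union]; exact Or.inl hz,
          Finset.disjoint_left.mp hd hz⟩
    · simp only [selSet_mem_b h hd]
      simp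
  · intro R hR
    simp only [Finset.mem_filter, Finset.mem_powersetCard, Finset.subset_univ, true_and] at hR
    exact hback R hR.2
  · rintro ⟨Z, s⟩ hp
    simp only [Finset.mem_product, Finset.mem_powersetCard, Finset.mem_univ, and_true] at hp
    rw [selSign_eq h (hdis Z hp.1)]

lemma cross_zero {k r : ℕ} {f : Finset V → ℝ} (hW : Wpow k r f = 0) {a b : Fin r → V}
    (h : Function.Injective (Sum.elim a b)) :
    ∑ R ∈ (Finset.univ.powersetCard k).filter
      (fun R => ∀ i, (R ∩ {a i, b i}).card = 1),
      (-1 : ℝ) ^ (R ∩ Finset.image b Finset.univ).card * f R = 0 := by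
  unfold Wpow at hW
  have hmem : (a, b) ∈ (Finset.univ : Finset ((Fin r → V) × (Fin r → V))).filter
        (fun p => Function.Injective (Sum.elim p.1 p.2)) := by simpa using h
  rw [Real.sqrt_eq_zero (by positivity), div_eq_zero_iff] at hW
  rcases hW with hW | hW
  · rw [Finset.sum_eq_zero_iff_of_nonneg (fun _ _ => sq_nonneg _)] at hW
    have h1 := hW _ hmem
    rw [sq_eq_zero_iff, signedAvg, div_eq_zero_iff] at h1
    rcases h1 with h1 | h1
    · exact h1
    · rw [Nat.cast_eq_zero, Finset.card_eq_zero] at h1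
      simp only at h1
      rw [h1, Finset.sum_empty]
  · rw [Nat.cast_eq_zero, Finset.card_eq_zero] at hW
    rw [hW] at hmem
    simp at hmem

lemma locD_zero {k d : ℕ} {f : Finset V → ℝ}
    (hW : ∀ r : ℕ, d ≤ r → r ≤ k → Wpow k r f = 0) :
    ∀ n r : ℕ, r + n = k → d ≤ r → ∀ a b : Fin r → V, Function.Injective (Sum.elim a b) →
      ∀ Z : Finset V, Disjoint Z (pairU a b) → Z.card = n → locD f a b Z = 0 := by
  intro n
  induction n with
  | zero =>
    intro r hrk hd a b h Z hZ hc
    have h0 := cross_zero (hW r hd (by omega)) h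
    rw [cross_sum k f (by omega) h] at h0
    have : k - r = 0 := by omega
    rw [this] at h0
    rw [Finset.card_eq_zero] at hc
    simpa [hc] using h0
  | succ n ih =>
    intro r hrk hd a b h Z hZ hc
    have swap : ∀ (Y : Finset V) (x y : V), x ∉ Y → y ∉ Y → x ≠ y →
        Disjoint (insert x Y) (pairU a b) → Disjoint (insert y Y) (pairU a b) →
        Y.card = n → locD f a b (insert x Y) = locD f a b (insert y Y) := by
      intro Y x y hx hy hxy hdx hdy hY
      rw [← sub_eq_zero, ← locD_cons]
      rw [Finset.disjoint_insert_left] at hdx hdy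
      have hxa : ∀ i, a i ≠ x := fun i hi => hdx.1 (by simp [pairU, ← hi])
      have hxb : ∀ i, b i ≠ x := fun i hi => hdx.1 (by simp [pairU, ← hi])
      have hya : ∀ i, a i ≠ y := fun i hi => hdy.1 (by simp [pairU, ← hi])
      have hyb : ∀ i, b i ≠ y := fun i hi => hdy.1 (by simp [pairU, ← hi])
      have ha : Function.Injective a := fun i j hij => by
        have := @h (Sum.inl i) (Sum.inl j) hij
        simpa using this
      have hb : Function.Injective b := fun i j hij => by
        have := @h (Sum.inr i) (Sum.inr j) hij
        simpa using this
      have hab : ∀ i j, a i ≠ b j := fun i j hi => by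
        have := @h (Sum.inl i) (Sum.inr j) hi
        simp at this
      refine ih (r + 1) (by omega) (by omega) _ _ ?_ Y ?_ hY
      · rw [Sum.elim_injective]
        refine ⟨?_, ?_, ?_⟩
        · rw [Fin.cons_injective_iff]
          exact ⟨by rintro ⟨i, hi⟩; exact hxa i hi, ha⟩
        · rw [Fin.cons_injective_iff]
          exact ⟨by rintro ⟨i, hi⟩; exact hyb i hi, hb⟩
        · intro i j
          refine Fin.cases ?_ (fun i => ?_) i <;> refine Fin.cases ?_ (fun j => ?_) j
          · simpa using hxy
          · simpa using (hxb j).symm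
          · simpa using hya i
          · simpa using hab i j
      · rw [Finset.disjoint_left]
        intro z hz hzu
        have hzn := Finset.disjoint_left.mp hdx.2 hz
        simp only [pairU, Finset.mem_union, Finset.mem_image, Finset.mem_univ, true_and,
          Fin.exists_fin_succ, Fin.cons_zero, Fin.cons_succ] at hzu hzn
        rcases hzu with (rfl | h1) | (rfl | h1) <;> tauto
    have conn : ∀ m : ℕ, ∀ Y Y' : Finset V, (Y \ Y').card = m → Y.card = n + 1 → Y'.card = n + 1 →
        Disjoint Y (pairU a b) → Disjoint Y' (pairU a b) →
        locD f a b Y = locD f a b Y' := by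
      intro m
      induction m with
      | zero =>
        intro Y Y' h0 h1 h2 _ _
        rw [Finset.card_eq_zero, Finset.sdiff_eq_empty_iff_subset] at h0
        rw [Finset.eq_of_subset_of_card_le h0 (by omega)]
      | succ m ihm =>
        intro Y Y' h0 h1 h2 hd1 hd2
        have hx : (Y \ Y').Nonempty := by rw [← Finset.card_pos]; omega
        have hy : (Y' \ Y).Nonempty := by
          rw [← Finset.card_pos]
          have e1 := Finset.card_sdiff_add_card_inter Y Y'
          have e2 := Finset.card_sdiff_add_card_inter Y' Y
          rw [Finset.inter_comm] at e2
          omega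
        obtain ⟨x, hx⟩ := hx
        obtain ⟨y, hy⟩ := hy
        have hx0 := hx
        rw [Finset.mem_sdiff] at hx hy
        have hYx : insert x (Y.erase x) = Y := Finset.insert_erase hx.1
        have hdy : Disjoint (insert y (Y.erase x)) (pairU a b) := by
          rw [Finset.disjoint_insert_left]
          exact ⟨Finset.disjoint_left.mp hd2 hy.1,
            Finset.disjoint_of_subset_left (Finset.erase_subset _ _) hd1⟩
        have hye : y ∉ Y.erase x := fun hh => hy.2 (Finset.mem_of_mem_erase hh)
        have hce : (Y.erase x).card = n := by
          rw [Finset.card_erase_of_mem hx.1]; omega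
        have s1 := swap (Y.erase x) x y (Finset.notMem_erase _ _)
          hye (by rintro rfl; exact hy.2 hx.1) (by rw [hYx]; exact hd1) hdy hce
        rw [hYx] at s1
        rw [s1]
        apply ihm _ _ _ _ h2 hdy hd2
        · have : insert y (Y.erase x) \ Y' = (Y \ Y').erase x := by
            ext z
            simp only [Finset.mem_sdiff, Finset.mem_insert, Finset.mem_erase]
            constructor
            · rintro ⟨rfl | h3, h4⟩
              · exact absurd hy.1 h4
              · tauto
            · tauto
          rw [this, Finset.card_erase_of_mem hx0]; omega
        · rw [Finset.card_insert_of_notMem hye, hce]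
    have h0 := cross_zero (hW r hd (by omega)) h
    rw [cross_sum k f (by omega) h] at h0
    have hkr : k - r = n + 1 := by omega
    have hmemZ : Z ∈ (pairU a b)ᶜ.powersetCard (k - r) := by
      rw [Finset.mem_powersetCard]
      refine ⟨fun z hz => ?_, by omega⟩
      simpa using Finset.disjoint_left.mp hZ hz
    have hall : ∀ Y ∈ (pairU a b)ᶜ.powersetCard (k - r), locD f a b Y = locD f a b Z := by
      intro Y hY
      rw [Finset.mem_powersetCard] at hY
      refine conn _ Y Z rfl (by omega) hc ?_ hZ
      exact Finset.disjoint_left.mpr (fun x hx => by simpa using hY.1 hx)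
    rw [Finset.sum_congr rfl hall, Finset.sum_const, nsmul_eq_mul, mul_eq_zero] at h0
    rcases h0 with h0 | h0
    · rw [Nat.cast_eq_zero, Finset.card_eq_zero] at h0
      rw [h0] at hmemZ
      simp at hmemZ
    · exact h0

end local_part

/-- The assignment equal to `q` on `W`, to `j` on `T` and to `o` elsewhere. -/
def lineFn {k t : ℕ} (o j : Fin t) (q : Fin k → Fin t) (W T : Finset (Fin k)) (l : Fin k) : Fin t :=
  if l ∈ W then q l else if l ∈ T then j else o

lemma lineFn_count {k t : ℕ} (o j : Fin t) (q : Fin k → Fin t) (W T : Finset (Fin k))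
    (hT : T ⊆ Wᶜ) (i : Fin t) :
    (Finset.univ.filter (fun l => lineFn o j q W T l = i)).card
      = (∑ l ∈ W, if q l = i then 1 else 0) + ((Wᶜ.card - T.card) * (if o = i then 1 else 0)
        + T.card * (if j = i then 1 else 0)) := by
  rw [Finset.card_filter, ← Finset.sum_add_sum_compl W, ← Finset.sum_sdiff hT]
  congr 1
  · apply Finset.sum_congr rfl
    intro l hl
    simp [lineFn, hl]
  congr 1
  · rw [← Finset.card_sdiff_of_subset hT, ← smul_eq_mul, ← Finset.sum_const]
    apply Finset.sum_congr rfl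
    intro l hl
    rw [Finset.mem_sdiff, Finset.mem_compl] at hl
    simp [lineFn, hl.1, hl.2]
  · rw [← smul_eq_mul, ← Finset.sum_const]
    apply Finset.sum_congr rfl
    intro l hl
    have := hT hl
    rw [Finset.mem_compl] at this
    simp [lineFn, this, hl]

lemma trans_const (k t : ℕ) (o : Fin t) (h : (Fin k → Fin t) → Bool)
    (hsym : ∀ q q' : Fin k → Fin t, (∀ i, (Finset.univ.filter (fun l => q l = i)).card
      = (Finset.univ.filter (fun l => q' l = i)).card) → h q = h q')
    (hD : ∀ (A : Finset (Fin k)) (q : Fin k → Fin t), k - gDef k ≤ A.card →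
      (∀ l ∈ A, q l ≠ o) →
      ∑ T ∈ A.powerset, (-1 : ℤ) ^ T.card *
        (if h (fun l => if l ∈ T then q l else o) then 1 else 0) = 0) :
    ∀ (w : ℕ) (q : Fin k → Fin t) (j : Fin t), j ≠ o →
      (Finset.univ.filter (fun l => q l ≠ o ∧ q l ≠ j)).card = w → h q = h (fun _ => o) := by
  classical
  intro w
  induction w using Nat.strong_induction_on with
  | _ w ih =>
  intro q j hj hw
  set W := Finset.univ.filter (fun l => q l ≠ o ∧ q l ≠ j) with hWdef
  have hWm : ∀ l, l ∈ W ↔ q l ≠ o ∧ q l ≠ j := by intro l; simp [hWdef]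
  have hline : ∀ T T' : Finset (Fin k), T ⊆ Wᶜ → T' ⊆ Wᶜ → T.card = T'.card →
      h (lineFn o j q W T) = h (lineFn o j q W T') := by
    intro T T' hT hT' hc
    apply hsym
    intro i
    rw [lineFn_count o j q W T hT, lineFn_count o j q W T' hT', hc]
  set α : ℕ → Bool := fun i => decide (∃ T, T ⊆ Wᶜ ∧ T.card = i ∧ h (lineFn o j q W T) = true)
    with hα
  have hαe : ∀ T : Finset (Fin k), T ⊆ Wᶜ → α T.card = h (lineFn o j q W T) := by
    intro T hT
    by_cases hh : h (lineFn o j q W T) = true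
    · rw [hh]
      simp only [hα, decide_eq_true_eq]
      exact ⟨T, hT, rfl, hh⟩
    · rw [Bool.not_eq_true] at hh
      rw [hh]
      simp only [hα, decide_eq_false_iff_not]
      rintro ⟨T', hT', hc, h1⟩
      rw [hline T' T hT' hT hc, hh] at h1
      exact absurd h1 (by simp)
  have hWk : W.card + Wᶜ.card = k := by
    rw [Finset.card_add_card_compl, Fintype.card_fin]
  set c : ℤ := if h (fun _ => o) then 1 else 0 with hcdef
  have hconst := alpha_const k Wᶜ.card (by omega) α (by
    intro r hr1 hr2 hr3
    obtain ⟨B, hB, hBc⟩ := Finset.exists_subset_card_eq hr3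
    have hdis : Disjoint W B := by
      rw [Finset.disjoint_left]
      intro x hx hxB
      have := hB hxB
      rw [Finset.mem_compl] at this
      exact this hx
    have hAc : (W ∪ B).card = W.card + r := by
      rw [Finset.card_union_of_disjoint hdis, hBc]
    have h0 := hD (W ∪ B) (lineFn o j q W B) (by omega) (by
      intro l hl
      by_cases hlW : l ∈ W
      · simp only [lineFn, hlW, if_true]
        exact ((hWm l).mp hlW).1
      · have hlB : l ∈ B := by
          rw [Finset.mem_union] at hl; tauto
        simp only [lineFn, hlW, hlB, if_true, if_false]
        exact hj)
    have h1 : ∑ T ∈ (W ∪ B).powerset, (-1 : ℤ) ^ T.card = 0 := by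
      apply Finset.sum_powerset_neg_one_pow_card_of_nonempty
      rw [← Finset.card_pos]; omega
    have h2 : ∑ T ∈ (W ∪ B).powerset, (-1 : ℤ) ^ T.card *
        ((if h (fun l => if l ∈ T then lineFn o j q W B l else o) then 1 else 0) - c) = 0 := by
      simp only [mul_sub, Finset.sum_sub_distrib]
      rw [h0, ← Finset.sum_mul, h1]; simp
    have h3 : ∑ T ∈ B.powerset.image (fun T => W ∪ T), (-1 : ℤ) ^ T.card *
        ((if h (fun l => if l ∈ T then lineFn o j q W B l else o) then 1 else 0) - c) = 0 := by
      refine Eq.trans ?_ h2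
      apply Finset.sum_subset
      · intro T hT
        rw [Finset.mem_image] at hT
        obtain ⟨T', hT', rfl⟩ := hT
        rw [Finset.mem_powerset] at hT' ⊢
        exact Finset.union_subset_union_right hT'
      · intro T hT hTn
        rw [Finset.mem_powerset] at hT
        have hWT : ¬ W ⊆ T := by
          intro hWT
          apply hTn
          rw [Finset.mem_image]
          refine ⟨T \ W, ?_, ?_⟩
          · rw [Finset.mem_powerset]
            intro x hx
            rw [Finset.mem_sdiff] at hx
            have := hT hx.1
            rw [Finset.mem_union] at this
            tauto
          · simpa using hWT
        have : h (fun l => if l ∈ T then lineFn o j q W B l else o) = h (fun _ => o) := by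
          apply ih _ _ _ j hj rfl
          rw [← hw]
          apply Finset.card_lt_card
          rw [Finset.ssubset_iff_of_subset]
          · obtain ⟨x, hx, hxT⟩ := Finset.not_subset.mp hWT
            refine ⟨x, hx, ?_⟩
            simp [hxT]
          · intro x hx
            simp only [Finset.mem_filter, Finset.mem_univ, true_and] at hx
            by_contra hxW
            by_cases hxT : x ∈ T
            · simp only [hxT, if_true, lineFn, hxW, if_false] at hx
              split_ifs at hx <;> tauto
            · simp [hxT] at hx
        rw [this]
        simp [hcdef]
    rw [Finset.sum_image] at h3
    swap
    · intro T hT T' hT' he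
      simp only [Finset.coe_powerset, Set.mem_preimage, Set.mem_powerset_iff,
        Finset.coe_subset] at hT hT'
      have e1 : (W ∪ T) \ W = T := by
        rw [Finset.union_sdiff_cancel_left]
        exact Finset.disjoint_of_subset_right hT hdis
      have e2 : (W ∪ T') \ W = T' := by
        rw [Finset.union_sdiff_cancel_left]
        exact Finset.disjoint_of_subset_right hT' hdis
      simp only at he
      rw [← e1, he, e2]
    have h4 : ∑ T ∈ B.powerset, (-1 : ℤ) ^ W.card *
        ((fun i => (-1 : ℤ) ^ i * ((if α i then 1 else 0) - c)) T.card) = 0 := by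
      refine Eq.trans ?_ h3
      apply Finset.sum_congr rfl
      intro T hT
      rw [Finset.mem_powerset] at hT
      have e1 : (fun l => if l ∈ W ∪ T then lineFn o j q W B l else o) = lineFn o j q W T := by
        funext l
        by_cases hlW : l ∈ W
        · simp [hlW, lineFn]
        · by_cases hlT : l ∈ T
          · simp [hlW, hlT, hT hlT, lineFn]
          · simp [hlW, hlT, lineFn]
      rw [e1, Finset.card_union_of_disjoint (Finset.disjoint_of_subset_right hT hdis), pow_add,
        ← hαe T (hT.trans hB), mul_assoc]
    rw [← Finset.mul_sum, mul_eq_zero] at h4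
    rcases h4 with h4 | h4
    · exact absurd h4 (pow_ne_zero _ (by norm_num))
    rw [Finset.sum_powerset_apply_card (fun i => (-1 : ℤ) ^ i * ((if α i then 1 else 0) - c)),
      hBc] at h4
    have h5 := alt_sum_const r hr1 c
    have h6 : ∑ i ∈ Finset.range (r + 1),
          (-1 : ℤ) ^ i * (r.choose i) * (if α i then 1 else 0)
        = (∑ i ∈ Finset.range (r + 1),
            r.choose i • ((-1 : ℤ) ^ i * ((if α i then 1 else 0) - c)))
          + ∑ i ∈ Finset.range (r + 1), (-1 : ℤ) ^ i * (r.choose i) * c := by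
      rw [← Finset.sum_add_distrib]
      apply Finset.sum_congr rfl
      intro i _
      rw [nsmul_eq_mul]
      ring
    rw [h6, h4, h5, add_zero])
  have hq : q = lineFn o j q W (Finset.univ.filter (fun l => q l = j)) := by
    funext l
    unfold lineFn
    split_ifs with h1 h2
    · rfl
    · simpa using h2
    · rw [hWm] at h1
      simp only [Finset.mem_filter, Finset.mem_univ, true_and] at h2
      tauto
  have hsub : (Finset.univ.filter (fun l => q l = j)) ⊆ Wᶜ := by
    intro l hl
    simp only [Finset.mem_filter, Finset.mem_univ, true_and] at hl
    rw [Finset.mem_compl, hWm]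
    tauto
  have e1 : h q = h (lineFn o j q W ∅) := by
    rw [← hαe ∅ (by simp)]
    conv_lhs => rw [hq]
    rw [← hαe _ hsub, Finset.card_empty]
    exact hconst _ (Finset.card_le_card hsub)
  rw [e1]
  rcases W.eq_empty_or_nonempty with hWe | ⟨l, hl⟩
  · congr 1
    funext l
    simp [lineFn, hWe]
  · have hl' := (hWm l).mp hl
    refine ih _ ?_ _ (q l) hl'.1 rfl
    rw [← hw]
    apply Finset.card_lt_card
    rw [Finset.ssubset_iff_of_subset]
    · exact ⟨l, hl, by simp [lineFn, hl]⟩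
    · intro x hx
      simp only [Finset.mem_filter, Finset.mem_univ, true_and] at hx
      by_contra hxW
      simp [lineFn, hxW] at hx

theorem stmt18 (k t : ℕ) (hk : 2 ≤ k) (ht : 2 ≤ t)
    (F : Finset (Finset (Fin (t * k)))) (parts : Fin t → Finset (Fin (t * k)))
    (hunif : ∀ e ∈ F, e.card = k)
    (hcard : ∀ i, (parts i).card = k)
    (hdisj : ∀ i j, i ≠ j → Disjoint (parts i) (parts j))
    (hpat : ∀ S T : Finset (Fin (t * k)), S.card = k → T.card = k →
      (∀ i, (S ∩ parts i).card = (T ∩ parts i).card) → (S ∈ F ↔ T ∈ F))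
    (hW : ∀ r : ℕ, k - gDef k ≤ r → r ≤ k → Wpow k r (hyperInd F) = 0) :
    (∀ S : Finset (Fin (t * k)), S.card = k → S ∈ F) ∨
    (∀ S : Finset (Fin (t * k)), S.card = k → S ∉ F) := by
  classical
  have ht0 : 0 < t := by omega
  set o : Fin t := ⟨0, ht0⟩ with ho
  set v : Fin t → Fin k → Fin (t * k) := fun i => (parts i).orderEmbOfFin (hcard i) with hv
  have hvm : ∀ i l, v i l ∈ parts i := fun i l => Finset.orderEmbOfFin_mem _ _ _
  have hpart : ∀ x i j, x ∈ parts i → x ∈ parts j → i = j := by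
    intro x i j hi hj
    by_contra hij
    exact Finset.disjoint_left.mp (hdisj i j hij) hi hj
  have hvinj : ∀ i l i' l', v i l = v i' l' → i = i' ∧ l = l' := by
    intro i l i' l' he
    have hii : i = i' := hpart (v i l) i i' (hvm i l) (he ▸ hvm i' l')
    subst hii
    exact ⟨rfl, ((parts i).orderEmbOfFin (hcard i)).injective he⟩
  set S : (Fin k → Fin t) → Finset (Fin (t * k)) :=
    fun q => Finset.univ.image (fun l => v (q l) l) with hS
  have hSinj : ∀ q : Fin k → Fin t, Function.Injective (fun l => v (q l) l) :=
    fun q l l' he => (hvinj _ _ _ _ he).2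
  have hScard : ∀ q, (S q).card = k := by
    intro q
    rw [hS]
    simp only
    rw [Finset.card_image_of_injective _ (hSinj q)]
    simp
  have hSprof : ∀ q i, (S q ∩ parts i).card = (Finset.univ.filter (fun l => q l = i)).card := by
    intro q i
    rw [← Finset.card_image_of_injective _ (hSinj q)]
    congr 1
    ext x
    simp only [hS, Finset.mem_inter, Finset.mem_image, Finset.mem_univ, true_and,
      Finset.mem_filter]
    constructor
    · rintro ⟨⟨l, rfl⟩, h2⟩
      exact ⟨l, hpart _ _ _ (hvm _ _) h2, rfl⟩
    · rintro ⟨l, rfl, rfl⟩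
      exact ⟨⟨l, rfl⟩, hvm _ _⟩
  have hcover : ∀ x, ∃ i, x ∈ parts i := by
    have hU : Finset.univ.biUnion parts = Finset.univ := by
      apply Finset.eq_univ_of_card
      rw [Finset.card_biUnion (fun i _ j _ hij => hdisj i j hij)]
      simp [hcard]
    intro x
    have : x ∈ Finset.univ.biUnion parts := by rw [hU]; simp
    simpa using this
  choose p hp using hcover
  have hreach : ∀ R : Finset (Fin (t * k)), R.card = k →
      ∃ q : Fin k → Fin t, (R ∈ F ↔ S q ∈ F) := by
    intro R hR
    refine ⟨fun l => p (R.orderEmbOfFin hR l), hpat _ _ hR (hScard _) ?_⟩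
    intro i
    rw [hSprof, ← Finset.card_image_of_injective _ (R.orderEmbOfFin hR).injective]
    congr 1
    ext x
    simp only [Finset.mem_inter, Finset.mem_image, Finset.mem_filter, Finset.mem_univ, true_and]
    constructor
    · rintro ⟨hx, hxi⟩
      have : x ∈ Set.range (R.orderEmbOfFin hR) := by
        rw [Finset.range_orderEmbOfFin]; exact hx
      obtain ⟨l, rfl⟩ := this
      exact ⟨l, hpart _ _ _ (hp _) hxi, rfl⟩
    · rintro ⟨l, rfl, rfl⟩
      exact ⟨Finset.orderEmbOfFin_mem _ _ _, hp _⟩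
  have hmain : ∀ q : Fin k → Fin t, decide (S q ∈ F) = decide (S (fun _ => o) ∈ F) := by
    intro q
    have key := trans_const k t o (fun q => decide (S q ∈ F)) ?_ ?_
    · refine key _ q ⟨1, by omega⟩ (by simp [ho]) rfl
    · intro q q' hqq
      simp only [decide_eq_decide]
      refine hpat _ _ (hScard _) (hScard _) (fun i => ?_)
      rw [hSprof, hSprof, hqq]
    · intro A q hA hq
      set e : Fin A.card → Fin k := fun i => A.orderEmbOfFin rfl i with he
      have heinj : Function.Injective e := (A.orderEmbOfFin rfl).injective
      have hem : ∀ i, e i ∈ A := fun i => Finset.orderEmbOfFin_mem _ _ _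
      have hesur : ∀ l ∈ A, ∃ i, e i = l := by
        intro l hl
        have : l ∈ Set.range (A.orderEmbOfFin rfl) := by
          rw [Finset.range_orderEmbOfFin]; exact hl
        exact this
      have hAk : A.card ≤ k := by simpa using Finset.card_le_univ A
      have h0 := locD_zero hW (k - A.card) A.card (by omega) hA
        (fun i => v o (e i)) (fun i => v (q (e i)) (e i)) ?_ (Aᶜ.image (v o)) ?_ ?_
      · have h1 : ∑ T ∈ A.powerset, (-1 : ℝ) ^ T.card *
            hyperInd F (S (fun l => if l ∈ T then q l else o)) = 0 := by
          rw [← h0, locD]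
          symm
          refine Finset.sum_bij' (fun s _ => (Finset.univ.filter (fun i => s i = true)).image e)
            (fun T _ => fun i => decide (e i ∈ T)) ?_ ?_ ?_ ?_ ?_
          · intro s _
            rw [Finset.mem_powerset]
            intro x hx
            rw [Finset.mem_image] at hx
            obtain ⟨i, -, rfl⟩ := hx
            exact hem i
          · intro T _
            simp
          · intro s _
            funext i
            simp [heinj.eq_iff]
          · intro T hT
            rw [Finset.mem_powerset] at hT
            ext x
            simp only [Finset.mem_image, Finset.mem_filter, Finset.mem_univ, true_and,
              decide_eq_true_eq]
            constructor
            · rintro ⟨i, hi, rfl⟩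
              exact hi
            · intro hx
              obtain ⟨i, rfl⟩ := hesur x (hT hx)
              exact ⟨i, hx, rfl⟩
          · intro s _
            rw [Finset.card_image_of_injective _ heinj]
            congr 1
            · rw [selSign, Finset.prod_ite]
              simp
            · congr 1
              have hmem : ∀ i, e i ∈ (Finset.univ.filter (fun i => s i = true)).image e
                  ↔ s i = true := by
                intro i
                simp [heinj.eq_iff]
              ext x
              simp only [selSet, selFn, hS, Finset.mem_union, Finset.mem_image (f := v o),
                Finset.mem_compl, Finset.mem_image (s := Finset.univ), Finset.mem_univ, true_and]
              constructor
              · rintro (⟨l, hl, rfl⟩ | ⟨i, rfl⟩)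
                · refine ⟨l, ?_⟩
                  rw [if_neg]
                  intro hc
                  rw [Finset.mem_image] at hc
                  obtain ⟨i, -, rfl⟩ := hc
                  exact hl (hem i)
                · refine ⟨e i, ?_⟩
                  simp only [hmem]
                  split_ifs <;> rfl
              · rintro ⟨l, rfl⟩
                by_cases hl : l ∈ A
                · obtain ⟨i, rfl⟩ := hesur l hl
                  right
                  refine ⟨i, ?_⟩
                  simp only [hmem]
                  split_ifs <;> rfl
                · left
                  refine ⟨l, hl, ?_⟩
                  rw [if_neg]
                  intro hc
                  rw [Finset.mem_image] at hc
                  obtain ⟨i, -, rfl⟩ := hc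
                  exact hl (hem i)
        have h2 : ((∑ T ∈ A.powerset, (-1 : ℤ) ^ T.card *
            (if decide (S (fun l => if l ∈ T then q l else o) ∈ F) = true then 1 else 0) : ℤ) : ℝ)
            = 0 := by
          rw [← h1]
          push_cast
          apply Finset.sum_congr rfl
          intro T _
          simp [hyperInd]
        exact_mod_cast h2
      · rw [Sum.elim_injective]
        refine ⟨fun i j hij => heinj (hvinj _ _ _ _ hij).2,
          fun i j hij => heinj (hvinj _ _ _ _ hij).2, fun i j hij => ?_⟩
        exact hq _ (hem j) (hvinj _ _ _ _ hij).1.symm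
      · rw [Finset.disjoint_left]
        intro x hx hxu
        rw [Finset.mem_image] at hx
        obtain ⟨l, hl, rfl⟩ := hx
        rw [Finset.mem_compl] at hl
        simp only [pairU, Finset.mem_union, Finset.mem_image, Finset.mem_univ, true_and] at hxu
        rcases hxu with ⟨i, hi⟩ | ⟨i, hi⟩
        · exact hl ((hvinj _ _ _ _ hi).2 ▸ hem i)
        · exact hl ((hvinj _ _ _ _ hi).2 ▸ hem i)
      · rw [Finset.card_image_of_injective _ (fun l l' hh => (hvinj _ _ _ _ hh).2),
          Finset.card_compl, Fintype.card_fin]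
  by_cases hc : S (fun _ => o) ∈ F
  · left
    intro R hR
    obtain ⟨q, hq⟩ := hreach R hR
    rw [hq]
    have := hmain q
    simpa [hc] using this
  · right
    intro R hR
    obtain ⟨q, hq⟩ := hreach R hR
    rw [hq]
    have := hmain q
    simpa [hc] using this
end
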